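/- arXiv:2402.14138 — 3 statements merged into one kernel-verified Lean document; each statement's English description precedes it below -/
import Mathlib

section
/- Let θ be a classical solution of the IBVP with data (θ₀, f, g), where θ₀ ∈ C([0,L]) and f, g ∈ C([0,∞)) with θ₀(0) = f(0) and θ₀(L) = g(0). Then for every 0 < x < L and t > 0, θ(x,t) = (1/2π) ∫_ℝ e^{iλx − ω(λ)t} θ̂₀(λ) dλ + (i/π) e^{−K₀(2L−x)/(2D₀)} ∫_{∂D₊} (e^{iλL − ω(λ)t}/Δ(λ)) sin(x(λ + iK₀/(2D₀))) θ̂₀(λ) dλ + (i/π) e^{−K₀(L−x)/(2D₀)} ∫_{∂D₊} (e^{−ω(λ)t}/Δ(λ)) sin((L−x)(λ + iK₀/(2D₀))) θ̂₀(ν(λ)) dλ − (2D₀/π) e^{−K₀(L−x)/(2D₀)} ∫_{∂D₊} (e^{−ω(λ)t}/Δ(λ)) (λ + iK₀/(2D₀)) sin((L−x)(λ + iK₀/(2D₀))) f̃(ω(λ),t) dλ − (2D₀/π) e^{−K₀(2L−x)/(2D₀)} ∫_{∂D₊} (e^{−ω(λ)t}/Δ(λ)) (λ + iK₀/(2D₀))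 sin(x(λ + iK₀/(2D₀))) g̃(ω(λ),t) dλ, where θ̂₀(λ) = ∫₀^L e^{−iλξ} θ₀(ξ) dξ. -/
open MeasureTheory

/-- ω(λ) = D₀λ² + iK₀λ. -/
noncomputable def omegaF (D₀ K₀ : ℝ) (l : ℂ) : ℂ := (D₀ : ℂ) * l ^ 2 + Complex.I * (K₀ : ℂ) * l

/-- ν(λ) = −λ − iK₀/D₀. -/
noncomputable def nuF (D₀ K₀ : ℝ) (l : ℂ) : ℂ := -l - Complex.I * ((K₀ : ℂ) / (D₀ : ℂ))

/-- Δ(λ) = e^{−iλL} − e^{−iν(λ)L}. -/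
noncomputable def deltaF (D₀ K₀ L : ℝ) (l : ℂ) : ℂ :=
  Complex.exp (-Complex.I * l * (L : ℂ)) - Complex.exp (-Complex.I * nuF D₀ K₀ l * (L : ℂ))

/-- θ̂₀(λ) = ∫₀^L e^{−iλξ} θ₀(ξ) dξ. -/
noncomputable def hatF (L : ℝ) (θ₀ : ℝ → ℝ) (l : ℂ) : ℂ :=
  ∫ ξ in (0:ℝ)..L, Complex.exp (-Complex.I * l * (ξ : ℂ)) * (θ₀ ξ : ℂ)

/-- φ̃(λ,t) = ∫₀^t e^{λτ} φ(τ) dτ. -/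
noncomputable def tildeF (φ : ℝ → ℝ) (l : ℂ) (t : ℝ) : ℂ :=
  ∫ τ in (0:ℝ)..t, Complex.exp (l * (τ : ℂ)) * (φ τ : ℂ)

/-- b₊(a) = (−K₀ + √(K₀² + 4D₀²a²))/(2D₀). -/
noncomputable def bPlus (D₀ K₀ a : ℝ) : ℝ :=
  (-K₀ + Real.sqrt (K₀ ^ 2 + 4 * D₀ ^ 2 * a ^ 2)) / (2 * D₀)

/-- Parametrization a ↦ a + i b₊(a) of the contour ∂D₊, oriented with increasing real part. -/
noncomputable def gammaPlus (D₀ K₀ a : ℝ) : ℂ := (a : ℂ) + Complex.I * (bPlus D₀ K₀ a : ℂ)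

/-- Derivative of the parametrization of ∂D₊. -/
noncomputable def gammaPlusD (D₀ K₀ a : ℝ) : ℂ :=
  1 + Complex.I * ((2 * D₀ * a / Real.sqrt (K₀ ^ 2 + 4 * D₀ ^ 2 * a ^ 2) : ℝ) : ℂ)

/-- The contour integral ∫_{∂D₊} φ(λ) dλ. -/
noncomputable def contourPlus (D₀ K₀ : ℝ) (φ : ℂ → ℂ) : ℂ :=
  ∫ a : ℝ, φ (gammaPlus D₀ K₀ a) * gammaPlusD D₀ K₀ a

/-- A classical solution of the IBVP ∂θ/∂t + K₀ ∂θ/∂x = D₀ ∂²θ/∂x² on (0,L)×(0,∞) with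
data (θ₀, f, g): a bounded continuous function on [0,L]×[0,∞), C² in x and C¹ in t on
(0,L)×(0,∞), whose x-derivative θx extends continuously to [0,L]×(0,∞), satisfying the PDE
and the initial and boundary conditions. -/
def IsClassicalSolution (D₀ K₀ L : ℝ) (θ θx : ℝ → ℝ → ℝ) (θ₀ f g : ℝ → ℝ) : Prop :=
  ContinuousOn (fun p : ℝ × ℝ => θ p.1 p.2) (Set.Icc 0 L ×ˢ Set.Ici 0) ∧
  (∃ M, ∀ x ∈ Set.Icc (0:ℝ) L, ∀ t ∈ Set.Ici (0:ℝ), |θ x t| ≤ M) ∧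
  ContinuousOn (fun p : ℝ × ℝ => θx p.1 p.2) (Set.Icc 0 L ×ˢ Set.Ioi 0) ∧
  (∀ x ∈ Set.Ioo (0:ℝ) L, ∀ t ∈ Set.Ioi (0:ℝ),
    HasDerivAt (fun x' => θ x' t) (θx x t) x ∧
    DifferentiableAt ℝ (fun x' => θx x' t) x ∧
    HasDerivAt (fun τ => θ x τ) (D₀ * deriv (fun x' => θx x' t) x - K₀ * θx x t) t) ∧
  (∀ x ∈ Set.Icc (0:ℝ) L, θ x 0 = θ₀ x) ∧
  (∀ t > (0:ℝ), θ 0 t = f t) ∧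
  (∀ t > (0:ℝ), θ L t = g t)

section part1
lemma second_deriv_nonpos {f f' : ℝ → ℝ} {a b x c : ℝ} (hx : x ∈ Set.Ioo a b)
    (hf : ∀ y ∈ Set.Ioo a b, HasDerivAt f (f' y) y) (hf' : HasDerivAt f' c x)
    (hm : IsLocalMax f x) : c ≤ 0 := by
  by_contra hc
  push Not at hc
  have hev : deriv f =ᶠ[nhds x] f' := by
    filter_upwards [Ioo_mem_nhds hx.1 hx.2] with y hy using (hf y hy).deriv
  have h2 : deriv (deriv f) x = c := by rw [hev.deriv_eq, hf'.deriv]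
  have hmin : IsLocalMin f x :=
    isLocalMin_of_deriv_deriv_pos (by rw [h2]; exact hc) hm.deriv_eq_zero
      (hf x hx).continuousAt
  have hconst : f =ᶠ[nhds x] fun _ => f x := by
    filter_upwards [hm, hmin] with y h1 h2 using le_antisymm h1 h2
  have hd : deriv f =ᶠ[nhds x] fun _ => 0 := by
    have := hconst.deriv
    simpa using this
  have : deriv (deriv f) x = 0 := by rw [hd.deriv_eq]; simp
  linarith

lemma max_principle (D K L T : ℝ) (hD : 0 < D) (w : ℝ → ℝ → ℝ)
    (hc : ContinuousOn (fun p : ℝ × ℝ => w p.1 p.2) (Set.Icc 0 L ×ˢ Set.Icc 0 T))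
    (hpde : ∀ x ∈ Set.Ioo (0:ℝ) L, ∀ t ∈ Set.Ioc (0:ℝ) T, ∃ wx : ℝ → ℝ, ∃ wxx wt : ℝ,
      (∀ y ∈ Set.Ioo (0:ℝ) L, HasDerivAt (fun x' => w x' t) (wx y) y) ∧
      HasDerivAt wx wxx x ∧ HasDerivAt (fun τ => w x τ) wt t ∧ wt = D * wxx - K * wx x)
    (M : ℝ) (h0 : ∀ x ∈ Set.Icc (0:ℝ) L, w x 0 ≤ M)
    (hl : ∀ t ∈ Set.Icc (0:ℝ) T, w 0 t ≤ M) (hr : ∀ t ∈ Set.Icc (0:ℝ) T, w L t ≤ M)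
    (x t : ℝ) (hx : x ∈ Set.Icc 0 L) (ht : t ∈ Set.Icc 0 T) : w x t ≤ M := by
  have key : ∀ ε > 0, w x t - ε * t ≤ M := by
    intro ε hε
    have hcomp : IsCompact (Set.Icc (0:ℝ) L ×ˢ Set.Icc (0:ℝ) T) := isCompact_Icc.prod isCompact_Icc
    have hcz : ContinuousOn (fun p : ℝ × ℝ => w p.1 p.2 - ε * p.2)
        (Set.Icc 0 L ×ˢ Set.Icc 0 T) := hc.sub (by fun_prop)
    obtain ⟨⟨x0, t0⟩, hmem, hmax⟩ := hcomp.exists_isMaxOn ⟨(x, t), ⟨hx, ht⟩⟩ hcz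
    have hle : ∀ y ∈ Set.Icc (0:ℝ) L, ∀ s ∈ Set.Icc (0:ℝ) T,
        w y s - ε * s ≤ w x0 t0 - ε * t0 := fun y hy s hs =>
      hmax (show (y, s) ∈ Set.Icc (0:ℝ) L ×ˢ Set.Icc (0:ℝ) T from ⟨hy, hs⟩)
    have hx0 : x0 ∈ Set.Icc 0 L := hmem.1
    have ht0 : t0 ∈ Set.Icc 0 T := hmem.2
    refine (hle x hx t ht).trans ?_
    have hεt : 0 ≤ ε * t0 := mul_nonneg hε.le ht0.1
    rcases eq_or_lt_of_le ht0.1 with h | htpos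
    · rw [← h]; linarith [h0 x0 hx0]
    rcases eq_or_lt_of_le hx0.1 with h | hxpos
    · rw [← h]; linarith [hl t0 ht0]
    rcases eq_or_lt_of_le hx0.2 with h | hxL
    · rw [h]; linarith [hr t0 ht0]
    exfalso
    obtain ⟨wx, wxx, wt, h1, h2, h3, h4⟩ := hpde x0 ⟨hxpos, hxL⟩ t0 ⟨htpos, ht0.2⟩
    have hlm : IsLocalMax (fun x' => w x' t0) x0 := by
      filter_upwards [Ioo_mem_nhds hxpos hxL] with y hy
      have := hle y ⟨hy.1.le, hy.2.le⟩ t0 ht0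
      linarith
    have hwx : wx x0 = 0 := hlm.hasDerivAt_eq_zero (h1 x0 ⟨hxpos, hxL⟩)
    have hwxx := second_deriv_nonpos ⟨hxpos, hxL⟩ h1 h2 hlm
    have hwt : ε ≤ wt := by
      have hs := (hasDerivAt_iff_tendsto_slope_left_right.1 h3).1
      refine ge_of_tendsto hs ?_
      filter_upwards [Ioo_mem_nhdsLT htpos] with s hs
      have := hle x0 hx0 s ⟨hs.1.le, hs.2.le.trans ht0.2⟩
      rw [slope_def_field, le_div_iff_of_neg (by linarith [hs.2])]
      nlinarith
    rw [hwx] at h4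
    nlinarith
  refine le_of_forall_pos_le_add fun δ hδ => ?_
  have ht1 : 0 < t + 1 := by linarith [ht.1]
  have := key (δ / (t + 1)) (by positivity)
  have h2 : δ / (t + 1) * t ≤ δ := by
    rw [div_mul_eq_mul_div, div_le_iff₀ ht1]; nlinarith
  linarith
end part1

section part2
lemma contour_shift (φ : ℂ → ℂ) (U : Set ℂ) (hφ : DifferentiableOn ℂ φ U)
    (c0 c1 d0 d1 : ℝ → ℝ) (h0 : ∀ a, HasDerivAt c0 (d0 a) a) (h1 : ∀ a, HasDerivAt c1 (d1 a) a)
    (hball : ∀ A : ℝ, ∃ (c : ℂ) (R : ℝ), Metric.ball c R ⊆ U ∧ ∀ a : ℝ, |a| ≤ A →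
      ∀ s ∈ Set.Icc (0:ℝ) 1,
        (a : ℂ) + Complex.I * ((c0 a + s * (c1 a - c0 a) : ℝ) : ℂ) ∈ Metric.ball c R)
    (B : ℝ → ℝ) (hB : Filter.Tendsto B Filter.atTop (nhds 0))
    (hdec : ∀ a : ℝ, ∀ s ∈ Set.Icc (0:ℝ) 1,
      ‖φ ((a : ℂ) + Complex.I * ((c0 a + s * (c1 a - c0 a) : ℝ) : ℂ))‖ * |c1 a - c0 a| ≤ B |a|)
    (i0 : Integrable fun a : ℝ => φ ((a : ℂ) + Complex.I * (c0 a : ℂ)) *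
      (1 + Complex.I * (d0 a : ℂ)))
    (i1 : Integrable fun a : ℝ => φ ((a : ℂ) + Complex.I * (c1 a : ℂ)) *
      (1 + Complex.I * (d1 a : ℂ))) :
    ∫ a : ℝ, φ ((a : ℂ) + Complex.I * (c0 a : ℂ)) * (1 + Complex.I * (d0 a : ℂ)) =
    ∫ a : ℝ, φ ((a : ℂ) + Complex.I * (c1 a : ℂ)) * (1 + Complex.I * (d1 a : ℂ)) := by
  have t0 := intervalIntegral_tendsto_integral i0 Filter.tendsto_neg_atTop_atBot Filter.tendsto_id
  have t1 := intervalIntegral_tendsto_integral i1 Filter.tendsto_neg_atTop_atBot Filter.tendsto_id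
  have t2 := t0.sub t1
  have hb2 : Filter.Tendsto (fun A => 2 * B A) Filter.atTop (nhds 0) := by
    simpa using hB.const_mul 2
  rw [← sub_eq_zero]
  refine tendsto_nhds_unique t2 (squeeze_zero_norm' ?_ hb2)
  filter_upwards [Filter.eventually_ge_atTop 0] with A hA
  obtain ⟨c, R, hsub, hin⟩ := hball A
  obtain ⟨F, hF⟩ := (hφ.mono hsub).isExactOn_ball
  have hin0 : ∀ a : ℝ, |a| ≤ A → (a : ℂ) + Complex.I * (c0 a : ℂ) ∈ Metric.ball c R := by
    intro a ha; simpa using hin a ha 0 (by simp)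
  have hin1 : ∀ a : ℝ, |a| ≤ A → (a : ℂ) + Complex.I * (c1 a : ℂ) ∈ Metric.ball c R := by
    intro a ha; simpa using hin a ha 1 (by simp)
  have ftc : ∀ (e d : ℝ → ℝ), (∀ a, HasDerivAt e (d a) a) →
      (∀ a : ℝ, |a| ≤ A → (a : ℂ) + Complex.I * (e a : ℂ) ∈ Metric.ball c R) →
      (Integrable fun a : ℝ => φ ((a : ℂ) + Complex.I * (e a : ℂ)) *
      (1 + Complex.I * (d a : ℂ))) →
      ∫ a in (-A)..A, φ ((a : ℂ) + Complex.I * (e a : ℂ)) * (1 + Complex.I * (d a : ℂ)) =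
      F ((A : ℂ) + Complex.I * (e A : ℂ)) - F (((-A : ℝ) : ℂ) + Complex.I * (e (-A) : ℂ)) := by
    intro e d he hm hi
    refine intervalIntegral.integral_eq_sub_of_hasDerivAt
      (f := fun a : ℝ => F ((a : ℂ) + Complex.I * (e a : ℂ))) ?_ hi.intervalIntegrable
    intro a ha
    rw [Set.uIcc_of_le (by linarith)] at ha
    have hg : HasDerivAt (fun a : ℝ => (a : ℂ) + Complex.I * (e a : ℂ))
        (1 + Complex.I * (d a : ℂ)) a :=
      (Complex.ofRealCLM.hasDerivAt (x := a)).add ((he a).ofReal_comp.const_mul Complex.I)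
    exact (hF _ (hm a (abs_le.2 ha))).comp a hg
  have vert : ∀ a : ℝ, |a| = A →
      ‖F ((a : ℂ) + Complex.I * (c1 a : ℂ)) - F ((a : ℂ) + Complex.I * (c0 a : ℂ))‖ ≤ B A := by
    intro a ha
    have := norm_image_sub_le_of_norm_deriv_le_segment_01'
      (f := fun s : ℝ => F ((a : ℂ) + Complex.I * ((c0 a + s * (c1 a - c0 a) : ℝ) : ℂ)))
      (f' := fun s : ℝ => φ ((a : ℂ) + Complex.I * ((c0 a + s * (c1 a - c0 a) : ℝ) : ℂ)) *
        (Complex.I * ((c1 a - c0 a : ℝ) : ℂ))) (C := B A) ?_ ?_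
    · simpa using this
    · intro s hs
      have hg : HasDerivAt (fun s : ℝ => (a : ℂ) + Complex.I * ((c0 a + s * (c1 a - c0 a) : ℝ) : ℂ))
          (Complex.I * ((c1 a - c0 a : ℝ) : ℂ)) s := by
        have h : HasDerivAt (fun s : ℝ => c0 a + s * (c1 a - c0 a)) (c1 a - c0 a) s := by
          simpa using ((hasDerivAt_id s).mul_const (c1 a - c0 a)).const_add (c0 a)
        exact (h.ofReal_comp.const_mul Complex.I).const_add _
      exact ((hF _ (hin a ha.le s hs)).comp s hg).hasDerivWithinAt
    · intro s hs
      have := hdec a s ⟨hs.1, hs.2.le⟩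
      rw [ha] at this
      rw [norm_mul, norm_mul, Complex.norm_I, one_mul, Complex.norm_real]
      exact this
  have v1 := vert A (abs_of_nonneg hA)
  have v2 := vert (-A) (by rw [abs_neg, abs_of_nonneg hA])
  simp only [id]
  rw [ftc c0 d0 h0 hin0 i0, ftc c1 d1 h1 hin1 i1]
  have : ∀ p q r s : ℂ, p - q - (r - s) = (s - q) - (r - p) := by intros; ring
  rw [this]
  refine (norm_sub_le _ _).trans ?_
  linarith
end part2

section part3
noncomputable def rH (k a : ℝ) : ℝ := Real.sqrt (a ^ 2 + k ^ 2)
noncomputable def mH (k a : ℝ) : ℂ := (a : ℂ) + Complex.I * (rH k a : ℂ)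
noncomputable def mD (k a : ℝ) : ℂ := 1 + Complex.I * ((a / rH k a : ℝ) : ℂ)

lemma rH_sq (k a : ℝ) : rH k a ^ 2 = a ^ 2 + k ^ 2 := Real.sq_sqrt (by positivity)
lemma rH_ge_k (k a : ℝ) : k ≤ rH k a := Real.le_sqrt_of_sq_le (by nlinarith)
lemma rH_ge_abs (k a : ℝ) : |a| ≤ rH k a :=
  Real.le_sqrt_of_sq_le (by rw [sq_abs]; nlinarith)
lemma rH_pos {k : ℝ} (hk : 0 < k) (a : ℝ) : 0 < rH k a := hk.trans_le (rH_ge_k k a)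
lemma rH_abs (k a : ℝ) : rH k |a| = rH k a := by simp [rH]
lemma rH_mono (k : ℝ) {a A : ℝ} (h : |a| ≤ A) : rH k a ≤ rH k A := by
  apply Real.sqrt_le_sqrt
  have := sq_le_sq' (by linarith [abs_nonneg a]) h
  rw [sq_abs] at this; linarith
lemma rH_cont (k : ℝ) : Continuous (rH k) := by unfold rH; fun_prop
lemma mH_cont (k : ℝ) : Continuous (mH k) := by
  have := rH_cont k
  unfold mH; fun_prop
lemma mD_cont {k : ℝ} (hk : 0 < k) : Continuous (mD k) := by
  have := rH_cont k
  unfold mD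
  have h2 : Continuous fun a => a / rH k a :=
    continuous_id.div this (fun a => (rH_pos hk a).ne')
  fun_prop
lemma rH_hasDeriv {k : ℝ} (hk : 0 < k) (a : ℝ) : HasDerivAt (rH k) (a / rH k a) a := by
  have h : HasDerivAt (fun a : ℝ => a ^ 2 + k ^ 2) (2 * a) a := by
    simpa using (hasDerivAt_pow 2 a).add_const (k ^ 2)
  have h2 := h.sqrt (by positivity)
  rw [mul_div_mul_left _ _ two_ne_zero] at h2
  exact h2
lemma mH_im (k a : ℝ) : (mH k a).im = rH k a := by simp [mH]
lemma mH_re (k a : ℝ) : (mH k a).re = a := by simp [mH]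
lemma mD_norm {k : ℝ} (hk : 0 < k) (a : ℝ) : ‖mD k a‖ ≤ 2 := by
  unfold mD
  refine (norm_add_le _ _).trans ?_
  rw [norm_mul, Complex.norm_I, one_mul, Complex.norm_real, norm_one, Real.norm_eq_abs, abs_div,
    abs_of_pos (rH_pos hk a)]
  have := (div_le_one (rH_pos hk a)).2 (rH_ge_abs k a)
  linarith
lemma mH_norm {k : ℝ} (hk : 0 < k) (a : ℝ) : ‖mH k a‖ ≤ 2 * rH k a := by
  unfold mH
  refine (norm_add_le _ _).trans ?_
  rw [norm_mul, Complex.norm_I, one_mul, Complex.norm_real, Complex.norm_real, Real.norm_eq_abs,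
    Real.norm_eq_abs, abs_of_pos (rH_pos hk a)]
  linarith [rH_ge_abs k a]

lemma integrable_exp_abs {δ : ℝ} (hδ : 0 < δ) : Integrable fun a : ℝ => Real.exp (-δ * |a|) := by
  rw [← integrableOn_univ, ← Set.Iic_union_Ioi (a := (0:ℝ))]
  refine IntegrableOn.union ?_ ?_
  · refine (integrableOn_exp_mul_Iic hδ 0).congr_fun (fun a ha => ?_) measurableSet_Iic
    simp only [Set.mem_Iic] at ha
    simp [abs_of_nonpos ha]
  · refine (integrableOn_exp_mul_Ioi (neg_lt_zero.2 hδ) 0).congr_fun (fun a ha => ?_)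
      measurableSet_Ioi
    simp only [Set.mem_Ioi] at ha
    simp [abs_of_pos ha]

lemma integrable_of_exp_bound {F : ℝ → ℂ} (hF : Continuous F) {C δ : ℝ} (hδ : 0 < δ)
    (hb : ∀ a, ‖F a‖ ≤ C * Real.exp (-δ * |a|)) : Integrable F :=
  ((integrable_exp_abs hδ).const_mul C).mono' hF.aestronglyMeasurable
    (Filter.Eventually.of_forall hb)

lemma tendsto_rH (k : ℝ) : Filter.Tendsto (rH k) Filter.atTop Filter.atTop :=
  Filter.tendsto_atTop_mono (fun a => (le_abs_self a).trans (rH_ge_abs k a)) Filter.tendsto_id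

noncomputable def NG (D k t y : ℝ) : ℂ :=
  ((Real.pi : ℂ) / ((D * t : ℝ) : ℂ)) ^ (1 / 2 : ℂ) *
    Complex.exp (-(y : ℂ) ^ 2 / (4 * ((D * t : ℝ) : ℂ)) - ((D * k ^ 2 * t : ℝ) : ℂ))

lemma gaussR (D k t y : ℝ) (hD : 0 < D) (ht : 0 < t) :
    ∫ a : ℝ, Complex.exp (-((D : ℂ) * ((a : ℂ) ^ 2 + (k : ℂ) ^ 2)) * t + Complex.I * a * y) =
      NG D k t y := by
  have hDt : 0 < D * t := mul_pos hD ht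
  have := integral_cexp_quadratic (b := ((-(D * t) : ℝ) : ℂ)) (by simpa using hDt)
    (Complex.I * y) (-((D * k ^ 2 * t : ℝ) : ℂ))
  unfold NG
  convert this using 3
  · congr 1; push_cast; ring
  · push_cast; ring
  · rw [mul_pow, Complex.I_sq]
    have : ((D * t : ℝ) : ℂ) ≠ 0 := by exact_mod_cast hDt.ne'
    push_cast at this ⊢
    have h1 : (D:ℂ) ≠ 0 := left_ne_zero_of_mul this
    have h2 : (t:ℂ) ≠ 0 := right_ne_zero_of_mul this
    field_simp
    ring

lemma gaussH (D k t y : ℝ) (hD : 0 < D) (hk : 0 < k) (ht : 0 < t) (hy : 0 < y) :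
    ∫ a : ℝ, Complex.exp (-((D : ℂ) * (mH k a ^ 2 + (k : ℂ) ^ 2)) * t + Complex.I * mH k a * y) *
      mD k a = NG D k t y := by
  have hDt : 0 < D * t := mul_pos hD ht
  set φ : ℂ → ℂ := fun m =>
    Complex.exp (-((D : ℂ) * (m ^ 2 + (k : ℂ) ^ 2)) * t + Complex.I * m * y) with hφ
  set δ := min (D * t * k) y with hδdef
  have hδ : 0 < δ := lt_min (by positivity) hy
  have hre : ∀ a v : ℝ, ‖φ ((a : ℂ) + Complex.I * (v : ℂ))‖ =
      Real.exp (-(D * (a ^ 2 - v ^ 2 + k ^ 2)) * t - v * y) := by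
    intro a v
    rw [hφ, Complex.norm_exp]
    congr 1
    simp [pow_two]
    try ring
  have hbd : ∀ a : ℝ, ∀ s ∈ Set.Icc (0:ℝ) 1,
      ‖φ ((a : ℂ) + Complex.I * ((0 + s * (rH k a - 0) : ℝ) : ℂ))‖ ≤ Real.exp (-δ * rH k a) := by
    intro a s hs
    rw [hre, Real.exp_le_exp]
    have hr := rH_sq k a
    have hrk := rH_ge_k k a
    have hr0 := rH_pos hk a
    have h1 : δ ≤ D * t * k := min_le_left _ _
    have h2 : δ ≤ y := min_le_right _ _
    have e1 : -(D * (a ^ 2 - (0 + s * (rH k a - 0)) ^ 2 + k ^ 2)) * t - (0 + s * (rH k a - 0)) * y =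
        -(D * t) * (1 - s ^ 2) * rH k a ^ 2 - s * rH k a * y := by
      have : a ^ 2 = rH k a ^ 2 - k ^ 2 := by linarith
      rw [this]; ring
    rw [e1]
    have hs1 : 0 ≤ 1 - s := by linarith [hs.2]
    have a1 : D * t * k * ((1 - s) * rH k a) ≤ (D * t) * (1 - s ^ 2) * rH k a ^ 2 := by
      have : (D * t) * (1 - s ^ 2) * rH k a ^ 2 - D * t * k * ((1 - s) * rH k a)
        = (D * t) * ((1 - s) * rH k a) * ((rH k a - k) + s * rH k a) := by ring
      have h3 : 0 ≤ (D * t) * ((1 - s) * rH k a) * ((rH k a - k) + s * rH k a) := by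
        have := mul_nonneg hs.1 hr0.le
        have h5 : 0 ≤ (rH k a - k) + s * rH k a := by linarith
        positivity
      linarith
    have a2 : δ * ((1 - s) * rH k a) ≤ D * t * k * ((1 - s) * rH k a) :=
      mul_le_mul_of_nonneg_right h1 (by positivity)
    have a3 : δ * (s * rH k a) ≤ y * (s * rH k a) :=
      mul_le_mul_of_nonneg_right h2 (mul_nonneg hs.1 hr0.le)
    nlinarith
  have hφc : Continuous φ := by rw [hφ]; fun_prop
  have key := contour_shift φ Set.univ (by rw [hφ]; fun_prop) (fun _ => 0) (rH k) (fun _ => 0)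
    (fun a => a / rH k a) (fun a => hasDerivAt_const a 0) (rH_hasDeriv hk) ?_
    (fun A => rH k A * Real.exp (-δ * rH k A)) ?_ ?_ ?_ ?_
  · have g := gaussR D k t y hD ht
    rw [← g]
    have key' := key.symm
    simp only [Complex.ofReal_zero, mul_zero, add_zero, mul_one] at key'
    exact key'
  · intro A
    refine ⟨0, |A| + rH k A + 1, Set.subset_univ _, fun a ha s hs => ?_⟩
    rw [Metric.mem_ball, dist_zero_right]
    refine (norm_add_le _ _).trans_lt ?_
    rw [norm_mul, Complex.norm_I, one_mul, Complex.norm_real, Complex.norm_real, Real.norm_eq_abs,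
      Real.norm_eq_abs]
    have h1 := rH_mono k ha
    have h2 := rH_pos hk a
    have h3 : |0 + s * (rH k a - 0)| ≤ rH k a := by
      rw [zero_add, sub_zero, abs_of_nonneg (mul_nonneg hs.1 h2.le)]
      nlinarith [hs.2]
    linarith [le_abs_self A]
  · have h := (Real.tendsto_pow_mul_exp_neg_atTop_nhds_zero 1).comp
      ((tendsto_rH k).const_mul_atTop hδ)
    have h2 := h.const_mul (1 / δ)
    simp only [mul_zero] at h2
    refine h2.congr (fun A => ?_)
    simp only [Function.comp, pow_one]
    rw [neg_mul]
    field_simp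
  · intro a s hs
    rw [rH_abs, sub_zero, abs_of_pos (rH_pos hk a), mul_comm]
    have := hbd a s hs
    rw [sub_zero] at this
    exact mul_le_mul_of_nonneg_left this (rH_pos hk a).le
  · refine integrable_of_exp_bound (C := 1) (δ := δ) (by fun_prop) hδ (fun a => ?_)
    have := hbd a 0 (by simp)
    simp only [zero_mul, add_zero, Complex.ofReal_zero, mul_zero, mul_one, one_mul] at this ⊢
    refine this.trans (Real.exp_le_exp.2 ?_)
    nlinarith [rH_ge_abs k a]
  · refine integrable_of_exp_bound (C := 2) (δ := δ) ?_ hδ (fun a => ?_)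
    · exact (hφc.comp (mH_cont k)).mul (mD_cont hk)
    have := hbd a 1 (by simp)
    simp only [zero_add, one_mul, sub_zero] at this
    rw [norm_mul, mul_comm]
    refine mul_le_mul (mD_norm hk a) (this.trans (Real.exp_le_exp.2 ?_)) (norm_nonneg _) (by norm_num)
    nlinarith [rH_ge_abs k a]

lemma zeroH (k y C : ℝ) (hk : 0 < k) (hy : 0 < y) (φ : ℂ → ℂ)
    (hφ : DifferentiableOn ℂ φ {m | 0 < m.im})
    (hb : ∀ m : ℂ, k ≤ m.im → ‖φ m‖ ≤ C * Real.exp (-y * m.im)) :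
    ∫ a : ℝ, φ (mH k a) * mD k a = 0 := by
  have hC : 0 ≤ C := by
    have := (norm_nonneg _).trans (hb (mH k 0) (by rw [mH_im]; exact rH_ge_k k 0))
    exact nonneg_of_mul_nonneg_left this (Real.exp_pos _)
  have him : ∀ (a v : ℝ), ((a : ℂ) + Complex.I * (v : ℂ)).im = v := by intro a v; simp
  have hcont : ∀ n : ℝ, 0 ≤ n →
      Continuous fun a : ℝ => φ ((a : ℂ) + Complex.I * ((rH k a + n : ℝ) : ℂ)) * mD k a := by
    intro n hn
    refine Continuous.mul ?_ (mD_cont hk)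
    have hrc := rH_cont k
    refine hφ.continuousOn.comp_continuous (by fun_prop) (fun a => ?_)
    simp only [Set.mem_ofPred_eq, him]
    linarith [rH_pos hk a]
  have hnorm : ∀ n : ℝ, 0 ≤ n → ∀ a : ℝ,
      ‖φ ((a : ℂ) + Complex.I * ((rH k a + n : ℝ) : ℂ)) * mD k a‖ ≤
        (2 * C * Real.exp (-y * n)) * Real.exp (-y * |a|) := by
    intro n hn a
    have h1 := hb ((a : ℂ) + Complex.I * ((rH k a + n : ℝ) : ℂ))
      (by rw [him]; linarith [rH_ge_k k a])
    rw [him] at h1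
    have h2 : Real.exp (-y * (rH k a + n)) ≤ Real.exp (-y * n) * Real.exp (-y * |a|) := by
      rw [← Real.exp_add, Real.exp_le_exp]; nlinarith [rH_ge_abs k a]
    rw [norm_mul]
    calc _ ≤ (C * Real.exp (-y * (rH k a + n))) * 2 :=
          mul_le_mul h1 (mD_norm hk a) (norm_nonneg _) (by positivity)
      _ ≤ (C * (Real.exp (-y * n) * Real.exp (-y * |a|))) * 2 := by gcongr
      _ = _ := by ring
  have hint : ∀ n : ℝ, 0 ≤ n →
      Integrable fun a : ℝ => φ ((a : ℂ) + Complex.I * ((rH k a + n : ℝ) : ℂ)) * mD k a :=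
    fun n hn => integrable_of_exp_bound (hcont n hn) hy (hnorm n hn)
  have heq : ∀ n : ℝ, 0 ≤ n → ∫ a : ℝ, φ (mH k a) * mD k a =
      ∫ a : ℝ, φ ((a : ℂ) + Complex.I * ((rH k a + n : ℝ) : ℂ)) * mD k a := by
    intro n hn
    refine contour_shift φ _ hφ (rH k) (fun a => rH k a + n) (fun a => a / rH k a)
      (fun a => a / rH k a) (rH_hasDeriv hk) (fun a => (rH_hasDeriv hk a).add_const n) ?_
      (fun A => (C * n) * Real.exp (-(y * rH k A))) ?_ ?_ ?_ (hint n hn)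
    · intro A
      set Y := rH k A + n with hY
      set R := (A ^ 2 + Y ^ 2 + 1) / k with hR
      have hRpos : 0 < R := by positivity
      refine ⟨Complex.I * (R : ℂ), R, ?_, ?_⟩
      · intro z hz
        rw [Metric.mem_ball, Complex.dist_eq] at hz
        have := (Complex.abs_im_le_norm _).trans_lt hz
        simp only [Complex.sub_im, Complex.mul_im, Complex.I_re, Complex.I_im, Complex.ofReal_re,
          Complex.ofReal_im, one_mul, zero_mul, zero_add] at this
        simp only [Set.mem_ofPred_eq]
        linarith [(abs_lt.1 this).1]
      · intro a ha s hs
        rw [Metric.mem_ball, Complex.dist_eq]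
        have hv : ∃ v : ℝ, v = rH k a + s * (rH k a + n - rH k a) := ⟨_, rfl⟩
        obtain ⟨v, hv⟩ := hv
        rw [← hv]
        have hv1 : k ≤ v := by
          have := mul_nonneg hs.1 hn
          rw [hv]; linarith [rH_ge_k k a, show s * (rH k a + n - rH k a) = s * n by ring]
        have hv2 : v ≤ Y := by
          have := mul_le_mul_of_nonneg_right hs.2 hn
          rw [hv, hY]; linarith [rH_mono k ha, show s * (rH k a + n - rH k a) = s * n by ring]
        have : (a : ℂ) + Complex.I * (v : ℂ) - Complex.I * (R : ℂ) = ⟨a, v - R⟩ := by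
          apply Complex.ext <;> simp
        rw [this, Complex.norm_eq_sqrt_sq_add_sq, Real.sqrt_lt' hRpos]
        have ha2 : a ^ 2 ≤ A ^ 2 := by
          have := sq_le_sq' (by linarith [abs_nonneg a]) ha
          rwa [sq_abs] at this
        have hRk : R * k = A ^ 2 + Y ^ 2 + 1 := by rw [hR]; field_simp
        have : R * k ≤ R * v := mul_le_mul_of_nonneg_left hv1 hRpos.le
        have : v ^ 2 ≤ Y ^ 2 := by apply sq_le_sq' <;> linarith
        have : 0 ≤ R * k := by positivity
        simp only
        nlinarith
    · have h := Real.tendsto_exp_neg_atTop_nhds_zero.comp ((tendsto_rH k).const_mul_atTop hy)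
      simpa using h.const_mul (C * n)
    · intro a s hs
      have e : rH k a + n - rH k a = n := by ring
      have hsn := mul_nonneg hs.1 hn
      rw [e, abs_of_nonneg hn, rH_abs]
      have h1 := hb ((a : ℂ) + Complex.I * ((rH k a + s * n : ℝ) : ℂ))
        (by rw [him]; linarith [rH_ge_k k a])
      rw [him] at h1
      have h2 : Real.exp (-y * (rH k a + s * n)) ≤ Real.exp (-(y * rH k a)) := by
        rw [Real.exp_le_exp]; nlinarith
      calc _ ≤ (C * Real.exp (-(y * rH k a))) * n := by gcongr; exact h1.trans (by gcongr)
        _ = _ := by ring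
    · simpa [mD] using! hint 0 le_rfl
  have hle : ∀ n : ℝ, 0 ≤ n → ‖∫ a : ℝ, φ (mH k a) * mD k a‖ ≤
      (2 * C * ∫ a : ℝ, Real.exp (-y * |a|)) * Real.exp (-(y * n)) := by
    intro n hn
    rw [heq n hn]
    refine (norm_integral_le_of_norm_le ((integrable_exp_abs hy).const_mul _)
      (Filter.Eventually.of_forall (hnorm n hn))).trans (le_of_eq ?_)
    rw [integral_const_mul, neg_mul]; ring
  rw [← norm_le_zero_iff]
  have h := (Real.tendsto_exp_neg_atTop_nhds_zero.comp
    (Filter.tendsto_id.const_mul_atTop hy)).const_mul (2 * C * ∫ a : ℝ, Real.exp (-y * |a|))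
  rw [mul_zero] at h
  refine ge_of_tendsto h ?_
  filter_upwards [Filter.eventually_ge_atTop 0] with n hn
  exact hle n hn
end part3

section part4
noncomputable def Sn (z L : ℝ) (m : ℂ) : ℂ := Complex.sin ((z : ℂ) * m) / Complex.sin ((L : ℂ) * m)

lemma norm_sin_le (z : ℝ) (hz : 0 ≤ z) (m : ℂ) (hm : 0 ≤ m.im) :
    ‖Complex.sin ((z : ℂ) * m)‖ ≤ Real.exp (z * m.im) := by
  unfold Complex.sin
  rw [norm_div, norm_mul, Complex.norm_I, mul_one]
  have h := norm_sub_le (Complex.exp (-((z : ℂ) * m) * Complex.I))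
    (Complex.exp (((z : ℂ) * m) * Complex.I))
  rw [Complex.norm_exp, Complex.norm_exp] at h
  simp only [Complex.mul_re, Complex.neg_re, Complex.neg_im, Complex.I_re, Complex.I_im,
    Complex.mul_im, Complex.ofReal_re, Complex.ofReal_im] at h
  ring_nf at h
  have h2 : Real.exp (-(z * m.im)) ≤ Real.exp (z * m.im) := by
    rw [Real.exp_le_exp]; nlinarith [mul_nonneg hz hm]
  have h3 : ‖(2:ℂ)‖ = 2 := by simp
  rw [h3, div_le_iff₀ two_pos]
  ring_nf
  linarith

lemma norm_sin_ge (L k : ℝ) (hL : 0 < L) (m : ℂ) (hm : k ≤ m.im) :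
    (1 - Real.exp (-(2 * L * k))) / 2 * Real.exp (L * m.im) ≤ ‖Complex.sin ((L : ℂ) * m)‖ := by
  unfold Complex.sin
  rw [norm_div, norm_mul, Complex.norm_I, mul_one]
  have h := norm_sub_norm_le (Complex.exp (-((L : ℂ) * m) * Complex.I))
    (Complex.exp (((L : ℂ) * m) * Complex.I))
  have e1 : ‖Complex.exp (-((L : ℂ) * m) * Complex.I)‖ = Real.exp (L * m.im) := by
    rw [Complex.norm_exp]; simp
  have e2 : ‖Complex.exp (((L : ℂ) * m) * Complex.I)‖ = Real.exp (-(L * m.im)) := by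
    rw [Complex.norm_exp]; simp
  rw [e1, e2] at h
  have h2 : Real.exp (-(L * m.im)) ≤ Real.exp (-(2 * L * k)) * Real.exp (L * m.im) := by
    rw [← Real.exp_add, Real.exp_le_exp]; nlinarith
  have h3 : ‖(2:ℂ)‖ = 2 := by simp
  rw [h3, le_div_iff₀ two_pos]
  nlinarith

lemma sin_ne {L : ℝ} (hL : 0 < L) {m : ℂ} (hm : 0 < m.im) : Complex.sin ((L : ℂ) * m) ≠ 0 := by
  have h := norm_sin_ge L m.im hL m le_rfl
  have h1 : Real.exp (-(2 * L * m.im)) < 1 := by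
    rw [Real.exp_lt_one_iff]; nlinarith [mul_pos hL hm]
  intro h0
  rw [h0, norm_zero] at h
  have : 0 < (1 - Real.exp (-(2 * L * m.im))) / 2 * Real.exp (L * m.im) :=
    mul_pos (by linarith) (Real.exp_pos _)
  linarith

lemma Sn_bound (L k : ℝ) (hL : 0 < L) (hk : 0 < k) : ∃ C : ℝ, 0 < C ∧
    ∀ z : ℝ, 0 ≤ z → ∀ m : ℂ, k ≤ m.im → ‖Sn z L m‖ ≤ C * Real.exp (-(L - z) * m.im) := by
  set c := (1 - Real.exp (-(2 * L * k))) / 2 with hc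
  have h1 : Real.exp (-(2 * L * k)) < 1 := by
    rw [Real.exp_lt_one_iff]; nlinarith [mul_pos hL hk]
  have hcpos : 0 < c := by rw [hc]; linarith
  refine ⟨c⁻¹, by positivity, fun z hz m hm => ?_⟩
  unfold Sn
  have h2 := norm_sin_ge L k hL m hm
  have h3 := norm_sin_le z hz m (hk.le.trans hm)
  rw [← hc] at h2
  rw [norm_div]
  calc _ ≤ Real.exp (z * m.im) / (c * Real.exp (L * m.im)) := by gcongr
    _ = _ := by
      rw [show -(L - z) * m.im = z * m.im - L * m.im by ring, Real.exp_sub]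
      field_simp

lemma Sn_cont {k L : ℝ} (hk : 0 < k) (hL : 0 < L) (z : ℝ) : Continuous fun a => Sn z L (mH k a) := by
  have := mH_cont k
  unfold Sn
  refine Continuous.div (by fun_prop) (by fun_prop) (fun a => sin_ne hL ?_)
  rw [mH_im]; exact rH_pos hk a

noncomputable def JJ (A p : ℝ → ℂ) (b : ℝ) (d : ℝ → ℂ) : ℂ :=
  ∫ a : ℝ, A a * ∫ ξ in (0:ℝ)..b, Complex.exp (p a * (ξ : ℂ)) * d ξ

structure JGood (A p : ℝ → ℂ) (b : ℝ) (C δ : ℝ) : Prop where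
  cA : Continuous A
  cp : Continuous p
  hb : 0 ≤ b
  hδ : 0 < δ
  bd : ∀ a : ℝ, ∀ ξ ∈ Set.Icc (0:ℝ) b, ‖A a‖ * Real.exp ((p a).re * ξ) ≤ C * Real.exp (-δ * |a|)

lemma JGood.norm_le {A p : ℝ → ℂ} {b C δ : ℝ} (h : JGood A p b C δ) {d : ℝ → ℂ} {M : ℝ}
    (hM : ∀ ξ ∈ Set.Icc (0:ℝ) b, ‖d ξ‖ ≤ M) (a : ℝ) :
    ‖A a * ∫ ξ in (0:ℝ)..b, Complex.exp (p a * (ξ : ℂ)) * d ξ‖ ≤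
      (C * b * M) * Real.exp (-δ * |a|) := by
  rw [← intervalIntegral.integral_const_mul]
  have := intervalIntegral.norm_integral_le_of_norm_le_const (a := 0) (b := b)
    (f := fun ξ : ℝ => A a * (Complex.exp (p a * (ξ : ℂ)) * d ξ))
    (C := C * Real.exp (-δ * |a|) * M) ?_
  · rw [sub_zero, abs_of_nonneg h.hb] at this
    refine this.trans (le_of_eq ?_); ring
  · intro ξ hξ
    rw [Set.uIoc_of_le h.hb] at hξ
    have hξ' : ξ ∈ Set.Icc 0 b := ⟨hξ.1.le, hξ.2⟩
    rw [norm_mul, norm_mul, ← mul_assoc, Complex.norm_exp]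
    have e : (p a * (ξ : ℂ)).re = (p a).re * ξ := by simp
    rw [e]
    have h1 := h.bd a ξ hξ'
    exact mul_le_mul h1 (hM ξ hξ') (norm_nonneg _)
      ((mul_nonneg (norm_nonneg _) (Real.exp_pos _).le).trans h1)

lemma exists_bound {d : ℝ → ℂ} (hd : Continuous d) (b : ℝ) :
    ∃ M, ∀ ξ ∈ Set.Icc (0:ℝ) b, ‖d ξ‖ ≤ M :=
  isCompact_Icc.exists_bound_of_continuousOn hd.continuousOn

lemma JGood.integrable {A p : ℝ → ℂ} {b C δ : ℝ} (h : JGood A p b C δ) {d : ℝ → ℂ}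
    (hd : Continuous d) :
    Integrable fun a : ℝ => A a * ∫ ξ in (0:ℝ)..b, Complex.exp (p a * (ξ : ℂ)) * d ξ := by
  obtain ⟨M, hM⟩ := exists_bound hd b
  refine integrable_of_exp_bound ?_ h.hδ (h.norm_le hM)
  refine h.cA.mul ?_
  have := h.cp
  apply intervalIntegral.continuous_parametric_intervalIntegral_of_continuous'
  simp only [Function.uncurry_def]
  fun_prop

lemma JGood.add {A p : ℝ → ℂ} {b C δ : ℝ} (h : JGood A p b C δ) {d e : ℝ → ℂ}
    (hd : Continuous d) (he : Continuous e) :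
    JJ A p b (fun ξ => d ξ + e ξ) = JJ A p b d + JJ A p b e := by
  unfold JJ
  rw [← integral_add (h.integrable hd) (h.integrable he)]
  congr 1
  ext a
  rw [← mul_add, ← intervalIntegral.integral_add]
  · simp only [mul_add]
  · exact Continuous.intervalIntegrable (by fun_prop) _ _
  · exact Continuous.intervalIntegrable (by fun_prop) _ _

lemma JJ_smul (A p : ℝ → ℂ) (b : ℝ) (c : ℂ) (d : ℝ → ℂ) :
    JJ A p b (fun ξ => c * d ξ) = c * JJ A p b d := by
  unfold JJ
  rw [← integral_const_mul]
  congr 1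
  ext a
  have : ∫ ξ in (0:ℝ)..b, Complex.exp (p a * (ξ : ℂ)) * (c * d ξ) =
      c * ∫ ξ in (0:ℝ)..b, Complex.exp (p a * (ξ : ℂ)) * d ξ := by
    rw [← intervalIntegral.integral_const_mul]
    refine intervalIntegral.integral_congr fun ξ _ => ?_
    ring
  rw [this]
  ring

lemma JGood.bound {A p : ℝ → ℂ} {b C δ : ℝ} (h : JGood A p b C δ) :
    ∃ B : ℝ, 0 ≤ B ∧ ∀ (d : ℝ → ℂ) (M : ℝ), 0 ≤ M → (∀ ξ ∈ Set.Icc (0:ℝ) b, ‖d ξ‖ ≤ M) →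
      ‖JJ A p b d‖ ≤ B * M := by
  have hI : 0 ≤ ∫ a : ℝ, Real.exp (-δ * |a|) := integral_nonneg fun a => (Real.exp_pos _).le
  refine ⟨|C| * b * ∫ a : ℝ, Real.exp (-δ * |a|), by have := h.hb; positivity, fun d M hM0 hM => ?_⟩
  refine (norm_integral_le_of_norm_le ((integrable_exp_abs h.hδ).const_mul _)
    (Filter.Eventually.of_forall (h.norm_le hM))).trans ?_
  rw [integral_const_mul]
  have := h.hb
  have : C * b * M ≤ |C| * b * M := by gcongr; exact le_abs_self C
  nlinarith
end part4

section part5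
noncomputable def WF (D k : ℝ) (m : ℂ) : ℂ := (D : ℂ) * (m ^ 2 + (k : ℂ) ^ 2)

lemma WF_re (D k a : ℝ) : (WF D k (mH k a)).re = 0 := by
  have h := rH_sq k a
  have e : mH k a ^ 2 + (k:ℂ) ^ 2 = ((2 * a * rH k a : ℝ) : ℂ) * Complex.I := by
    unfold mH
    have h' : ((rH k a : ℝ) : ℂ) ^ 2 = (a : ℂ) ^ 2 + (k : ℂ) ^ 2 := by exact_mod_cast h
    rw [add_sq, mul_pow, Complex.I_sq, h']
    push_cast; ring
  unfold WF
  rw [e]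
  simp

noncomputable def UK (D k L t z a : ℝ) : ℂ :=
  Complex.exp (-WF D k (mH k a) * t) * Sn z L (mH k a) * mD k a

lemma UK_cont {D k L t : ℝ} (hk : 0 < k) (hL : 0 < L) (z : ℝ) : Continuous (UK D k L t z) := by
  have h1 := Sn_cont hk hL z
  have h2 := mD_cont hk
  have h3 := mH_cont k
  unfold UK WF
  fun_prop

lemma UK_norm (D k L t : ℝ) (hk : 0 < k) (hL : 0 < L) : ∃ C : ℝ, 0 < C ∧
    ∀ z : ℝ, 0 ≤ z → ∀ a, ‖UK D k L t z a‖ ≤ C * Real.exp (-(L - z) * rH k a) := by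
  obtain ⟨C, hC, h⟩ := Sn_bound L k hL hk
  refine ⟨2 * C, by positivity, fun z hz a => ?_⟩
  unfold UK
  have h1 : ‖Complex.exp (-WF D k (mH k a) * t)‖ = 1 := by
    rw [Complex.norm_exp]
    simp [WF_re]
  have h2 := h z hz (mH k a) (by rw [mH_im]; exact rH_ge_k k a)
  rw [mH_im] at h2
  rw [norm_mul, norm_mul, h1, one_mul]
  calc _ ≤ (C * Real.exp (-(L - z) * rH k a)) * 2 :=
        mul_le_mul h2 (mD_norm hk a) (norm_nonneg _) (by positivity)
    _ = _ := by ring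

lemma good_gen (D k L t z b E : ℝ) (hk : 0 < k) (hL : 0 < L) (hz : 0 ≤ z) (hzL : z < L)
    (hb : 0 ≤ b) (c : ℂ) (G p : ℝ → ℂ) (cG : Continuous G) (cp : Continuous p)
    (hG : ∀ a : ℝ, ∀ ξ ∈ Set.Icc (0:ℝ) b,
      ‖G a‖ * Real.exp ((p a).re * ξ) ≤ E * Real.exp ((L - z) / 2 * rH k a)) :
    ∃ C δ, JGood (fun a => c * G a * UK D k L t z a) p b C δ := by
  obtain ⟨C, hC, h⟩ := UK_norm D k L t hk hL
  have hδ : 0 < (L - z) / 2 := by linarith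
  refine ⟨‖c‖ * E * C, (L - z) / 2, ?_, cp, hb, hδ, ?_⟩
  · have := UK_cont (D := D) (t := t) hk hL z
    fun_prop
  intro a ξ hξ
  have hE : 0 ≤ E := by
    have := (mul_nonneg (norm_nonneg (G a)) (Real.exp_pos ((p a).re * ξ)).le).trans (hG a ξ hξ)
    exact nonneg_of_mul_nonneg_left this (Real.exp_pos _)
  rw [norm_mul, norm_mul]
  calc ‖c‖ * ‖G a‖ * ‖UK D k L t z a‖ * Real.exp ((p a).re * ξ)
      = ‖c‖ * (‖G a‖ * Real.exp ((p a).re * ξ)) * ‖UK D k L t z a‖ := by ring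
    _ ≤ ‖c‖ * (E * Real.exp ((L - z) / 2 * rH k a)) * (C * Real.exp (-(L - z) * rH k a)) := by
        have := hG a ξ hξ
        have := h z hz a
        gcongr
    _ = ‖c‖ * E * C * (Real.exp ((L - z) / 2 * rH k a) * Real.exp (-(L - z) * rH k a)) := by ring
    _ ≤ _ := by
        rw [← Real.exp_add]
        gcongr
        nlinarith [rH_ge_abs k a]

noncomputable def c1 : ℂ := -(1 / (2 * (Real.pi : ℂ)))
noncomputable def A1 (D k x t a : ℝ) : ℂ :=
  1 / (2 * (Real.pi : ℂ)) *
    Complex.exp (Complex.I * a * x - ((D : ℂ) * a ^ 2 + Complex.I * (2 * D * k) * a) * t)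
noncomputable def p1 (a : ℝ) : ℂ := -Complex.I * a
noncomputable def A2 (D k L x t a : ℝ) : ℂ :=
  (c1 * Complex.exp (k * x)) * Complex.exp (Complex.I * mH k a * L) * UK D k L t x a
noncomputable def p2 (k a : ℝ) : ℂ := -Complex.I * mH k a - k
noncomputable def A3 (D k L x t a : ℝ) : ℂ :=
  (c1 * Complex.exp (k * x)) * 1 * UK D k L t (L - x) a
noncomputable def p3 (k a : ℝ) : ℂ := Complex.I * mH k a - k
noncomputable def A4 (D k L x t a : ℝ) : ℂ :=
  (c1 * (2 * Complex.I * D) * Complex.exp (k * x)) * mH k a * UK D k L t (L - x) a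
noncomputable def p4 (D k a : ℝ) : ℂ := WF D k (mH k a)
noncomputable def A5 (D k L x t a : ℝ) : ℂ :=
  (c1 * (2 * Complex.I * D) * Complex.exp (k * x) * Complex.exp (-(k * L))) * mH k a * UK D k L t x a

lemma good1 (D k L x t : ℝ) (hD : 0 < D) (ht : 0 < t) (hL : 0 < L) :
    ∃ C δ, JGood (A1 D k x t) p1 L C δ := by
  refine ⟨1 / (2 * Real.pi) * Real.exp (D * t), D * t, ?_, ?_, hL.le, by positivity, ?_⟩
  · unfold A1; fun_prop
  · unfold p1; fun_prop
  intro a ξ hξ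
  have e1 : (p1 a).re = 0 := by simp [p1]
  have e2 : ‖A1 D k x t a‖ = 1 / (2 * Real.pi) * Real.exp (-(D * t) * a ^ 2) := by
    unfold A1
    rw [norm_mul, Complex.norm_exp]
    congr 1
    · simp [abs_of_pos Real.pi_pos]
    · congr 1
      simp [pow_two]
      ring
  rw [e1, e2, zero_mul, Real.exp_zero, mul_one, mul_assoc, ← Real.exp_add]
  gcongr
  have : 0 < D * t := mul_pos hD ht
  rw [← sq_abs a]
  nlinarith [sq_nonneg (|a| - 1), abs_nonneg a]

variable (D k L x t : ℝ)

lemma good2 (hk : 0 < k) (hL : 0 < L) (hx : x ∈ Set.Ioo 0 L) :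
    ∃ C δ, JGood (A2 D k L x t) (p2 k) L C δ := by
  have hc := mH_cont k
  refine good_gen D k L t x L 1 hk hL hx.1.le hx.2 hL.le _ _ _ (by fun_prop)
    (by unfold p2; fun_prop) ?_
  intro a ξ hξ
  have e1 : (p2 k a).re = rH k a - k := by simp [p2, mH_im]
  have hr := rH_ge_k k a
  have hr0 := rH_pos hk a
  have e2 : ‖Complex.exp (Complex.I * mH k a * L)‖ = Real.exp (-(rH k a * L)) := by
    rw [Complex.norm_exp]; simp [mH_im]
  rw [e1, e2, ← Real.exp_add, one_mul, Real.exp_le_exp]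
  have h1 : 0 ≤ (L - x) / 2 * rH k a := mul_nonneg (by linarith [hx.2]) hr0.le
  have h2 : (rH k a - k) * ξ ≤ (rH k a - k) * L := mul_le_mul_of_nonneg_left hξ.2 (by linarith)
  nlinarith

lemma good3 (hk : 0 < k) (hL : 0 < L) (hx : x ∈ Set.Ioo 0 L) :
    ∃ C δ, JGood (A3 D k L x t) (p3 k) L C δ := by
  have hc := mH_cont k
  refine good_gen D k L t (L - x) L 1 hk hL (by linarith [hx.2]) (by linarith [hx.1]) hL.le _
    (fun _ => 1) _ (by fun_prop) (by unfold p3; fun_prop) ?_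
  intro a ξ hξ
  have e1 : (p3 k a).re = -rH k a - k := by simp [p3, mH_im]
  have hr0 := rH_pos hk a
  rw [e1, norm_one, one_mul, one_mul, Real.exp_le_exp]
  have h1 : 0 ≤ (L - (L - x)) / 2 * rH k a := mul_nonneg (by linarith [hx.1]) hr0.le
  nlinarith [mul_nonneg (add_nonneg hr0.le hk.le) hξ.1]

lemma good45 (hk : 0 < k) (hL : 0 < L) (z : ℝ) (hz : z ∈ Set.Ioo 0 L) (ht : 0 < t) (c : ℂ) :
    ∃ C δ, JGood (fun a => c * mH k a * UK D k L t z a) (p4 D k) t C δ := by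
  have hc := mH_cont k
  have hd : 0 < (L - z) / 2 := by linarith [hz.2]
  refine good_gen D k L t z t (2 / ((L - z) / 2)) hk hL hz.1.le hz.2 ht.le _
    _ _ hc (by unfold p4 WF; fun_prop) ?_
  intro a ξ hξ
  have hr0 := rH_pos hk a
  have e1 : (p4 D k a).re = 0 := WF_re D k a
  rw [e1, zero_mul, Real.exp_zero, mul_one]
  refine (mH_norm hk a).trans ?_
  rw [div_mul_eq_mul_div, le_div_iff₀ hd]
  have := Real.add_one_le_exp ((L - z) / 2 * rH k a)
  nlinarith

lemma good4 (hk : 0 < k) (hL : 0 < L) (hx : x ∈ Set.Ioo 0 L) (ht : 0 < t) :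
    ∃ C δ, JGood (A4 D k L x t) (p4 D k) t C δ :=
  good45 D k L t hk hL (L - x) ⟨by linarith [hx.2], by linarith [hx.1]⟩ ht _

lemma good5 (hk : 0 < k) (hL : 0 < L) (hx : x ∈ Set.Ioo 0 L) (ht : 0 < t) :
    ∃ C δ, JGood (A5 D k L x t) (p4 D k) t C δ :=
  good45 D k L t hk hL x hx ht _

noncomputable def RR (d f g : ℝ → ℂ) : ℂ :=
  JJ (A1 D k x t) p1 L d + JJ (A2 D k L x t) (p2 k) L d + JJ (A3 D k L x t) (p3 k) L d +
  JJ (A4 D k L x t) (p4 D k) t f + JJ (A5 D k L x t) (p4 D k) t g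

lemma RR_add (hD : 0 < D) (hk : 0 < k) (hL : 0 < L) (hx : x ∈ Set.Ioo 0 L) (ht : 0 < t)
    {d f g d' f' g' : ℝ → ℂ} (hd : Continuous d) (hf : Continuous f) (hg : Continuous g)
    (hd' : Continuous d') (hf' : Continuous f') (hg' : Continuous g') :
    RR D k L x t (fun s => d s + d' s) (fun s => f s + f' s) (fun s => g s + g' s) =
      RR D k L x t d f g + RR D k L x t d' f' g' := by
  obtain ⟨_, _, h1⟩ := good1 D k L x t hD ht hL
  obtain ⟨_, _, h2⟩ := good2 D k L x t hk hL hx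
  obtain ⟨_, _, h3⟩ := good3 D k L x t hk hL hx
  obtain ⟨_, _, h4⟩ := good4 D k L x t hk hL hx ht
  obtain ⟨_, _, h5⟩ := good5 D k L x t hk hL hx ht
  unfold RR
  rw [h1.add hd hd', h2.add hd hd', h3.add hd hd', h4.add hf hf', h5.add hg hg']
  ring

lemma RR_smul (c : ℂ) (d f g : ℝ → ℂ) :
    RR D k L x t (fun s => c * d s) (fun s => c * f s) (fun s => c * g s) =
      c * RR D k L x t d f g := by
  unfold RR
  simp only [JJ_smul]
  ring

lemma RR_bound (hD : 0 < D) (hk : 0 < k) (hL : 0 < L) (hx : x ∈ Set.Ioo 0 L) (ht : 0 < t) :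
    ∃ B : ℝ, 0 ≤ B ∧ ∀ (d f g : ℝ → ℂ) (M : ℝ), 0 ≤ M → (∀ ξ ∈ Set.Icc (0:ℝ) L, ‖d ξ‖ ≤ M) →
      (∀ ξ ∈ Set.Icc (0:ℝ) t, ‖f ξ‖ ≤ M) → (∀ ξ ∈ Set.Icc (0:ℝ) t, ‖g ξ‖ ≤ M) →
      ‖RR D k L x t d f g‖ ≤ B * M := by
  obtain ⟨_, _, h1⟩ := good1 D k L x t hD ht hL
  obtain ⟨_, _, h2⟩ := good2 D k L x t hk hL hx
  obtain ⟨_, _, h3⟩ := good3 D k L x t hk hL hx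
  obtain ⟨_, _, h4⟩ := good4 D k L x t hk hL hx ht
  obtain ⟨_, _, h5⟩ := good5 D k L x t hk hL hx ht
  obtain ⟨B1, b1, h1⟩ := h1.bound
  obtain ⟨B2, b2, h2⟩ := h2.bound
  obtain ⟨B3, b3, h3⟩ := h3.bound
  obtain ⟨B4, b4, h4⟩ := h4.bound
  obtain ⟨B5, b5, h5⟩ := h5.bound
  refine ⟨B1 + B2 + B3 + B4 + B5, by positivity, fun d f g M hM hd hf hg => ?_⟩
  have i1 := h1 d M hM hd
  have i2 := h2 d M hM hd
  have i3 := h3 d M hM hd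
  have i4 := h4 f M hM hf
  have i5 := h5 g M hM hg
  unfold RR
  refine (norm_add_le _ _).trans ?_
  have j3 := norm_add_le (JJ (A1 D k x t) p1 L d + JJ (A2 D k L x t) (p2 k) L d +
    JJ (A3 D k L x t) (p3 k) L d) (JJ (A4 D k L x t) (p4 D k) t f)
  have j2 := norm_add_le (JJ (A1 D k x t) p1 L d + JJ (A2 D k L x t) (p2 k) L d)
    (JJ (A3 D k L x t) (p3 k) L d)
  have j1 := norm_add_le (JJ (A1 D k x t) p1 L d) (JJ (A2 D k L x t) (p2 k) L d)
  nlinarith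
end part5

section part6
lemma JGood.swap {A p : ℝ → ℂ} {b C δ : ℝ} (h : JGood A p b C δ) {d : ℝ → ℂ} (hd : Continuous d) :
    JJ A p b d = ∫ ξ in (0:ℝ)..b, (∫ a, A a * Complex.exp (p a * (ξ:ℂ))) * d ξ := by
  obtain ⟨M, hM⟩ := exists_bound hd b
  have hcA := h.cA
  have hcp := h.cp
  have key : Integrable (Function.uncurry fun (ξ a : ℝ) => A a * (Complex.exp (p a * (ξ:ℂ)) * d ξ))
      ((volume.restrict (Set.uIoc 0 b)).prod volume) := by
    have h1 : Integrable (fun _ : ℝ => |C| * |M|) (volume.restrict (Set.uIoc 0 b)) := by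
      rw [← IntegrableOn]
      exact integrableOn_const (by simp [Set.uIoc])
    refine (h1.mul_prod (integrable_exp_abs h.hδ)).mono' ?_ ?_
    · apply Continuous.aestronglyMeasurable
      simp only [Function.uncurry_def]
      fun_prop
    · rw [← Measure.restrict_univ (μ := volume (α := ℝ)), Measure.restrict_restrict (by measurability),
        Measure.prod_restrict]
      refine (ae_restrict_iff' (by measurability)).2 (Filter.Eventually.of_forall ?_)
      rintro ⟨ξ, a⟩ ⟨hξ, -⟩
      simp only [Set.inter_univ, Set.uIoc_of_le h.hb] at hξ
      have hξ' : ξ ∈ Set.Icc 0 b := ⟨hξ.1.le, hξ.2⟩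
      have h2 := h.bd a ξ hξ'
      have h3 := hM ξ hξ'
      simp only [Function.uncurry_apply_pair, norm_mul, Complex.norm_exp]
      have e : (p a * (ξ:ℂ)).re = (p a).re * ξ := by simp
      rw [e, ← mul_assoc]
      calc _ ≤ (C * Real.exp (-δ * |a|)) * M := by
            gcongr
            exact (by positivity : (0:ℝ) ≤ _).trans h2
        _ ≤ |C| * |M| * Real.exp (-δ * |a|) := by
            rw [mul_right_comm, ← abs_mul]
            gcongr
            exact le_abs_self _
  have := intervalIntegral_integral_swap key
  unfold JJ
  simp_rw [← intervalIntegral.integral_const_mul]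
  rw [← this]
  congr 1
  ext ξ
  rw [← integral_mul_const]
  simp only [mul_assoc]

lemma A1_int (D k x t ξ : ℝ) (hD : 0 < D) (ht : 0 < t) :
    ∫ a, A1 D k x t a * Complex.exp (p1 a * (ξ:ℂ)) =
      1 / (2 * (Real.pi : ℂ)) * Complex.exp (k * (x - ξ)) * NG D k t (x - ξ) := by
  have hDt : 0 < D * t := mul_pos hD ht
  have hD' : (D:ℂ) ≠ 0 := by exact_mod_cast hD.ne'
  have ht' : (t:ℂ) ≠ 0 := by exact_mod_cast ht.ne'
  have := integral_cexp_quadratic (b := ((-(D * t) : ℝ) : ℂ)) (by simpa using hDt)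
    (Complex.I * (x - ξ) - 2 * Complex.I * D * k * t) 0
  unfold A1 p1
  simp_rw [mul_assoc (1 / (2 * (Real.pi:ℂ)))]
  rw [integral_const_mul]
  congr 1
  simp_rw [← Complex.exp_add]
  unfold NG
  rw [mul_left_comm (Complex.exp ((k:ℂ) * (x - ξ))), ← Complex.exp_add]
  refine Eq.trans ?_ (this.trans ?_)
  · congr 1
    ext a; congr 1; push_cast; ring
  congr 1
  · push_cast; simp
  · congr 1
    push_cast
    have : (Complex.I * (x - ξ) - 2 * Complex.I * D * k * t) ^ 2 = -((x - ξ - 2 * D * k * t : ℂ)^2) := by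
      linear_combination ((x - ξ - 2 * D * k * t : ℂ)^2) * Complex.I_sq
    rw [this]
    field_simp
    ring

noncomputable def GQ (D k x t q ξ : ℝ) : ℂ := Complex.exp (Complex.I * q * ξ) * NG D k t (x - ξ)

lemma JJ1_eq (D k L x t q : ℝ) (hD : 0 < D) (hL : 0 < L) (ht : 0 < t) :
    JJ (A1 D k x t) p1 L (fun ξ => Complex.exp (k * ξ + Complex.I * q * ξ)) =
      1 / (2 * (Real.pi : ℂ)) * Complex.exp (k * x) * ∫ ξ in (0:ℝ)..L, GQ D k x t q ξ := by
  obtain ⟨_, _, h⟩ := good1 D k L x t hD ht hL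
  rw [h.swap (by fun_prop), ← intervalIntegral.integral_const_mul]
  congr 1
  ext ξ
  rw [A1_int D k x t ξ hD ht, GQ]
  have : Complex.exp (k * (x - ξ)) * Complex.exp (k * ξ + Complex.I * q * ξ) =
      Complex.exp (k * x) * Complex.exp (Complex.I * q * ξ) := by
    rw [← Complex.exp_add, ← Complex.exp_add]; congr 1; ring
  linear_combination 1 / (2 * (Real.pi : ℂ)) * NG D k t (x - ξ) * this

lemma GQ_form (D k x t q : ℝ) (hD : 0 < D) (ht : 0 < t) (ξ : ℝ) :
    GQ D k x t q ξ = ((Real.pi : ℂ) / ((D * t : ℝ) : ℂ)) ^ (1 / 2 : ℂ) * Complex.exp (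
      -((1 / (4 * (D * t)) : ℝ) : ℂ) * (ξ:ℂ) ^ 2 + (Complex.I * q + x / (2 * (D * t))) * ξ +
        (-(x:ℂ)^2 / (4 * (D * t)) - D * k^2 * t)) := by
  have hD' : (D:ℂ) ≠ 0 := by exact_mod_cast hD.ne'
  have ht' : (t:ℂ) ≠ 0 := by exact_mod_cast ht.ne'
  unfold GQ NG
  rw [mul_left_comm, ← Complex.exp_add]
  congr 2
  push_cast
  field_simp
  ring

lemma GQ_integrable (D k x t q : ℝ) (hD : 0 < D) (ht : 0 < t) : Integrable (GQ D k x t q) := by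
  have hb : 0 < ((1 / (4 * (D * t)) : ℝ) : ℂ).re := by
    rw [Complex.ofReal_re]; positivity
  rw [funext (GQ_form D k x t q hD ht)]
  exact (integrable_cexp_quadratic hb _ _).const_mul _

lemma cpow_half_mul {a b : ℝ} (ha : 0 < a) (hb : 0 < b) :
    (a:ℂ) ^ (1/2:ℂ) * (b:ℂ) ^ (1/2:ℂ) = ((Real.sqrt (a * b) : ℝ) : ℂ) := by
  have h : (1/2:ℂ) = ((1/2:ℝ):ℂ) := by push_cast; rfl
  rw [h, ← Complex.ofReal_cpow ha.le, ← Complex.ofReal_cpow hb.le, ← Complex.ofReal_mul,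
    ← Real.mul_rpow ha.le hb.le, Real.sqrt_eq_rpow]

lemma GQ_total (D k x t q : ℝ) (hD : 0 < D) (ht : 0 < t) :
    ∫ ξ, GQ D k x t q ξ = 2 * Real.pi *
      Complex.exp (Complex.I * q * x - D * (q^2 + k^2) * t) := by
  have hDt : 0 < D * t := mul_pos hD ht
  have hD' : (D:ℂ) ≠ 0 := by exact_mod_cast hD.ne'
  have ht' : (t:ℂ) ≠ 0 := by exact_mod_cast ht.ne'
  have hb : (-((1 / (4 * (D * t)) : ℝ) : ℂ)).re < 0 := by
    rw [Complex.neg_re, Complex.ofReal_re]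
    have : 0 < 1 / (4 * (D * t)) := by positivity
    linarith
  simp_rw [GQ_form D k x t q hD ht]
  rw [integral_const_mul, integral_cexp_quadratic hb, ← mul_assoc]
  congr 1
  · rw [← Complex.ofReal_div, neg_neg, ← Complex.ofReal_div, cpow_half_mul (by positivity) (by positivity)]
    have : Real.pi / (D * t) * (Real.pi / (1 / (4 * (D * t)))) = (2 * Real.pi)^2 := by
      field_simp; ring
    rw [this, Real.sqrt_sq (by positivity)]
    push_cast; rfl
  · congr 1
    have e : (Complex.I * q + x / (2 * (D * t)))^2 = -(q:ℂ)^2 + Complex.I * q * x / (D * t)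
       + (x:ℂ)^2/(4 * (D*t)^2) := by
      have : ((x:ℂ) / (2 * (D * t)))^2 = (x:ℂ)^2/(4 * (D*t)^2) := by ring
      rw [← this]
      linear_combination (q:ℂ)^2 * Complex.I_sq
    rw [e]
    push_cast
    field_simp
    ring

lemma NG_even (D k t y : ℝ) : NG D k t (-y) = NG D k t y := by
  unfold NG; push_cast; rw [neg_sq]

/-- splitting of the Gaussian integral -/
lemma GQ_split (D k L x t q : ℝ) (hD : 0 < D) (ht : 0 < t) :
    (∫ s in Set.Ioi (0:ℝ), Complex.exp (-Complex.I * q * s) * NG D k t (x + s)) +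
    (∫ ξ in (0:ℝ)..L, GQ D k x t q ξ) +
    Complex.exp (Complex.I * q * L) *
      (∫ s in Set.Ioi (0:ℝ), Complex.exp (Complex.I * q * s) * NG D k t (L - x + s)) =
    ∫ ξ, GQ D k x t q ξ := by
  have hi := GQ_integrable D k x t q hD ht
  have h1 : (∫ s in Set.Ioi (0:ℝ), Complex.exp (-Complex.I * q * s) * NG D k t (x + s)) =
      ∫ ξ in Set.Iic 0, GQ D k x t q ξ := by
    have := integral_comp_neg_Ioi 0 (GQ D k x t q)
    rw [neg_zero] at this
    rw [← this]
    congr 1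
    ext s
    unfold GQ
    rw [sub_neg_eq_add]
    congr 2
    push_cast; ring
  have h2 : Complex.exp (Complex.I * q * L) *
      (∫ s in Set.Ioi (0:ℝ), Complex.exp (Complex.I * q * s) * NG D k t (L - x + s)) =
      ∫ ξ in Set.Ioi L, GQ D k x t q ξ := by
    have := (measurePreserving_add_left volume L).setIntegral_preimage_emb
      (measurableEmbedding_addLeft L) (GQ D k x t q) (Set.Ioi L)
    rw [← this, ← integral_const_mul]
    have e : (fun s => L + s) ⁻¹' Set.Ioi L = Set.Ioi 0 := by ext s; simp
    rw [e]
    congr 1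
    ext s
    unfold GQ
    rw [← mul_assoc, ← Complex.exp_add, ← NG_even]
    congr 2
    · push_cast; ring
    · ring
  rw [h1, h2, add_assoc, intervalIntegral.integral_interval_add_Ioi hi.integrableOn hi.integrableOn,
    intervalIntegral.integral_Iic_add_Ioi hi.integrableOn hi.integrableOn]
end part6

section part7
lemma sub_ne_of_im {m : ℂ} (hm : 0 < m.im) (q : ℝ) : m - q ≠ 0 := by
  intro h
  have := congrArg Complex.im h
  simp at this
  linarith

lemma norm_inv_sub {k : ℝ} (hk : 0 < k) {m : ℂ} (hm : k ≤ m.im) (q : ℝ) : ‖(m - q)⁻¹‖ ≤ k⁻¹ := by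
  rw [norm_inv]
  apply inv_anti₀ hk
  have := Complex.abs_im_le_norm (m - q)
  simp at this
  exact hm.trans ((le_abs_self _).trans this)

noncomputable def PE (D k t y q a : ℝ) : ℂ :=
  Complex.exp (-WF D k (mH k a) * t + Complex.I * mH k a * y) * (Complex.I * (mH k a - q)⁻¹) * mD k a

lemma norm_exp_W (D k t y a : ℝ) :
    ‖Complex.exp (-WF D k (mH k a) * t + Complex.I * mH k a * y)‖ = Real.exp (-(rH k a * y)) := by
  rw [Complex.norm_exp]
  congr 1
  simp [WF_re, mH_im]

lemma inv_cont {k : ℝ} (hk : 0 < k) (q : ℝ) : Continuous fun a => (mH k a - (q:ℂ))⁻¹ := by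
  have := mH_cont k
  refine Continuous.inv₀ (by fun_prop) (fun a => sub_ne_of_im ?_ q)
  rw [mH_im]; exact rH_pos hk a

lemma PE_integrable (D k t y q : ℝ) (hk : 0 < k) (hy : 0 < y) : Integrable (PE D k t y q) := by
  have h1 := inv_cont hk q
  have h2 := mH_cont k
  have h3 := mD_cont hk
  refine integrable_of_exp_bound (C := k⁻¹ * 2) (δ := y) ?_ hy (fun a => ?_)
  · unfold PE WF; fun_prop
  · unfold PE
    rw [norm_mul, norm_mul, norm_exp_W, norm_mul, Complex.norm_I, one_mul]
    have i1 := norm_inv_sub hk (m := mH k a) (by rw [mH_im]; exact rH_ge_k k a) q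
    have i2 := mD_norm hk a
    have i3 : Real.exp (-(rH k a * y)) ≤ Real.exp (-y * |a|) := by
      rw [Real.exp_le_exp]; nlinarith [rH_ge_abs k a]
    calc _ ≤ Real.exp (-y * |a|) * k⁻¹ * 2 := by gcongr
      _ = _ := by ring

lemma halfline (D k t y q : ℝ) (hD : 0 < D) (hk : 0 < k) (ht : 0 < t) (hy : 0 < y) :
    ∫ a, PE D k t y q a =
      ∫ s in Set.Ioi (0:ℝ), Complex.exp (-Complex.I * q * s) * NG D k t (y + s) := by
  have h2 := mH_cont k
  have h3 := mD_cont hk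
  set F : ℝ → ℝ → ℂ := fun a s => Complex.exp (-WF D k (mH k a) * t + Complex.I * mH k a * y) *
    mD k a * Complex.exp ((Complex.I * (mH k a - q)) * s) with hF
  have key : Integrable (Function.uncurry F) (volume.prod (volume.restrict (Set.Ioi 0))) := by
    have j1 : Integrable (fun s : ℝ => 2 * Real.exp (-k * s)) (volume.restrict (Set.Ioi 0)) :=
      (integrableOn_exp_mul_Ioi (neg_lt_zero.2 hk) 0).const_mul 2
    refine ((integrable_exp_abs hy).mul_prod j1).mono' ?_ ?_
    · apply Continuous.aestronglyMeasurable
      simp only [Function.uncurry_def, hF, WF]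
      fun_prop
    · have : (volume : Measure ℝ).prod (volume.restrict (Set.Ioi (0:ℝ))) =
          ((volume : Measure ℝ).prod volume).restrict (Set.univ ×ˢ Set.Ioi (0:ℝ)) := by
        rw [← Measure.prod_restrict, Measure.restrict_univ]
      rw [this]
      refine (ae_restrict_iff' (by measurability)).2 (Filter.Eventually.of_forall ?_)
      rintro ⟨a, s⟩ ⟨-, hs⟩
      simp only [Set.mem_Ioi] at hs
      simp only [Function.uncurry_apply_pair, hF]
      rw [norm_mul, norm_mul, norm_exp_W, Complex.norm_exp]
      have e : (Complex.I * (mH k a - q) * s).re = -(rH k a * s) := by simp [mH_im]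
      rw [e]
      have i2 := mD_norm hk a
      have i3 : Real.exp (-(rH k a * y)) ≤ Real.exp (-y * |a|) := by
        rw [Real.exp_le_exp]; nlinarith [rH_ge_abs k a]
      have i4 : Real.exp (-(rH k a * s)) ≤ Real.exp (-k * s) := by
        rw [Real.exp_le_exp]; nlinarith [rH_ge_k k a]
      calc _ ≤ Real.exp (-y * |a|) * 2 * Real.exp (-k * s) := by gcongr
        _ = _ := by ring
  have h := integral_integral_swap key
  have e1 : ∀ a, ∫ s in Set.Ioi (0:ℝ), F a s = PE D k t y q a := by
    intro a
    have hp := rH_pos hk a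
    simp only [hF]
    rw [integral_const_mul, integral_exp_mul_complex_Ioi (by simp [mH_im]; exact hp)]
    unfold PE
    have hne := sub_ne_of_im (m := mH k a) (by rw [mH_im]; exact hp) q
    have : -Complex.exp (Complex.I * (mH k a - q) * ((0:ℝ):ℂ)) / (Complex.I * (mH k a - q)) =
        Complex.I * (mH k a - q)⁻¹ := by
      simp
      rw [div_eq_iff (mul_ne_zero Complex.I_ne_zero hne)]
      field_simp
      simp
    rw [this]; ring
  simp_rw [e1] at h
  rw [h]
  refine setIntegral_congr_fun measurableSet_Ioi (fun s hs => ?_)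
  simp only [Set.mem_Ioi] at hs
  rw [← gaussH D k t (y + s) hD hk ht (by linarith), ← integral_const_mul]
  congr 1
  ext a
  simp only [hF, WF]
  rw [mul_right_comm, ← Complex.exp_add, ← mul_assoc, ← Complex.exp_add]
  congr 2
  push_cast; ring

noncomputable def ZZ (L z q : ℝ) (m : ℂ) : ℂ := ((m - q)⁻¹ + (m - (-q:ℝ))⁻¹) * Sn z L m

lemma ZZ_bound (k L z q : ℝ) (hk : 0 < k) (hL : 0 < L) (hz : 0 ≤ z) : ∃ C,
    ∀ m : ℂ, k ≤ m.im → ‖ZZ L z q m‖ ≤ C * Real.exp (-(L - z) * m.im) := by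
  obtain ⟨C, hC, h⟩ := Sn_bound L k hL hk
  refine ⟨(k⁻¹ + k⁻¹) * C, fun m hm => ?_⟩
  unfold ZZ
  rw [norm_mul, mul_assoc]
  have h1 := norm_add_le (m - q)⁻¹ (m - (-q:ℝ))⁻¹
  have h2 := norm_inv_sub hk hm q
  have h3 := norm_inv_sub hk hm (-q)
  have h4 := h z hz m hm
  gcongr
  linarith

lemma ZZ_int (k L z q : ℝ) (hk : 0 < k) (hL : 0 < L) (hz : 0 ≤ z) (hzL : z < L) :
    Integrable (fun a => ZZ L z q (mH k a) * mD k a) ∧ ∫ a, ZZ L z q (mH k a) * mD k a = 0 := by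
  obtain ⟨C, h⟩ := ZZ_bound k L z q hk hL hz
  have hLz : 0 < L - z := by linarith
  constructor
  · have h1 := inv_cont hk q
    have h1' := inv_cont hk (-q)
    have h2 := mH_cont k
    have h3 := mD_cont hk
    have h4 := Sn_cont hk hL z
    refine integrable_of_exp_bound (C := |C| * 2) (δ := L - z) ?_ hLz (fun a => ?_)
    · unfold ZZ; fun_prop
    · rw [norm_mul]
      have i1 := h (mH k a) (by rw [mH_im]; exact rH_ge_k k a)
      rw [mH_im] at i1
      have i2 := mD_norm hk a
      have i3 : Real.exp (-(L - z) * rH k a) ≤ Real.exp (-(L - z) * |a|) := by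
        rw [Real.exp_le_exp]; nlinarith [rH_ge_abs k a]
      have i4 : C * Real.exp (-(L - z) * rH k a) ≤ |C| * Real.exp (-(L - z) * |a|) :=
        mul_le_mul (le_abs_self _) i3 (Real.exp_pos _).le (abs_nonneg _)
      calc _ ≤ |C| * Real.exp (-(L - z) * |a|) * 2 :=
            mul_le_mul (i1.trans i4) i2 (norm_nonneg _) (by positivity)
        _ = _ := by ring
  · refine zeroH k (L - z) C hk hLz _ ?_ h
    intro m hm
    simp only [Set.mem_ofPred_eq] at hm
    apply DifferentiableAt.differentiableWithinAt
    unfold ZZ Sn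
    have n1 := sub_ne_of_im hm q
    have n2 := sub_ne_of_im hm (-q)
    have n3 := sin_ne hL hm
    refine DifferentiableAt.mul (DifferentiableAt.add (DifferentiableAt.inv (by fun_prop) n1)
      (DifferentiableAt.inv (by fun_prop) n2)) (DifferentiableAt.div ?_ ?_ n3)
    · exact (Complex.differentiable_sin _).comp _ (by fun_prop)
    · exact (Complex.differentiable_sin _).comp _ (by fun_prop)

lemma comb_alg (X Y E1 Q w wq u v : ℂ) :
    -(w * X * ((Q - E1) * (Complex.I * u)) + w * Y * ((Q * E1 - 1) * (-Complex.I * v)) +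
      Complex.I * (u + v) * Y * (wq - w) + Complex.I * (u + v) * X * Q * (wq - w)) =
    w * (E1 * X + Y) * (Complex.I * u) + Q * (w * (E1 * Y + X) * (Complex.I * v)) -
      Complex.I * wq * ((u + v) * Y + Q * ((u + v) * X)) := by
  ring

lemma sin_id1 (L x : ℝ) (m : ℂ) (h : Complex.sin ((L:ℂ) * m) ≠ 0) :
    Complex.exp (Complex.I * m * x) = Complex.exp (Complex.I * m * L) * Sn x L m + Sn (L - x) L m := by
  unfold Sn
  rw [← mul_div_assoc, ← add_div, eq_div_iff h]
  have e1 : Complex.I * m * x = (x * m) * Complex.I := by ring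
  have e2 : Complex.I * m * L = (L * m) * Complex.I := by ring
  have e3 : ((L - x : ℝ):ℂ) * m = L * m - x * m := by push_cast; ring
  rw [e1, e2, e3, Complex.exp_mul_I, Complex.exp_mul_I, Complex.sin_sub]
  ring

lemma sin_id2 (L x : ℝ) (m : ℂ) (h : Complex.sin ((L:ℂ) * m) ≠ 0) :
    Complex.exp (Complex.I * m * ((L - x:ℝ):ℂ)) =
      Complex.exp (Complex.I * m * L) * Sn (L - x) L m + Sn x L m := by
  have := sin_id1 L (L - x) m h
  rwa [sub_sub_cancel] at this
end part7

section part8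
noncomputable def eD (k q ξ : ℝ) : ℂ := Complex.exp (k * ξ + Complex.I * q * ξ)
noncomputable def eT (D k q τ : ℝ) : ℂ := Complex.exp (-(D * (q ^ 2 + k ^ 2)) * τ)

lemma comb (D k L x t q a : ℝ) (hD : 0 < D) (hk : 0 < k) (hL : 0 < L) :
    (A2 D k L x t a * ∫ ξ in (0:ℝ)..L, Complex.exp (p2 k a * (ξ:ℂ)) * eD k q ξ) +
    (A3 D k L x t a * ∫ ξ in (0:ℝ)..L, Complex.exp (p3 k a * (ξ:ℂ)) * eD k q ξ) +
    (A4 D k L x t a * ∫ ξ in (0:ℝ)..t, Complex.exp (p4 D k a * (ξ:ℂ)) * eT D k q ξ) +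
    (A5 D k L x t a * ∫ ξ in (0:ℝ)..t, Complex.exp (p4 D k a * (ξ:ℂ)) * (eD k q L * eT D k q ξ)) =
    (1 / (2 * (Real.pi:ℂ)) * Complex.exp (k * x)) * (PE D k t x q a +
      Complex.exp (Complex.I * q * L) * PE D k t (L - x) (-q) a) -
    (1 / (2 * (Real.pi:ℂ)) * Complex.exp (k * x) * Complex.I * eT D k q t) *
      (ZZ L (L - x) q (mH k a) * mD k a + Complex.exp (Complex.I * q * L) *
        (ZZ L x q (mH k a) * mD k a)) := by
  have hp : 0 < (mH k a).im := by rw [mH_im]; exact rH_pos hk a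
  have hD' : (D:ℂ) ≠ 0 := by exact_mod_cast hD.ne'
  have hs := sin_ne hL hp
  have i1 := sin_id1 L x _ hs
  have i2 := sin_id2 L x _ hs
  have n1 := sub_ne_of_im hp q
  have n2 := sub_ne_of_im hp (-q)
  unfold PE ZZ A2 A3 A4 A5 UK
  rw [Complex.exp_add, Complex.exp_add, i1, i2]
  set m := mH k a with hm
  have n2' : m + q ≠ 0 := by simpa using n2
  have en2 : m - ((-q:ℝ):ℂ) = m + q := by push_cast; ring
  rw [en2]
  set X := Sn x L m
  set Y := Sn (L - x) L m
  set u := (m - q)⁻¹ with hu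
  set v := (m + q)⁻¹ with hv
  set w := Complex.exp (-WF D k m * t) with hw
  have j2 : Complex.exp (Complex.I * m * L) * ∫ ξ in (0:ℝ)..L, Complex.exp (p2 k a * (ξ:ℂ)) * eD k q ξ
      = (Complex.exp (Complex.I * q * L) - Complex.exp (Complex.I * m * L)) * (Complex.I * u) := by
    have e : ∀ ξ : ℝ, Complex.exp (p2 k a * (ξ:ℂ)) * eD k q ξ =
        Complex.exp ((-Complex.I * (m - q)) * ξ) := by
      intro ξ
      unfold p2 eD
      rw [← Complex.exp_add, ← hm]; congr 1; ring
    have hne : -Complex.I * (m - q) ≠ 0 := mul_ne_zero (neg_ne_zero.2 Complex.I_ne_zero) n1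
    simp_rw [e]
    rw [integral_exp_mul_complex hne]
    have e3 : Complex.exp (Complex.I * m * L) * Complex.exp (-Complex.I * (m - q) * L) =
       Complex.exp (Complex.I * q * L) := by rw [← Complex.exp_add]; congr 1; ring
    have e4 : (-Complex.I * (m - q))⁻¹ = Complex.I * u := by
      rw [mul_inv, inv_neg, Complex.inv_I, neg_neg]
    rw [div_eq_mul_inv, e4, ← mul_assoc, mul_sub, e3]
    simp
  have j3 : ∫ ξ in (0:ℝ)..L, Complex.exp (p3 k a * (ξ:ℂ)) * eD k q ξ
      = (Complex.exp (Complex.I * q * L) * Complex.exp (Complex.I * m * L) - 1) * (-Complex.I * v) := by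
    have e : ∀ ξ : ℝ, Complex.exp (p3 k a * (ξ:ℂ)) * eD k q ξ =
        Complex.exp ((Complex.I * (m + q)) * ξ) := by
      intro ξ
      unfold p3 eD
      rw [← Complex.exp_add, ← hm]; congr 1; ring
    have hne : Complex.I * (m + q) ≠ 0 := mul_ne_zero Complex.I_ne_zero n2'
    simp_rw [e]
    rw [integral_exp_mul_complex hne, ← Complex.exp_add]
    have e4 : (Complex.I * (m + q))⁻¹ = -Complex.I * v := by
      rw [mul_inv, Complex.inv_I]
    rw [div_eq_mul_inv, e4]
    simp
    left
    congr 1; ring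
  have j4 : w * (2 * Complex.I * D * m * ∫ ξ in (0:ℝ)..t, Complex.exp (p4 D k a * (ξ:ℂ)) * eT D k q ξ)
      = Complex.I * (u + v) * (eT D k q t - w) := by
    have e : ∀ ξ : ℝ, Complex.exp (p4 D k a * (ξ:ℂ)) * eT D k q ξ =
        Complex.exp ((D * (m - q) * (m + q)) * ξ) := by
      intro ξ
      unfold p4 eT WF
      rw [← Complex.exp_add, ← hm]; congr 1; ring
    have hne : D * (m - q) * (m + q) ≠ 0 := mul_ne_zero (mul_ne_zero hD' n1) n2'
    simp_rw [e]
    rw [integral_exp_mul_complex hne]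
    have e3 : w * Complex.exp (D * (m - q) * (m + q) * t) = eT D k q t := by
      rw [hw, eT, ← Complex.exp_add, WF]; congr 1; ring
    rw [← e3, hu, hv]
    simp
    field_simp
    ring
  have eL : Complex.exp (-(k * L)) * eD k q L = Complex.exp (Complex.I * q * L) := by
    unfold eD; rw [← Complex.exp_add]; congr 1; ring
  have j5 : ∫ ξ in (0:ℝ)..t, Complex.exp (p4 D k a * (ξ:ℂ)) * (eD k q L * eT D k q ξ) =
      eD k q L * ∫ ξ in (0:ℝ)..t, Complex.exp (p4 D k a * (ξ:ℂ)) * eT D k q ξ := by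
    rw [← intervalIntegral.integral_const_mul]
    congr 1; ext ξ; ring
  rw [j5, j3]
  have key := comb_alg X Y (Complex.exp (Complex.I * m * L)) (Complex.exp (Complex.I * q * L)) w
    (eT D k q t) u v
  rw [← eL] at key j2 ⊢
  generalize hI4 : ∫ ξ in (0:ℝ)..t, Complex.exp (p4 D k a * (ξ:ℂ)) * eT D k q ξ = I4 at j4 ⊢
  generalize hI2 : ∫ ξ in (0:ℝ)..L, Complex.exp (p2 k a * (ξ:ℂ)) * eD k q ξ = I2 at j2 ⊢
  unfold c1
  generalize Complex.exp (Complex.I * m * L) = E1 at *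
  generalize 1 / (2 * (Real.pi:ℂ)) = c0
  generalize Complex.exp (k * x) = ek
  generalize Complex.exp (-((k:ℂ) * L)) = eL' at *
  generalize eD k q L = eDL at *
  linear_combination (c0 * ek * mD k a) * key - (c0 * ek * w * X * mD k a) * j2
    - c0 * ek * mD k a * Y * j4 - c0 * ek * eL' * eDL * mD k a * X * j4

lemma iadd {F1 F2 : ℝ → ℂ} (h1 : Integrable F1) (h2 : Integrable F2) :
    Integrable (fun a => F1 a + F2 a) := h1.add h2

lemma int4 {F1 F2 F3 F4 G : ℝ → ℂ} (h1 : Integrable F1) (h2 : Integrable F2) (h3 : Integrable F3)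
    (h4 : Integrable F4) (h : ∀ a, F1 a + F2 a + F3 a + F4 a = G a) :
    (∫ a, F1 a) + (∫ a, F2 a) + (∫ a, F3 a) + (∫ a, F4 a) = ∫ a, G a := by
  rw [← integral_add h1 h2, ← integral_add (iadd h1 h2) h3,
      ← integral_add (iadd (iadd h1 h2) h3) h4]
  congr 1; ext a; exact h a

lemma RR_exp (D k L x t q : ℝ) (hD : 0 < D) (hk : 0 < k) (hL : 0 < L) (hx : x ∈ Set.Ioo 0 L)
    (ht : 0 < t) :
    RR D k L x t (eD k q) (eT D k q) (fun τ => eD k q L * eT D k q τ) = eD k q x * eT D k q t := by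
  have cD : Continuous (eD k q) := by unfold eD; fun_prop
  have cT : Continuous (eT D k q) := by unfold eT; fun_prop
  obtain ⟨_, _, h2⟩ := good2 D k L x t hk hL hx
  obtain ⟨_, _, h3⟩ := good3 D k L x t hk hL hx
  obtain ⟨_, _, h4⟩ := good4 D k L x t hk hL hx ht
  obtain ⟨_, _, h5⟩ := good5 D k L x t hk hL hx ht
  have g2 := h2.integrable cD
  have g3 := h3.integrable cD
  have g4 := h4.integrable cT
  have g5 := h5.integrable (d := fun τ => eD k q L * eT D k q τ) (by fun_prop)
  have s1 := JJ1_eq D k L x t q hD hL ht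
  have hLx : 0 < L - x := by linarith [hx.2]
  have q1 := PE_integrable D k t x q hk hx.1
  have q2 := PE_integrable D k t (L - x) (-q) hk hLx
  have z1 := ZZ_int k L (L - x) q hk hL hLx.le (by linarith [hx.1])
  have z2 := ZZ_int k L x q hk hL hx.1.le hx.2
  have s2 : JJ (A2 D k L x t) (p2 k) L (eD k q) + JJ (A3 D k L x t) (p3 k) L (eD k q) +
      JJ (A4 D k L x t) (p4 D k) t (eT D k q) +
      JJ (A5 D k L x t) (p4 D k) t (fun τ => eD k q L * eT D k q τ) =
      (1 / (2 * (Real.pi:ℂ)) * Complex.exp (k * x)) * ((∫ a, PE D k t x q a) +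
      Complex.exp (Complex.I * q * L) * ∫ a, PE D k t (L - x) (-q) a) := by
    unfold JJ
    rw [int4 g2 g3 g4 g5 (fun a => comb D k L x t q a hD hk hL)]
    rw [integral_sub ((iadd q1 (q2.const_mul _)).const_mul _)
      ((iadd z1.1 (z2.1.const_mul _)).const_mul _), integral_const_mul, integral_const_mul,
      integral_add q1 (q2.const_mul _), integral_add z1.1 (z2.1.const_mul _), integral_const_mul,
      integral_const_mul, z1.2, z2.2]
    ring
  rw [halfline D k t x q hD hk ht hx.1, halfline D k t (L - x) (-q) hD hk ht hLx] at s2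
  have s3 := GQ_split D k L x t q hD ht
  rw [GQ_total D k x t q hD ht] at s3
  have s1' : JJ (A1 D k x t) p1 L (eD k q) = _ := s1
  have hneg : ∀ s : ℝ, -Complex.I * ((-q:ℝ):ℂ) * s = Complex.I * q * s := by
    intro s; push_cast; ring
  simp_rw [hneg] at s2
  have fin : eD k q x * eT D k q t = Complex.exp (k * x) * Complex.exp (Complex.I * q * x - D * (q^2 + k^2) * t) := by
    unfold eD eT
    rw [← Complex.exp_add, ← Complex.exp_add]; congr 1; ring
  have hpi : (1 / (2 * (Real.pi:ℂ))) * (2 * Real.pi) = 1 := by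
    have : (Real.pi:ℂ) ≠ 0 := by exact_mod_cast Real.pi_ne_zero
    field_simp
  unfold RR
  rw [fin]
  linear_combination s1' + s2 + (1 / (2 * (Real.pi:ℂ)) * Complex.exp (k * x)) * s3 +
    Complex.exp (k * x) * Complex.exp (Complex.I * q * x - D * (q^2 + k^2) * t) * hpi
end part8

section part9
structure VGood (D k L : ℝ) (v : ℝ → ℝ → ℂ) : Prop where
  cont : Continuous (fun p : ℝ × ℝ => v p.1 p.2)
  pde : ∃ vx vxx : ℝ → ℝ → ℂ, (∀ x t, HasDerivAt (fun y => v y t) (vx x t) x) ∧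
    (∀ x t, HasDerivAt (fun y => vx y t) (vxx x t) x) ∧
    (∀ x t, HasDerivAt (fun τ => v x τ) (D * vxx x t - 2 * D * k * vx x t) t)
  rep : 0 < D → 0 < k → 0 < L → ∀ x ∈ Set.Ioo 0 L, ∀ t > 0,
    RR D k L x t (fun ξ => v ξ 0) (fun τ => v 0 τ) (fun τ => v L τ) = v x t

lemma VGood.c1 {D k L : ℝ} {v : ℝ → ℝ → ℂ} (h : VGood D k L v) (t : ℝ) : Continuous (fun x => v x t) :=
  h.cont.comp (by fun_prop : Continuous fun x : ℝ => (x, t))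
lemma VGood.c2 {D k L : ℝ} {v : ℝ → ℝ → ℂ} (h : VGood D k L v) (x : ℝ) : Continuous (fun t => v x t) :=
  h.cont.comp (by fun_prop : Continuous fun t : ℝ => (x, t))

lemma VGood.add {D k L : ℝ} {v w : ℝ → ℝ → ℂ} (hv : VGood D k L v) (hw : VGood D k L w) :
    VGood D k L (v + w) := by
  refine ⟨hv.cont.add hw.cont, ?_, ?_⟩
  · obtain ⟨a, b, h1, h2, h3⟩ := hv.pde
    obtain ⟨a', b', h1', h2', h3'⟩ := hw.pde
    refine ⟨a + a', b + b', fun x t => (h1 x t).add (h1' x t), fun x t => (h2 x t).add (h2' x t),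
      fun x t => ?_⟩
    refine ((h3 x t).add (h3' x t)).congr_deriv ?_
    simp only [Pi.add_apply]; ring
  · intro hD hk hL x hx t ht
    have := RR_add D k L x t hD hk hL hx ht (hv.c1 0) (hv.c2 0) (hv.c2 L) (hw.c1 0) (hw.c2 0) (hw.c2 L)
    simp only [Pi.add_apply]
    rw [this, hv.rep hD hk hL x hx t ht, hw.rep hD hk hL x hx t ht]

lemma VGood.smul {D k L : ℝ} {v : ℝ → ℝ → ℂ} (c : ℂ) (hv : VGood D k L v) :
    VGood D k L (c • v) := by
  refine ⟨hv.cont.const_smul c, ?_, ?_⟩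
  · obtain ⟨a, b, h1, h2, h3⟩ := hv.pde
    refine ⟨c • a, c • b, fun x t => (h1 x t).const_smul c, fun x t => (h2 x t).const_smul c,
      fun x t => ?_⟩
    refine ((h3 x t).const_smul c).congr_deriv ?_
    simp only [Pi.smul_apply, smul_eq_mul]; ring
  · intro hD hk hL x hx t ht
    have := RR_smul D k L x t c (fun ξ => v ξ 0) (fun τ => v 0 τ) (fun τ => v L τ)
    simp only [Pi.smul_apply, smul_eq_mul]
    rw [this, hv.rep hD hk hL x hx t ht]

noncomputable def eQ (D k q : ℝ) : ℝ → ℝ → ℂ := fun x t => eD k q x * eT D k q t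

lemma eD_zero (k q : ℝ) : eD k q 0 = 1 := by simp [eD]
lemma eT_zero (D k q : ℝ) : eT D k q 0 = 1 := by simp [eT]

lemma eQ_good (D k L q : ℝ) : VGood D k L (eQ D k q) := by
  have dD : ∀ x, HasDerivAt (eD k q) ((k + Complex.I * q) * eD k q x) x := by
    intro x
    have : HasDerivAt (fun x : ℝ => (k + Complex.I * q) * (x:ℂ)) ((k + Complex.I * q) * 1) x :=
      (Complex.ofRealCLM.hasDerivAt (x := x)).const_mul _
    have h2 := this.cexp
    unfold eD
    convert h2 using 1
    · ext y; congr 1; ring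
    · rw [mul_one, mul_comm]; congr 2; ring
  have dT : ∀ t, HasDerivAt (eT D k q) (-(D * (q ^ 2 + k ^ 2)) * eT D k q t) t := by
    intro x
    have : HasDerivAt (fun x : ℝ => -((D:ℂ) * (q ^ 2 + k ^ 2)) * (x:ℂ)) (-((D:ℂ) * (q ^ 2 + k ^ 2)) * 1) x :=
      (Complex.ofRealCLM.hasDerivAt (x := x)).const_mul _
    have h2 := this.cexp
    unfold eT
    convert h2 using 1
    ring
  refine ⟨?_, ⟨fun x t => (k + Complex.I * q) * eQ D k q x t,
    fun x t => (k + Complex.I * q) ^ 2 * eQ D k q x t, fun x t => ?_, fun x t => ?_, fun x t => ?_⟩, ?_⟩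
  · unfold eQ eD eT; fun_prop
  · unfold eQ
    refine ((dD x).mul_const (eT D k q t)).congr_deriv ?_
    ring
  · unfold eQ
    refine (((dD x).mul_const (eT D k q t)).const_mul (k + Complex.I * q)).congr_deriv ?_
    ring
  · unfold eQ
    refine ((dT t).const_mul (eD k q x)).congr_deriv ?_
    linear_combination (-eD k q x * eT D k q t * D * q^2) * Complex.I_sq
  · intro hD hk hL x hx t ht
    have := RR_exp D k L x t q hD hk hL hx ht
    unfold eQ
    rw [← this]
    congr 1
    · ext ξ; rw [eT_zero, mul_one]
    · ext ξ; rw [eD_zero, one_mul]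

noncomputable def VS (D k L : ℝ) : Submodule ℂ (ℝ → ℝ → ℂ) where
  carrier := {v | VGood D k L v}
  add_mem' := fun h1 h2 => VGood.add h1 h2
  zero_mem' := by
    have := VGood.smul 0 (eQ_good D k L 0)
    rwa [zero_smul] at this
  smul_mem' := fun c _ h => VGood.smul c h

noncomputable def sQ (D k q : ℝ) : ℝ → ℝ → ℂ :=
  fun x t => Complex.exp (k * x) * Complex.sin (q * x) * eT D k q t
noncomputable def sQ' (D k L q : ℝ) : ℝ → ℝ → ℂ :=
  fun x t => Complex.exp (k * x) * Complex.sin (q * (L - x)) * eT D k q t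

lemma eQ_mem (D k L q : ℝ) : eQ D k q ∈ VS D k L := eQ_good D k L q

lemma eT_neg (D k q t : ℝ) : eT D k (-q) t = eT D k q t := by
  unfold eT; push_cast; rw [neg_sq]

lemma eD_eq (k q x : ℝ) : eD k q x =
    Complex.exp (k * x) * (Complex.cos (q * x) + Complex.sin (q * x) * Complex.I) := by
  unfold eD
  rw [Complex.exp_add, ← Complex.exp_mul_I]
  congr 2; ring
lemma eD_neg_eq (k q x : ℝ) : eD k (-q) x =
    Complex.exp (k * x) * (Complex.cos (q * x) - Complex.sin (q * x) * Complex.I) := by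
  rw [eD_eq]; push_cast; rw [neg_mul, Complex.cos_neg, Complex.sin_neg]; ring

lemma sQ_mem (D k L q : ℝ) : sQ D k q ∈ VS D k L := by
  have : sQ D k q = (-Complex.I / 2) • eQ D k q + (Complex.I / 2) • eQ D k (-q) := by
    ext x t
    simp only [sQ, eQ, Pi.add_apply, Pi.smul_apply, smul_eq_mul, eT_neg, eD_eq k q x, eD_neg_eq k q x]
    linear_combination (Complex.exp (k * x) * Complex.sin (q * x) * eT D k q t) * Complex.I_sq
  rw [this]
  exact add_mem (Submodule.smul_mem _ _ (eQ_mem ..)) (Submodule.smul_mem _ _ (eQ_mem ..))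

lemma sQ'_mem (D k L q : ℝ) : sQ' D k L q ∈ VS D k L := by
  have : sQ' D k L q = (Complex.sin (q * L)) • ((1/2:ℂ) • eQ D k q + (1 / 2:ℂ) • eQ D k (-q)) -
      (Complex.cos (q * L)) • sQ D k q := by
    ext x t
    simp only [sQ', sQ, eQ, Pi.add_apply, Pi.sub_apply, Pi.smul_apply, smul_eq_mul, eT_neg, eD_eq k q x, eD_neg_eq k q x]
    rw [mul_sub, Complex.sin_sub]
    ring
  rw [this]
  exact sub_mem (Submodule.smul_mem _ _ (add_mem (Submodule.smul_mem _ _ (eQ_mem ..))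
    (Submodule.smul_mem _ _ (eQ_mem ..)))) (Submodule.smul_mem _ _ (sQ_mem ..))
end part9

section part10
noncomputable def qj (L : ℝ) (j : ℕ) : ℝ := Real.pi / L * Real.sqrt (Real.sqrt 2 * (j + 1))
noncomputable def sg (D L : ℝ) : ℝ := D * (Real.pi / L) ^ 2 * Real.sqrt 2

lemma sg_pos {D L : ℝ} (hD : 0 < D) (hL : 0 < L) : 0 < sg D L := by
  unfold sg; have := Real.pi_pos; positivity

lemma qj_sq (D L : ℝ) (j : ℕ) : D * qj L j ^ 2 = sg D L * (j + 1) := by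
  unfold qj sg
  rw [mul_pow, Real.sq_sqrt (by positivity)]
  ring

lemma sin_qj {L : ℝ} (hL : 0 < L) (j : ℕ) : Real.sin (qj L j * L) ≠ 0 := by
  intro h
  obtain ⟨n, hn⟩ := Real.sin_eq_zero_iff.1 h
  unfold qj at hn
  have h1 : (n:ℝ) = Real.sqrt (Real.sqrt 2 * (j + 1)) := by
    have hp := Real.pi_pos
    field_simp at hn
    linarith
  have h2 : (n:ℝ)^2 = Real.sqrt 2 * (j + 1) := by
    rw [h1, Real.sq_sqrt (by positivity)]
  apply irrational_sqrt_two
  refine ⟨(n:ℚ)^2 / ((j:ℚ) + 1), ?_⟩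
  push_cast
  rw [h2]
  field_simp

lemma side_approx (D k L : ℝ) (hD : 0 < D) (hL : 0 < L) (z0 z1 : ℝ)
    (w : ℕ → ℝ → ℝ → ℂ) (hw : ∀ j, w j ∈ VS D k L) (h0 : ∀ j t, w j z0 t = 0)
    (h1 : ∀ j t, w j z1 t = eT D k (qj L j) t) (h : ℝ → ℝ) (hc : Continuous h) (T ε : ℝ)
    (hε : 0 < ε) : ∃ v ∈ VS D k L, (∀ t, v z0 t = 0) ∧
      ∀ τ ∈ Set.Icc (0:ℝ) T, ‖v z1 τ - h τ‖ ≤ ε := by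
  have hs := sg_pos hD hL
  set σ := sg D L with hσ
  set F : ℝ → ℝ := fun y => h (-Real.log y / σ) * Real.exp (-(1 + D * k ^ 2 / σ) * Real.log y) with hF
  have hFc : ContinuousOn F (Set.Icc (Real.exp (-σ * T)) 1) := by
    have hl : ContinuousOn Real.log (Set.Icc (Real.exp (-σ * T)) 1) :=
      Real.continuousOn_log.mono (fun y hy => by
        have := (Real.exp_pos (-σ * T)).trans_le hy.1
        simp; exact this.ne')
    refine ContinuousOn.mul (hc.comp_continuousOn (by fun_prop)) ?_
    exact Real.continuous_exp.comp_continuousOn (by fun_prop)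
  obtain ⟨p, hp⟩ := exists_polynomial_near_of_continuousOn _ _ F hFc ε hε
  refine ⟨∑ j ∈ Finset.range (p.natDegree + 1), (p.coeff j : ℂ) • w j,
    Submodule.sum_mem _ (fun j _ => Submodule.smul_mem _ _ (hw j)), fun t => ?_, fun τ hτ => ?_⟩
  · simp [Finset.sum_apply, h0]
  · simp only [Finset.sum_apply, Pi.smul_apply, smul_eq_mul, h1]
    set y := Real.exp (-σ * τ) with hy
    have hyI : y ∈ Set.Icc (Real.exp (-σ * T)) 1 := by
      constructor
      · rw [hy, Real.exp_le_exp]; nlinarith [hτ.2]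
      · rw [hy, Real.exp_le_one_iff]; nlinarith [hτ.1]
    have hpy := hp y hyI
    have hlog : Real.log y = -σ * τ := by rw [hy, Real.log_exp]
    set c := y * Real.exp (-(D * k ^ 2) * τ) with hcdef
    have hc1 : |c| ≤ 1 := by
      rw [abs_of_pos (by positivity), hcdef]
      refine mul_le_one₀ hyI.2 (Real.exp_pos _).le ?_
      rw [Real.exp_le_one_iff]
      have : 0 ≤ D * k^2 * τ := mul_nonneg (by positivity) hτ.1
      linarith
    have e1 : ∀ j : ℕ, (p.coeff j : ℂ) * eT D k (qj L j) τ = ((c * (p.coeff j * y ^ j) : ℝ) : ℂ) := by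
      intro j
      have : eT D k (qj L j) τ = ((c * y ^ j : ℝ) : ℂ) := by
        unfold eT
        rw [hcdef, hy, ← Real.exp_nat_mul, ← Real.exp_add, ← Real.exp_add]
        push_cast
        congr 1
        have := qj_sq D L j
        have h' : (D:ℂ) * (qj L j : ℂ)^2 = σ * (j + 1) := by
          rw [hσ]; exact_mod_cast this
        linear_combination (-(τ:ℂ)) * h'
      rw [this]; push_cast; ring
    have e2 : h τ = c * F y := by
      simp only [hF, hcdef, hy, Real.log_exp]
      have a1 : -(-σ * τ) / σ = τ := by field_simp
      rw [a1]
      have : Real.exp (-σ * τ) * Real.exp (-(D * k ^ 2) * τ) *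
        Real.exp (-(1 + D * k ^ 2 / σ) * (-σ * τ)) = 1 := by
        rw [← Real.exp_add, ← Real.exp_add, Real.exp_eq_one_iff]
        field_simp
        ring
      linear_combination (-h τ) * this
    simp_rw [e1]
    rw [← Complex.ofReal_sum, ← Finset.mul_sum, ← Polynomial.eval_eq_sum_range, e2,
      ← Complex.ofReal_sub, Complex.norm_real, Real.norm_eq_abs, ← mul_sub, abs_mul]
    calc _ ≤ 1 * ε := mul_le_mul hc1 hpy.le (abs_nonneg _) zero_le_one
      _ = ε := one_mul _

lemma csin_qj {L : ℝ} (hL : 0 < L) (j : ℕ) : Complex.sin (qj L j * L) ≠ 0 := by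
  have := sin_qj hL j
  rw [← Complex.ofReal_mul, ← Complex.ofReal_sin]
  exact_mod_cast this

lemma right_approx (D k L : ℝ) (hD : 0 < D) (hL : 0 < L) (h : ℝ → ℝ) (hc : Continuous h) (T ε : ℝ)
    (hε : 0 < ε) : ∃ v ∈ VS D k L, (∀ t, v 0 t = 0) ∧
      ∀ τ ∈ Set.Icc (0:ℝ) T, ‖v L τ - h τ‖ ≤ ε := by
  refine side_approx D k L hD hL 0 L
    (fun j => (Complex.exp (-(k * L)) / Complex.sin (qj L j * L)) • sQ D k (qj L j))
    (fun j => Submodule.smul_mem _ _ (sQ_mem ..)) ?_ ?_ h hc T ε hε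
  · intro j t; simp [sQ]
  · intro j t
    simp only [sQ, Pi.smul_apply, smul_eq_mul]
    have := csin_qj hL j
    have e : Complex.exp (-(k * L)) * Complex.exp (k * L) = 1 := by
      rw [← Complex.exp_add]; simp
    generalize Complex.sin (qj L j * L) = S at *
    field_simp
    linear_combination eT D k (qj L j) t * e

lemma left_approx (D k L : ℝ) (hD : 0 < D) (hL : 0 < L) (h : ℝ → ℝ) (hc : Continuous h) (T ε : ℝ)
    (hε : 0 < ε) : ∃ v ∈ VS D k L, (∀ t, v L t = 0) ∧
      ∀ τ ∈ Set.Icc (0:ℝ) T, ‖v 0 τ - h τ‖ ≤ ε := by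
  refine side_approx D k L hD hL L 0
    (fun j => (1 / Complex.sin (qj L j * L)) • sQ' D k L (qj L j))
    (fun j => Submodule.smul_mem _ _ (sQ'_mem ..)) ?_ ?_ h hc T ε hε
  · intro j t; simp [sQ']
  · intro j t
    simp only [sQ', Pi.smul_apply, smul_eq_mul]
    have := csin_qj hL j
    simp
    field_simp

lemma sincos_mem (D k L : ℝ) (hL : 0 < L) (n : ℕ) : ∀ a : ℤ, ∃ v ∈ VS D k L, (∀ t, v 0 t = 0) ∧
    (∀ t, v L t = 0) ∧ ∀ x : ℝ, v x 0 = Complex.exp (k * x) *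
      ((Real.sin (a * (Real.pi / L * x)) * Real.cos (Real.pi / L * x) ^ n : ℝ) : ℂ) := by
  induction n with
  | zero =>
    intro a
    refine ⟨sQ D k (a * (Real.pi / L)), sQ_mem .., fun t => by simp [sQ], fun t => ?_, fun x => ?_⟩
    · unfold sQ
      have : Complex.sin (((a * (Real.pi / L) : ℝ):ℂ) * L) = 0 := by
        rw [← Complex.ofReal_mul, ← Complex.ofReal_sin]
        have : (a * (Real.pi / L)) * L = a * Real.pi := by field_simp
        rw [this, Real.sin_int_mul_pi]; simp
      rw [this]; ring
    · unfold sQ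
      rw [eT_zero]
      push_cast
      simp [mul_assoc]
  | succ n ih =>
    intro a
    obtain ⟨v, hv, h0, hL', hx⟩ := ih (a + 1)
    obtain ⟨v', hv', h0', hL'', hx'⟩ := ih (a - 1)
    refine ⟨(1/2:ℂ) • (v + v'), Submodule.smul_mem _ _ (add_mem hv hv'), fun t => by simp [h0, h0'],
      fun t => by simp [hL', hL''], fun x => ?_⟩
    simp only [Pi.smul_apply, Pi.add_apply, smul_eq_mul, hx, hx']
    have e1 : (((a + 1 : ℤ):ℝ) * (Real.pi / L * x)) = a * (Real.pi / L * x) + Real.pi / L * x := by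
      push_cast; ring
    have e2 : (((a - 1 : ℤ):ℝ) * (Real.pi / L * x)) = a * (Real.pi / L * x) - Real.pi / L * x := by
      push_cast; ring
    rw [e1, e2, Real.sin_add, Real.sin_sub, pow_succ]
    push_cast
    ring

lemma init_real (D k L : ℝ) (hL : 0 < L) (h : ℝ → ℝ) (hc : Continuous h) (h0 : h 0 = 0) (hL0 : h L = 0)
    (ε : ℝ) (hε : 0 < ε) : ∃ v ∈ VS D k L, (∀ t, v 0 t = 0) ∧
    (∀ t, v L t = 0) ∧ ∀ x ∈ Set.Icc 0 L, ‖v x 0 - Complex.exp (k * x) * h x‖ ≤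
      Real.exp (k * x) * ε := by
  have hpi := Real.pi_pos
  set s : ℝ → ℝ := fun x => Real.sin (Real.pi / L * x) with hs
  have hsc : Continuous s := by rw [hs]; fun_prop
  obtain ⟨M, hM⟩ := isCompact_Icc.exists_bound_of_continuousOn (s := Set.Icc 0 L) hc.continuousOn
  have hM0 : 0 ≤ M := (norm_nonneg _).trans (hM 0 ⟨le_rfl, hL.le⟩)
  have hspos : ∀ x ∈ Set.Ioo 0 L, 0 < s x := by
    intro x hx
    apply Real.sin_pos_of_pos_of_lt_pi
    · have := hx.1; positivity
    · rw [div_mul_eq_mul_div, div_lt_iff₀ hL]; nlinarith [hx.2]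
  have hsnn : ∀ x ∈ Set.Icc 0 L, 0 ≤ s x := by
    intro x hx
    apply Real.sin_nonneg_of_nonneg_of_le_pi
    · have := hx.1; positivity
    · rw [div_mul_eq_mul_div, div_le_iff₀ hL]; nlinarith [hx.2]
  have hK : IsCompact {x ∈ Set.Icc 0 L | ε / 2 ≤ |h x|} := by
    refine isCompact_Icc.inter_right (t := {x | ε / 2 ≤ |h x|}) ?_
    exact isClosed_le continuous_const hc.abs
  obtain ⟨m, hm, hmK⟩ := hK.exists_forall_le' (f := fun x => s x ^ 2) (a := 0) (by fun_prop) (by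
    rintro x ⟨hx, hx2⟩
    have n0 : x ≠ 0 := by rintro rfl; rw [h0] at hx2; simp at hx2; linarith
    have n1 : x ≠ L := by rintro rfl; rw [hL0] at hx2; simp at hx2; linarith
    have := hspos x ⟨lt_of_le_of_ne hx.1 (Ne.symm n0), lt_of_le_of_ne hx.2 n1⟩
    positivity)
  set δ := ε / 2 * m / (M + 1) with hδ
  have hδ0 : 0 < δ := by positivity
  -- approximation of h by h s^2/(s^2+δ)
  have hA : ∀ x ∈ Set.Icc 0 L, |h x * (s x ^ 2 / (s x ^ 2 + δ)) - h x| ≤ ε / 2 := by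
    intro x hx
    have hp : 0 < s x ^ 2 + δ := by positivity
    have e : h x * (s x ^ 2 / (s x ^ 2 + δ)) - h x = -(h x * (δ / (s x ^ 2 + δ))) := by
      field_simp; ring
    rw [e, abs_neg, abs_mul, abs_of_pos (a := δ / (s x ^ 2 + δ)) (by positivity)]
    by_cases hxK : ε / 2 ≤ |h x|
    · have h1 := hmK x ⟨hx, hxK⟩
      have h2 : |h x| ≤ M := hM x hx
      calc |h x| * (δ / (s x ^ 2 + δ)) ≤ M * (δ / m) := by
            gcongr
            linarith
        _ = ε / 2 * (M / (M + 1)) := by rw [hδ]; field_simp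
        _ ≤ ε / 2 * 1 := by
            gcongr
            rw [div_le_one (by positivity)]; linarith
        _ = ε / 2 := mul_one _
    · push Not at hxK
      calc |h x| * (δ / (s x ^ 2 + δ)) ≤ |h x| * 1 := by
            gcongr
            rw [div_le_one hp]; nlinarith [sq_nonneg (s x)]
        _ ≤ _ := by linarith
  set G : ℝ → ℝ := fun y => h (L / Real.pi * Real.arccos y) *
    (Real.sin (Real.arccos y) / (Real.sin (Real.arccos y) ^ 2 + δ)) with hG
  have hGc : Continuous G := by
    rw [hG]
    have := Real.continuous_arccos
    refine Continuous.mul (by fun_prop) (Continuous.div (by fun_prop) (by fun_prop) (fun y => ?_))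
    positivity
  obtain ⟨p, hp⟩ := exists_polynomial_near_of_continuousOn (-1) 1 G hGc.continuousOn (ε / 2) (by positivity)
  choose v hv hv0 hvL hvx using fun n => sincos_mem D k L hL n 1
  refine ⟨∑ j ∈ Finset.range (p.natDegree + 1), (p.coeff j : ℂ) • v j,
    Submodule.sum_mem _ (fun j _ => Submodule.smul_mem _ _ (hv j)), fun t => by simp [Finset.sum_apply, hv0],
    fun t => by simp [Finset.sum_apply, hvL], fun x hx => ?_⟩
  simp only [Finset.sum_apply, Pi.smul_apply, smul_eq_mul, hvx]
  set y := Real.cos (Real.pi / L * x) with hy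
  have hyI : y ∈ Set.Icc (-1:ℝ) 1 := ⟨Real.neg_one_le_cos _, Real.cos_le_one _⟩
  have harc : Real.arccos y = Real.pi / L * x := by
    rw [hy, Real.arccos_cos]
    · have := hx.1; positivity
    · rw [div_mul_eq_mul_div, div_le_iff₀ hL]; nlinarith [hx.2]
  have hGy : G y = h x * (s x / (s x ^ 2 + δ)) := by
    simp only [hG, harc, hs]
    congr 2
    field_simp
  have h1 := hp y hyI
  have h2 := hA x hx
  have e : ∑ j ∈ Finset.range (p.natDegree + 1), (p.coeff j : ℂ) * (Complex.exp (k * x) *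
      ((Real.sin (((1:ℤ):ℝ) * (Real.pi / L * x)) * y ^ j : ℝ) : ℂ)) =
      Complex.exp (k * x) * ((s x * p.eval y : ℝ) : ℂ) := by
    rw [Polynomial.eval_eq_sum_range, Finset.mul_sum]
    push_cast
    rw [Finset.mul_sum]
    refine Finset.sum_congr rfl (fun j _ => ?_)
    simp only [hs]
    push_cast
    rw [one_mul]; ring
  rw [e, ← mul_sub, norm_mul, ← Complex.ofReal_sub, Complex.norm_real, ← Complex.ofReal_mul,
    Complex.norm_exp_ofReal]
  gcongr
  rw [Real.norm_eq_abs]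
  have h3 : |s x * p.eval y - h x * (s x ^ 2 / (s x ^ 2 + δ))| ≤ ε / 2 := by
    have : s x * p.eval y - h x * (s x ^ 2 / (s x ^ 2 + δ)) = s x * (p.eval y - G y) := by
      rw [hGy]; ring
    rw [this, abs_mul]
    calc _ ≤ 1 * (ε / 2) := mul_le_mul (Real.abs_sin_le_one _) h1.le (abs_nonneg _) zero_le_one
      _ = _ := one_mul _
  have := abs_add_le (s x * p.eval y - h x * (s x ^ 2 / (s x ^ 2 + δ))) (h x * (s x ^ 2 / (s x ^ 2 + δ)) - h x)
  rw [sub_add_sub_cancel] at this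
  linarith

lemma init_cplx (D k L : ℝ) (hL : 0 < L) (h : ℝ → ℂ) (hc : Continuous h) (h0 : h 0 = 0) (hL0 : h L = 0)
    (ε : ℝ) (hε : 0 < ε) : ∃ v ∈ VS D k L, (∀ t, v 0 t = 0) ∧
    (∀ t, v L t = 0) ∧ ∀ x ∈ Set.Icc 0 L, ‖v x 0 - Complex.exp (k * x) * h x‖ ≤
      Real.exp (k * x) * ε := by
  obtain ⟨v, hv, v0, vL, vx⟩ := init_real D k L hL (fun x => (h x).re) (Complex.continuous_re.comp hc)
    (by simp [h0]) (by simp [hL0]) (ε / 2) (by positivity)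
  obtain ⟨w, hw, w0, wL, wx⟩ := init_real D k L hL (fun x => (h x).im) (Complex.continuous_im.comp hc)
    (by simp [h0]) (by simp [hL0]) (ε / 2) (by positivity)
  refine ⟨v + Complex.I • w, add_mem hv (Submodule.smul_mem _ _ hw), fun t => by simp [v0, w0],
    fun t => by simp [vL, wL], fun x hx => ?_⟩
  have e : (v + Complex.I • w) x 0 - Complex.exp (k * x) * h x =
      (v x 0 - Complex.exp (k * x) * (h x).re) + Complex.I * (w x 0 - Complex.exp (k * x) * (h x).im) := by
    simp only [Pi.add_apply, Pi.smul_apply, smul_eq_mul]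
    linear_combination (-Complex.exp (k * x)) * (Complex.re_add_im (h x)).symm
  rw [e]
  refine (norm_add_le _ _).trans ?_
  rw [norm_mul, Complex.norm_I, one_mul]
  have := vx x hx
  have := wx x hx
  linarith

lemma density (D k L : ℝ) (hD : 0 < D) (hk : 0 < k) (hL : 0 < L) (d f g : ℝ → ℝ) (hd : Continuous d)
    (hf : Continuous f) (hg : Continuous g) (hc0 : d 0 = f 0) (hcL : d L = g 0) (T : ℝ) (hT : 0 ≤ T)
    (ε : ℝ) (hε : 0 < ε) : ∃ v ∈ VS D k L, (∀ x ∈ Set.Icc 0 L, ‖v x 0 - d x‖ ≤ ε) ∧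
      (∀ τ ∈ Set.Icc 0 T, ‖v 0 τ - f τ‖ ≤ ε) ∧ (∀ τ ∈ Set.Icc 0 T, ‖v L τ - g τ‖ ≤ ε) := by
  set ε' := ε / (2 * Real.exp (k * L)) with hε'
  have hε'0 : 0 < ε' := by positivity
  have hE1 : 1 ≤ Real.exp (k * L) := Real.one_le_exp (by positivity)
  have hee : Real.exp (k * L) * ε' = ε / 2 := by rw [hε']; field_simp
  have hle : ε' ≤ ε / 2 := by nlinarith
  obtain ⟨v1, m1, z1, a1⟩ := right_approx D k L hD hL g hg T ε' hε'0
  obtain ⟨v2, m2, z2, a2⟩ := left_approx D k L hD hL f hf T ε' hε'0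
  have c1 : Continuous fun x => v1 x 0 := VGood.c1 m1 0
  have c2 : Continuous fun x => v2 x 0 := VGood.c1 m2 0
  set h : ℝ → ℂ := fun x => Complex.exp (-(k * x)) * (d x - v1 x 0 - v2 x 0) with hh
  have ch : Continuous h := by rw [hh]; fun_prop
  set l : ℝ → ℂ := fun x => ((1 - x / L : ℝ) : ℂ) * h 0 + ((x / L : ℝ) : ℂ) * h L with hl
  have cl : Continuous l := by rw [hl]; fun_prop
  have n0 : ‖h 0‖ ≤ ε' := by
    have := a2 0 ⟨le_rfl, hT⟩
    simp only [hh, z1]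
    rw [norm_sub_rev] at this
    simpa [hc0] using this
  have nL : ‖h L‖ ≤ ε' := by
    have := a1 0 ⟨le_rfl, hT⟩
    simp only [hh, z2]
    rw [norm_sub_rev] at this
    rw [sub_zero, hcL, norm_mul, ← Complex.ofReal_mul, ← Complex.ofReal_neg, Complex.norm_exp_ofReal]
    have h1 : Real.exp (-(k * L)) ≤ 1 := by rw [Real.exp_le_one_iff]; nlinarith [mul_pos hk hL]
    calc _ ≤ 1 * ε' := mul_le_mul h1 this (norm_nonneg _) zero_le_one
      _ = _ := one_mul _
  obtain ⟨v3, m3, z3, z3', a3⟩ := init_cplx D k L hL (fun x => h x - l x) (ch.sub cl)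
    (by simp [hl]) (by simp [hl, hL.ne']) ε' hε'0
  refine ⟨v1 + v2 + v3, add_mem (add_mem m1 m2) m3, fun x hx => ?_, fun τ hτ => ?_, fun τ hτ => ?_⟩
  · have nl : ‖l x‖ ≤ ε' := by
      have hx1 : 0 ≤ x / L := div_nonneg hx.1 hL.le
      have hx2 : x / L ≤ 1 := (div_le_one hL).2 hx.2
      simp only [hl]
      generalize h 0 = u at n0 ⊢
      generalize h L = w at nL ⊢
      refine (norm_add_le _ _).trans ?_
      rw [norm_mul, norm_mul, Complex.norm_real, Complex.norm_real, Real.norm_of_nonneg hx1,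
        Real.norm_of_nonneg (by linarith : 0 ≤ 1 - x / L)]
      nlinarith
    have h3 := a3 x hx
    have eE : Complex.exp (k * x) * Complex.exp (-(k * x)) = 1 := by
      rw [← Complex.exp_add]; simp
    have e : (v1 + v2 + v3) x 0 - (d x : ℂ) = (v3 x 0 - Complex.exp (k * x) * (h x - l x)) -
        Complex.exp (k * x) * l x := by
      simp only [Pi.add_apply, hh]
      linear_combination (d x - v1 x 0 - v2 x 0) * eE
    rw [e]
    refine (norm_sub_le _ _).trans ?_
    rw [norm_mul, ← Complex.ofReal_mul, Complex.norm_exp_ofReal]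
    rw [← Complex.ofReal_mul] at h3
    have hex : Real.exp (k * x) ≤ Real.exp (k * L) := by
      rw [Real.exp_le_exp]; nlinarith [hx.2]
    have i1 : Real.exp (k * x) * ε' ≤ Real.exp (k * L) * ε' := by gcongr
    have i2 : Real.exp (k * x) * ‖l x‖ ≤ Real.exp (k * L) * ε' := by gcongr
    linarith
  · have := a2 τ hτ
    simp only [Pi.add_apply, z1, z3, zero_add, add_zero]
    linarith
  · have := a1 τ hτ
    simp only [Pi.add_apply, z2, z3', add_zero]
    linarith
end part10

section part11
lemma sqrt_conv (D k a : ℝ) (hD : 0 < D) :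
    Real.sqrt ((2 * D * k) ^ 2 + 4 * D ^ 2 * a ^ 2) = 2 * D * rH k a := by
  rw [show (2 * D * k) ^ 2 + 4 * D ^ 2 * a ^ 2 = (2 * D) ^ 2 * (a ^ 2 + k ^ 2) by ring,
    Real.sqrt_mul (by positivity), Real.sqrt_sq (by positivity)]
  rfl

lemma gam_conv (D k a : ℝ) (hD : 0 < D) :
    gammaPlus D (2 * D * k) a = mH k a - Complex.I * k := by
  unfold gammaPlus bPlus mH
  rw [sqrt_conv D k a hD, show (-(2 * D * k) + 2 * D * rH k a) / (2 * D) = rH k a - k by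
    field_simp; ring]
  push_cast; ring

lemma gamD_conv (D k a : ℝ) (hD : 0 < D) (hk : 0 < k) :
    gammaPlusD D (2 * D * k) a = mD k a := by
  unfold gammaPlusD mD
  have := rH_pos hk a
  rw [sqrt_conv D k a hD, show 2 * D * a / (2 * D * rH k a) = a / rH k a by field_simp]

lemma nu_conv (D k : ℝ) (m : ℂ) (hD : 0 < D) :
    nuF D (2 * D * k) (m - Complex.I * k) = -m - Complex.I * k := by
  unfold nuF
  have : (D:ℂ) ≠ 0 := by exact_mod_cast hD.ne'
  push_cast
  field_simp
  ring

lemma om_conv (D k : ℝ) (m : ℂ) :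
    omegaF D (2 * D * k) (m - Complex.I * k) = WF D k m := by
  unfold omegaF WF
  push_cast
  linear_combination (-(D:ℂ) * k ^ 2) * Complex.I_sq

lemma de_conv (D k L : ℝ) (m : ℂ) (hD : 0 < D) :
    deltaF D (2 * D * k) L (m - Complex.I * k) =
      -2 * Complex.I * Complex.exp (-(k * L)) * Complex.sin (L * m) := by
  unfold deltaF
  rw [nu_conv D k m hD, Complex.sin]
  rw [show -Complex.I * (m - Complex.I * k) * L = -(k * L) + -(L * m) * Complex.I by
      linear_combination (k * L : ℂ) * Complex.I_sq,
    show -Complex.I * (-m - Complex.I * k) * L = -(k * L) + (L * m) * Complex.I by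
      linear_combination (k * L : ℂ) * Complex.I_sq, Complex.exp_add, Complex.exp_add]
  linear_combination (Complex.exp (-(k * L)) * (Complex.exp (-(L * m) * Complex.I) -
    Complex.exp ((L * m) * Complex.I))) * Complex.I_sq

lemma sh_conv (D k : ℝ) (m : ℂ) (hD : 0 < D) :
    m - Complex.I * k + Complex.I * (((2 * D * k : ℝ) : ℂ) / (2 * (D : ℂ))) = m := by
  have : (D:ℂ) ≠ 0 := by exact_mod_cast hD.ne'
  push_cast
  field_simp
  ring

lemma hat2_conv (k L a : ℝ) (d : ℝ → ℝ) : hatF L d (mH k a - Complex.I * k) =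
    ∫ ξ in (0:ℝ)..L, Complex.exp (p2 k a * ξ) * (d ξ : ℂ) := by
  unfold hatF p2
  congr 1; ext ξ
  rw [show -Complex.I * (mH k a - Complex.I * k) * (ξ:ℂ) = (-Complex.I * mH k a - k) * ξ by
    linear_combination (k * ξ : ℂ) * Complex.I_sq]

lemma hat3_conv (k L a : ℝ) (d : ℝ → ℝ) : hatF L d (-mH k a - Complex.I * k) =
    ∫ ξ in (0:ℝ)..L, Complex.exp (p3 k a * ξ) * (d ξ : ℂ) := by
  unfold hatF p3
  congr 1; ext ξ
  rw [show -Complex.I * (-mH k a - Complex.I * k) * (ξ:ℂ) = (Complex.I * mH k a - k) * ξ by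
    linear_combination (k * ξ : ℂ) * Complex.I_sq]

lemma exp_shift (k L : ℝ) (m W : ℂ) :
    Complex.exp (Complex.I * (m - Complex.I * k) * L - W) =
      Complex.exp (Complex.I * m * L) * Complex.exp (k * L) * Complex.exp (-W) := by
  rw [← Complex.exp_add, ← Complex.exp_add]
  congr 1
  linear_combination (-(k * L : ℂ)) * Complex.I_sq

lemma conv_RHS (D k L x t : ℝ) (hD : 0 < D) (hk : 0 < k) (hL : 0 < L) (θ₀ f g : ℝ → ℝ) :
      (1 / (2 * (Real.pi : ℂ))) *
        (∫ a : ℝ, Complex.exp (Complex.I * (a : ℂ) * (x : ℂ) - omegaF D (2 * D * k) (a : ℂ) * (t : ℂ)) *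
          hatF L θ₀ (a : ℂ))
      + (Complex.I / (Real.pi : ℂ)) * (Real.exp (-((2 * D * k) * (2 * L - x) / (2 * D))) : ℂ) *
        contourPlus D (2 * D * k) (fun l =>
          Complex.exp (Complex.I * l * (L : ℂ) - omegaF D (2 * D * k) l * (t : ℂ)) / deltaF D (2 * D * k) L l *
            Complex.sin ((x : ℂ) * (l + Complex.I * (((2 * D * k : ℝ) : ℂ) / (2 * (D : ℂ))))) *
            hatF L θ₀ l)
      + (Complex.I / (Real.pi : ℂ)) * (Real.exp (-((2 * D * k) * (L - x) / (2 * D))) : ℂ) *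
        contourPlus D (2 * D * k) (fun l =>
          Complex.exp (-omegaF D (2 * D * k) l * (t : ℂ)) / deltaF D (2 * D * k) L l *
            Complex.sin (((L - x : ℝ) : ℂ) * (l + Complex.I * (((2 * D * k : ℝ) : ℂ) / (2 * (D : ℂ))))) *
            hatF L θ₀ (nuF D (2 * D * k) l))
      - ((2 * D : ℂ) / (Real.pi : ℂ)) * (Real.exp (-((2 * D * k) * (L - x) / (2 * D))) : ℂ) *
        contourPlus D (2 * D * k) (fun l =>
          Complex.exp (-omegaF D (2 * D * k) l * (t : ℂ)) / deltaF D (2 * D * k) L l *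
            ((l + Complex.I * (((2 * D * k : ℝ) : ℂ) / (2 * (D : ℂ)))) *
              Complex.sin (((L - x : ℝ) : ℂ) * (l + Complex.I * (((2 * D * k : ℝ) : ℂ) / (2 * (D : ℂ)))))) *
            tildeF f (omegaF D (2 * D * k) l) t)
      - ((2 * D : ℂ) / (Real.pi : ℂ)) * (Real.exp (-((2 * D * k) * (2 * L - x) / (2 * D))) : ℂ) *
        contourPlus D (2 * D * k) (fun l =>
          Complex.exp (-omegaF D (2 * D * k) l * (t : ℂ)) / deltaF D (2 * D * k) L l *
            ((l + Complex.I * (((2 * D * k : ℝ) : ℂ) / (2 * (D : ℂ)))) *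
              Complex.sin ((x : ℂ) * (l + Complex.I * (((2 * D * k : ℝ) : ℂ) / (2 * (D : ℂ)))))) *
            tildeF g (omegaF D (2 * D * k) l) t) =
      RR D k L x t (fun s => (θ₀ s : ℂ)) (fun s => (f s : ℂ)) (fun s => (g s : ℂ)) := by
  have e2L : (Real.exp (-((2 * D * k) * (2 * L - x) / (2 * D))) : ℂ) =
      Complex.exp (k * x) * Complex.exp (-(k * L)) * Complex.exp (-(k * L)) := by
    rw [show -((2 * D * k) * (2 * L - x) / (2 * D)) = k * x + -(k * L) + -(k * L) by
      field_simp; ring]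
    push_cast
    rw [Complex.exp_add, Complex.exp_add]
  have e1L : (Real.exp (-((2 * D * k) * (L - x) / (2 * D))) : ℂ) =
      Complex.exp (k * x) * Complex.exp (-(k * L)) := by
    rw [show -((2 * D * k) * (L - x) / (2 * D)) = k * x + -(k * L) by
      field_simp; ring]
    push_cast
    rw [Complex.exp_add]
  have eE : Complex.exp (k * L) = (Complex.exp (-(k * L)))⁻¹ := by
    rw [← Complex.exp_neg, neg_neg]
  have hE : Complex.exp (-(k * L : ℂ)) ≠ 0 := Complex.exp_ne_zero _
  have hpi : (Real.pi : ℂ) ≠ 0 := by exact_mod_cast Real.pi_ne_zero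
  have hI := Complex.I_ne_zero
  unfold contourPlus RR JJ
  rw [e2L, e1L, sub_eq_add_neg, sub_eq_add_neg]
  simp only [gam_conv D k _ hD, gamD_conv D k _ hD hk, om_conv, de_conv D k L _ hD, sh_conv D k _ hD,
    nu_conv D k _ hD, hat2_conv, hat3_conv]
  simp only [← integral_const_mul, ← integral_neg]
  congr 1
  · congr 1
    · congr 1
      · congr 1
        · congr 1; ext a
          simp only [A1, p1, hatF, omegaF]
          push_cast
          ring
        · congr 1; ext a
          have hs := sin_ne hL (m := mH k a) (by rw [mH_im]; exact rH_pos hk a)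
          rw [exp_shift, eE]
          simp only [A2, UK, Sn, c1]
          rw [neg_mul (WF _ _ _)]
          field_simp
      · congr 1; ext a
        have hs := sin_ne hL (m := mH k a) (by rw [mH_im]; exact rH_pos hk a)
        simp only [A3, UK, Sn, c1]
        field_simp
    · congr 1; ext a
      have hs := sin_ne hL (m := mH k a) (by rw [mH_im]; exact rH_pos hk a)
      simp only [A4, UK, Sn, c1, tildeF, p4]
      field_simp
      simp only [Complex.I_sq]
      ring
  · congr 1; ext a
    have hs := sin_ne hL (m := mH k a) (by rw [mH_im]; exact rH_pos hk a)
    simp only [A5, UK, Sn, c1, tildeF, p4]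
    field_simp
    simp only [Complex.I_sq]
    ring
end part11

section part12
lemma comp_principle (D k L T : ℝ) (hD : 0 < D) (θ θx : ℝ → ℝ → ℝ) (θ₀ f g : ℝ → ℝ)
    (hsol : IsClassicalSolution D (2 * D * k) L θ θx θ₀ f g) (v : ℝ → ℝ → ℂ) (hv : VGood D k L v)
    (s : ℝ) (c : ℂ) (M : ℝ) 
    (h0 : ∀ x ∈ Set.Icc (0:ℝ) L, s * θ x 0 - (c * v x 0).re ≤ M)
    (hl : ∀ t ∈ Set.Icc (0:ℝ) T, s * θ 0 t - (c * v 0 t).re ≤ M)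
    (hr : ∀ t ∈ Set.Icc (0:ℝ) T, s * θ L t - (c * v L t).re ≤ M)
    (x t : ℝ) (hx : x ∈ Set.Icc 0 L) (ht : t ∈ Set.Icc 0 T) : s * θ x t - (c * v x t).re ≤ M := by
  obtain ⟨hc, -, -, hp, -⟩ := hsol
  obtain ⟨vx, vxx, d1, d2, d3⟩ := hv.pde
  have hvc := hv.cont
  have rd : ∀ (F : ℝ → ℂ) (F' : ℂ) (y : ℝ), HasDerivAt F F' y →
      HasDerivAt (fun z => (c * F z).re) (c * F').re y := fun F F' y h =>
    Complex.reCLM.hasFDerivAt.comp_hasDerivAt y (h.const_mul c)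
  refine max_principle D (2 * D * k) L T hD (fun x t => s * θ x t - (c * v x t).re) ?_ ?_ M h0 hl hr x t hx ht
  · refine ContinuousOn.sub ((hc.mono ?_).const_smul s) (Continuous.continuousOn ?_)
    · exact Set.prod_mono le_rfl Set.Icc_subset_Ici_self
    · exact Complex.continuous_re.comp (continuous_const.mul hvc)
  · intro x hx t ht
    refine ⟨fun y => s * θx y t - (c * vx y t).re, s * deriv (fun x' => θx x' t) x - (c * vxx x t).re,
      s * (D * deriv (fun x' => θx x' t) x - 2 * D * k * θx x t) -
        (c * (D * vxx x t - 2 * D * k * vx x t)).re, ?_, ?_, ?_, ?_⟩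
    · intro y hy
      exact ((hp y hy t ht.1).1.const_mul s).sub (rd _ _ _ (d1 y t))
    · exact ((hp x hx t ht.1).2.1.hasDerivAt.const_mul s).sub (rd _ _ _ (d2 x t))
    · exact ((hp x hx t ht.1).2.2.const_mul s).sub (rd _ _ _ (d3 x t))
    · have : (c * (D * vxx x t - 2 * D * k * vx x t)) = (D:ℝ) • (c * vxx x t) - (2 * D * k : ℝ) • (c * vx x t) := by
        simp only [Complex.real_smul]; push_cast; ring
      rw [this, Complex.sub_re, Complex.smul_re, Complex.smul_re]
      simp only [smul_eq_mul]
      ring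

lemma comp_norm (D k L T : ℝ) (hD : 0 < D) (θ θx : ℝ → ℝ → ℝ) (θ₀ f g : ℝ → ℝ)
    (hsol : IsClassicalSolution D (2 * D * k) L θ θx θ₀ f g) (v : ℝ → ℝ → ℂ) (hv : VGood D k L v)
    (M : ℝ) 
    (h0 : ∀ x ∈ Set.Icc (0:ℝ) L, ‖v x 0 - θ x 0‖ ≤ M)
    (hl : ∀ t ∈ Set.Icc (0:ℝ) T, ‖v 0 t - θ 0 t‖ ≤ M)
    (hr : ∀ t ∈ Set.Icc (0:ℝ) T, ‖v L t - θ L t‖ ≤ M)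
    (x t : ℝ) (hx : x ∈ Set.Icc 0 L) (ht : t ∈ Set.Icc 0 T) : ‖v x t - θ x t‖ ≤ 2 * M := by
  have hre : ∀ (z : ℂ) (u : ℝ), ‖z - u‖ ≤ M → |z.re - u| ≤ M := fun z u h => by
    simpa using (Complex.abs_re_le_norm _).trans h
  have him : ∀ (z : ℂ) (u : ℝ), ‖z - u‖ ≤ M → |z.im| ≤ M := fun z u h => by
    simpa using (Complex.abs_im_le_norm _).trans h
  have b (s : ℝ) (c : ℂ) (hb : ∀ (z : ℂ) (u : ℝ), ‖z - u‖ ≤ M → s * u - (c * z).re ≤ M) :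
      s * θ x t - (c * v x t).re ≤ M :=
    comp_principle D k L T hD θ θx θ₀ f g hsol v hv s c M (fun y hy => hb _ _ (h0 y hy))
      (fun y hy => hb _ _ (hl y hy)) (fun y hy => hb _ _ (hr y hy)) x t hx ht
  have b1 := b 1 1 (fun z u h => by have := abs_le.1 (hre z u h); simp; linarith)
  have b2 := b (-1) (-1) (fun z u h => by have := abs_le.1 (hre z u h); simp; linarith)
  have b3 := b 0 Complex.I (fun z u h => by have := abs_le.1 (him z u h); simp; linarith)
  have b4 := b 0 (-Complex.I) (fun z u h => by have := abs_le.1 (him z u h); simp; linarith)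
  simp at b1 b2 b3 b4
  refine (Complex.norm_le_abs_re_add_abs_im _).trans ?_
  have i1 : |(v x t - θ x t).re| ≤ M := by simp; exact abs_le.2 ⟨by linarith, by linarith⟩
  have i2 : |(v x t - θ x t).im| ≤ M := by simp; exact abs_le.2 ⟨by linarith, by linarith⟩
  linarith

lemma RR_congr (D k L x t : ℝ) (hL : 0 < L) (ht : 0 < t) {d f g d' f' g' : ℝ → ℂ}
    (h1 : ∀ s ∈ Set.Icc 0 L, d s = d' s) (h2 : ∀ s ∈ Set.Icc 0 t, f s = f' s)
    (h3 : ∀ s ∈ Set.Icc 0 t, g s = g' s) : RR D k L x t d f g = RR D k L x t d' f' g' := by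
  have key : ∀ (A p : ℝ → ℂ) (b : ℝ) (u u' : ℝ → ℂ), 0 ≤ b → (∀ s ∈ Set.Icc 0 b, u s = u' s) →
      JJ A p b u = JJ A p b u' := by
    intro A p b u u' hb h
    unfold JJ
    congr 1; ext a; congr 1
    apply intervalIntegral.integral_congr
    intro s hs
    rw [Set.uIcc_of_le hb] at hs
    simp only [h s hs]
  unfold RR
  rw [key _ _ _ _ _ hL.le h1, key _ _ _ _ _ hL.le h1, key _ _ _ _ _ hL.le h1,
    key _ _ _ _ _ ht.le h2, key _ _ _ _ _ ht.le h3]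

lemma ext_cont (u : ℝ → ℝ) (b : ℝ) (hb : 0 ≤ b) (h : ContinuousOn u (Set.Icc 0 b)) :
    ∃ u' : ℝ → ℝ, Continuous u' ∧ ∀ s ∈ Set.Icc 0 b, u' s = u s := by
  refine ⟨Set.IccExtend hb (Set.domRestrict (Set.Icc 0 b) u),
    (continuousOn_iff_continuous_domRestrict.1 h).Icc_extend', fun s hs => ?_⟩
  rw [Set.IccExtend_of_mem _ _ hs]; rfl

lemma main_rep (D k L : ℝ) (hD : 0 < D) (hk : 0 < k) (hL : 0 < L)
    (θ θx : ℝ → ℝ → ℝ) (θ₀ f g : ℝ → ℝ)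
    (hθ₀c : ContinuousOn θ₀ (Set.Icc 0 L))
    (hfc : ContinuousOn f (Set.Ici 0)) (hgc : ContinuousOn g (Set.Ici 0))
    (hcomp0 : θ₀ 0 = f 0) (hcompL : θ₀ L = g 0)
    (hsol : IsClassicalSolution D (2 * D * k) L θ θx θ₀ f g)
    (x t : ℝ) (hx : x ∈ Set.Ioo 0 L) (ht : 0 < t) :
    (θ x t : ℂ) = RR D k L x t (fun s => (θ₀ s : ℂ)) (fun s => (f s : ℂ)) (fun s => (g s : ℂ)) := by
  obtain ⟨d', cd, ed⟩ := ext_cont θ₀ L hL.le hθ₀c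
  obtain ⟨f', cf, ef⟩ := ext_cont f t ht.le (hfc.mono Set.Icc_subset_Ici_self)
  obtain ⟨g', cg, eg⟩ := ext_cont g t ht.le (hgc.mono Set.Icc_subset_Ici_self)
  have z0 : (0:ℝ) ∈ Set.Icc 0 L := ⟨le_rfl, hL.le⟩
  have zL : L ∈ Set.Icc 0 L := ⟨hL.le, le_rfl⟩
  have zt : (0:ℝ) ∈ Set.Icc 0 t := ⟨le_rfl, ht.le⟩
  rw [RR_congr D k L x t hL ht (d' := fun s => (d' s : ℂ)) (f' := fun s => (f' s : ℂ))
    (g' := fun s => (g' s : ℂ)) (fun s hs => by rw [ed s hs]) (fun s hs => by rw [ef s hs])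
    (fun s hs => by rw [eg s hs])]
  obtain ⟨B, hB, hbd⟩ := RR_bound D k L x t hD hk hL hx ht
  have key : ∀ ε > 0, ‖(θ x t : ℂ) - RR D k L x t (fun s => (d' s : ℂ)) (fun s => (f' s : ℂ))
      (fun s => (g' s : ℂ))‖ ≤ (2 + B) * ε := by
    intro ε hε
    obtain ⟨v, hv, a0, al, ar⟩ := density D k L hD hk hL d' f' g' cd cf cg
      (by rw [ed 0 z0, ef 0 zt, hcomp0]) (by rw [ed L zL, eg 0 zt, hcompL]) t ht.le ε hε
    have hv : VGood D k L v := hv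
    have hi := hsol.2.2.2.2.1
    have hl := hsol.2.2.2.2.2.1
    have hr := hsol.2.2.2.2.2.2
    have n1 : ‖v x t - θ x t‖ ≤ 2 * ε := by
      refine comp_norm D k L t hD θ θx θ₀ f g hsol v hv ε ?_ ?_ ?_ x t ⟨hx.1.le, hx.2.le⟩ ⟨ht.le, le_rfl⟩
      · intro y hy
        rw [hi y hy, ← ed y hy]; exact a0 y hy
      · intro τ hτ
        have : θ 0 τ = f' τ := by
          rw [ef τ hτ]
          rcases hτ.1.eq_or_lt with h | h
          · rw [← h, hi 0 z0, hcomp0]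
          · exact hl τ h
        rw [this]; exact al τ hτ
      · intro τ hτ
        have : θ L τ = g' τ := by
          rw [eg τ hτ]
          rcases hτ.1.eq_or_lt with h | h
          · rw [← h, hi L zL, hcompL]
          · exact hr τ h
        rw [this]; exact ar τ hτ
    have hadd := RR_add D k L x t hD hk hL hx ht (d := fun s => (d' s : ℂ)) (f := fun s => (f' s : ℂ))
      (g := fun s => (g' s : ℂ)) (d' := fun s => v s 0 - d' s) (f' := fun s => v 0 s - f' s)
      (g' := fun s => v L s - g' s) (by fun_prop) (by fun_prop) (by fun_prop)
      ((hv.c1 0).sub (by fun_prop)) ((hv.c2 0).sub (by fun_prop)) ((hv.c2 L).sub (by fun_prop))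
    simp only [add_sub_cancel] at hadd
    rw [hv.rep hD hk hL x hx t ht] at hadd
    have n2 := hbd (fun s => v s 0 - d' s) (fun s => v 0 s - f' s) (fun s => v L s - g' s) ε hε.le
      a0 al ar
    have e : (θ x t : ℂ) - RR D k L x t (fun s => (d' s : ℂ)) (fun s => (f' s : ℂ))
      (fun s => (g' s : ℂ)) = RR D k L x t (fun s => v s 0 - d' s) (fun s => v 0 s - f' s)
        (fun s => v L s - g' s) - (v x t - θ x t) := by
      linear_combination hadd
    rw [e]
    refine (norm_sub_le _ _).trans ?_
    linarith
  have : ‖(θ x t : ℂ) - RR D k L x t (fun s => (d' s : ℂ)) (fun s => (f' s : ℂ))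
      (fun s => (g' s : ℂ))‖ ≤ 0 := by
    refine le_of_forall_pos_le_add fun δ hδ => ?_
    have := key (δ / (2 + B)) (by positivity)
    rw [mul_div_cancel₀ _ (by positivity)] at this
    linarith
  exact sub_eq_zero.1 (norm_le_zero_iff.1 this)
end part12

/-- The Fokas-method integral representation of the solution of the IBVP on ∂D₊. -/
theorem statement_0
    (D₀ K₀ L : ℝ) (hD : 0 < D₀) (hK : 0 < K₀) (hL : 0 < L)
    (θ θx : ℝ → ℝ → ℝ) (θ₀ f g : ℝ → ℝ)
    (hθ₀c : ContinuousOn θ₀ (Set.Icc 0 L))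
    (hfc : ContinuousOn f (Set.Ici 0)) (hgc : ContinuousOn g (Set.Ici 0))
    (hcomp0 : θ₀ 0 = f 0) (hcompL : θ₀ L = g 0)
    (hsol : IsClassicalSolution D₀ K₀ L θ θx θ₀ f g)
    (x t : ℝ) (hx : x ∈ Set.Ioo 0 L) (ht : 0 < t) :
    (θ x t : ℂ) =
      (1 / (2 * (Real.pi : ℂ))) *
        (∫ a : ℝ, Complex.exp (Complex.I * (a : ℂ) * (x : ℂ) - omegaF D₀ K₀ (a : ℂ) * (t : ℂ)) *
          hatF L θ₀ (a : ℂ))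
      + (Complex.I / (Real.pi : ℂ)) * (Real.exp (-(K₀ * (2 * L - x) / (2 * D₀))) : ℂ) *
        contourPlus D₀ K₀ (fun l =>
          Complex.exp (Complex.I * l * (L : ℂ) - omegaF D₀ K₀ l * (t : ℂ)) / deltaF D₀ K₀ L l *
            Complex.sin ((x : ℂ) * (l + Complex.I * ((K₀ : ℂ) / (2 * (D₀ : ℂ))))) *
            hatF L θ₀ l)
      + (Complex.I / (Real.pi : ℂ)) * (Real.exp (-(K₀ * (L - x) / (2 * D₀))) : ℂ) *
        contourPlus D₀ K₀ (fun l =>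
          Complex.exp (-omegaF D₀ K₀ l * (t : ℂ)) / deltaF D₀ K₀ L l *
            Complex.sin (((L - x : ℝ) : ℂ) * (l + Complex.I * ((K₀ : ℂ) / (2 * (D₀ : ℂ))))) *
            hatF L θ₀ (nuF D₀ K₀ l))
      - ((2 * D₀ : ℂ) / (Real.pi : ℂ)) * (Real.exp (-(K₀ * (L - x) / (2 * D₀))) : ℂ) *
        contourPlus D₀ K₀ (fun l =>
          Complex.exp (-omegaF D₀ K₀ l * (t : ℂ)) / deltaF D₀ K₀ L l *
            ((l + Complex.I * ((K₀ : ℂ) / (2 * (D₀ : ℂ)))) *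
              Complex.sin (((L - x : ℝ) : ℂ) * (l + Complex.I * ((K₀ : ℂ) / (2 * (D₀ : ℂ)))))) *
            tildeF f (omegaF D₀ K₀ l) t)
      - ((2 * D₀ : ℂ) / (Real.pi : ℂ)) * (Real.exp (-(K₀ * (2 * L - x) / (2 * D₀))) : ℂ) *
        contourPlus D₀ K₀ (fun l =>
          Complex.exp (-omegaF D₀ K₀ l * (t : ℂ)) / deltaF D₀ K₀ L l *
            ((l + Complex.I * ((K₀ : ℂ) / (2 * (D₀ : ℂ)))) *
              Complex.sin ((x : ℂ) * (l + Complex.I * ((K₀ : ℂ) / (2 * (D₀ : ℂ)))))) *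
            tildeF g (omegaF D₀ K₀ l) t) := by
  obtain ⟨k, hk, rfl⟩ : ∃ k : ℝ, 0 < k ∧ K₀ = 2 * D₀ * k :=
    ⟨K₀ / (2 * D₀), by positivity, by field_simp⟩
  rw [conv_RHS D₀ k L x t hD hk hL θ₀ f g]
  exact main_rep D₀ k L hD hk hL θ θx θ₀ f g hθ₀c hfc hgc hcomp0 hcompL hsol x t hx ht
end

section
/- Let θ be a classical solution of the IBVP with data (θ₀, f, g). Then for every λ ∈ ℂ and every t > 0, the function t ↦ θ̂(λ,t) is differentiable and satisfies the ordinary differential equation ∂θ̂/∂t (λ,t) + ω(λ) θ̂(λ,t) = e^{−iλL}(iλD₀ − K₀) g(t) − (iλD₀ − K₀) f(t) + D₀ ( e^{−iλL} ∂θ/∂x(L,t) − ∂θ/∂x(0,t) ). -/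
open MeasureTheory

/-- θ̂(λ,t) = ∫₀^L e^{−iλx} θ(x,t) dx. -/
noncomputable def hatTheta (L : ℝ) (θ : ℝ → ℝ → ℝ) (l : ℂ) (t : ℝ) : ℂ :=
  ∫ x in (0:ℝ)..L, Complex.exp (-Complex.I * l * (x : ℂ)) * (θ x t : ℂ)


lemma hh_second (w w1 : ℝ → ℝ) (w2 x : ℝ) (hmax : IsLocalMax w x)
    (h1 : ∀ᶠ y in nhds x, HasDerivAt w (w1 y) y) (h2 : HasDerivAt w1 w2 x) : w2 ≤ 0 := by
  by_contra hpos
  push Not at hpos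
  have e : deriv w =ᶠ[nhds x] w1 := h1.mono fun y hy => hy.deriv
  have hdd : deriv (deriv w) x = w2 := by rw [e.deriv_eq, h2.deriv]
  have hd0 : deriv w x = 0 := hmax.deriv_eq_zero
  have hmin : IsLocalMin w x :=
    isLocalMin_of_deriv_deriv_pos (by rw [hdd]; exact hpos) hd0 h1.self_of_nhds.continuousAt
  have hc : w =ᶠ[nhds x] fun _ => w x := by
    filter_upwards [hmax, hmin] with y a b
    exact le_antisymm a b
  have : deriv (deriv w) x = 0 := by
    rw [hc.deriv.deriv_eq]; simp
  linarith

lemma hh_visc (D K c ρ η δ x0 t0 : ℝ) (hD : 0 < D) (hK : 0 < K) (hρ : 0 < ρ)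
    (hη : 0 < η) (hηc : η * (2 * ρ + 2 * K * ρ + 2 * D) < c) (hδ : 2 * δ < η * ρ ^ 2)
    (v vx vxx vt : ℝ → ℝ → ℝ) (hv : Continuous (fun p : ℝ × ℝ => v p.1 p.2))
    (hvx : ∀ x ∈ Set.Ioo (x0 - ρ) (x0 + ρ), ∀ t ∈ Set.Ioo (t0 - ρ) (t0 + ρ),
      HasDerivAt (fun y => v y t) (vx x t) x ∧ HasDerivAt (fun y => vx y t) (vxx x t) x ∧
      HasDerivAt (fun s => v x s) (vt x t) t ∧ vt x t + K * vx x t - D * vxx x t ≤ - c)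
    (hb : ∀ x ∈ Set.Icc (x0 - ρ) (x0 + ρ), ∀ t ∈ Set.Icc (t0 - ρ) (t0 + ρ), |v x t| ≤ δ) :
    False := by
  set B := Set.Icc (x0 - ρ) (x0 + ρ) ×ˢ Set.Icc (t0 - ρ) (t0 + ρ)
  have hB : IsCompact B := isCompact_Icc.prod isCompact_Icc
  obtain ⟨⟨x, t⟩, hxt, hm⟩ := hB.exists_isMaxOn
    (f := fun p : ℝ × ℝ => v p.1 p.2 - η * ((p.1 - x0) ^ 2 + (p.2 - t0) ^ 2))
    ⟨(x0, t0), by constructor <;> constructor <;> simp <;> linarith⟩ (by fun_prop)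
  have hx := hxt.1
  have ht := hxt.2
  have h0 := hm (show (x0, t0) ∈ B by constructor <;> constructor <;> simp <;> linarith)
  simp only [Set.mem_ofPred_eq, sub_self] at h0 hx ht
  have b0 := abs_le.1 (hb x0 ⟨by linarith, by linarith⟩ t0 ⟨by linarith, by linarith⟩)
  have b1 := abs_le.1 (hb x hx t ht)
  have hlt : (x - x0) ^ 2 + (t - t0) ^ 2 < ρ ^ 2 := by
    have : η * ((x - x0) ^ 2 + (t - t0) ^ 2) < η * ρ ^ 2 := by nlinarith
    exact lt_of_mul_lt_mul_left this hη.le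
  have ax := abs_lt.1 (abs_lt_of_sq_lt_sq (show (x - x0) ^ 2 < ρ ^ 2 by nlinarith [sq_nonneg (t - t0)]) hρ.le)
  have at' := abs_lt.1 (abs_lt_of_sq_lt_sq (show (t - t0) ^ 2 < ρ ^ 2 by nlinarith [sq_nonneg (x - x0)]) hρ.le)
  have hxo : x ∈ Set.Ioo (x0 - ρ) (x0 + ρ) := ⟨by linarith, by linarith⟩
  have hto : t ∈ Set.Ioo (t0 - ρ) (t0 + ρ) := ⟨by linarith, by linarith⟩
  have nx := Ioo_mem_nhds hxo.1 hxo.2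
  have nt := Ioo_mem_nhds hto.1 hto.2
  obtain ⟨d1, d2, d3, d4⟩ := hvx x hxo t hto
  have mx : IsLocalMax (fun y => v y t - η * ((y - x0) ^ 2 + (t - t0) ^ 2)) x := by
    filter_upwards [nx] with y hy
    exact hm (show (y, t) ∈ B from ⟨⟨hy.1.le, hy.2.le⟩, ht⟩)
  have mt : IsLocalMax (fun s => v x s - η * ((x - x0) ^ 2 + (s - t0) ^ 2)) t := by
    filter_upwards [nt] with y hy
    exact hm (show (x, y) ∈ B from ⟨hx, ⟨hy.1.le, hy.2.le⟩⟩)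
  have q (y z : ℝ) : HasDerivAt (fun y => (y - z) ^ 2) (2 * (y - z)) y := by
    have := ((hasDerivAt_id y).sub_const z).fun_pow 2
    simpa using this
  have e1 : vx x t - η * (2 * (x - x0)) = 0 :=
    mx.hasDerivAt_eq_zero (d1.sub (((q x x0).add_const _).const_mul η))
  have e2 : vt x t - η * (2 * (t - t0)) = 0 :=
    mt.hasDerivAt_eq_zero (d3.sub (((q t t0).const_add _).const_mul η))
  have e3 : vxx x t - η * (2 * 1) ≤ 0 := by
    refine hh_second _ (fun y => vx y t - η * (2 * (y - x0))) _ x mx ?_ ?_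
    · filter_upwards [nx] with y hy
      exact (hvx y hy t hto).1.sub (((q y x0).add_const _).const_mul η)
    · exact d2.sub ((((hasDerivAt_id x).sub_const x0).const_mul 2).const_mul η)
  have e4 : D * vxx x t ≤ D * (2 * η) := by gcongr; linarith
  have e5 : vt x t = η * (2 * (t - t0)) := by linarith
  have e6 : vx x t = η * (2 * (x - x0)) := by linarith
  rw [e5, e6] at d4
  have : η * (-ρ) ≤ η * (t - t0) := by gcongr; linarith
  have : (K * η) * (-ρ) ≤ (K * η) * (x - x0) := by gcongr; linarith
  nlinarith

lemma hh_riem {X : Type*} [PseudoMetricSpace X] (A : Set X) (hA : IsCompact A) (G : X → ℝ → ℝ)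
    (hG : Continuous (fun p : X × ℝ => G p.1 p.2)) (h ε : ℝ) (hh : 0 < h) (hε : 0 < ε) :
    ∃ n : ℕ, 0 < n ∧ ∀ a ∈ A,
      |(∫ s in (0:ℝ)..h, G a s) - ∑ i ∈ Finset.range n, (h / n) * G a (i * (h / n))| ≤ ε := by
  have huc := (hA.prod (isCompact_Icc (a := (0:ℝ)) (b := h))).uniformContinuousOn_of_continuous
    hG.continuousOn
  rw [Metric.uniformContinuousOn_iff] at huc
  obtain ⟨δ, hδ, H⟩ := huc (ε / h) (by positivity)
  obtain ⟨n, hn⟩ := exists_nat_gt (h / δ)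
  have hn0 : (0:ℝ) < n := lt_trans (by positivity) hn
  have hnn : 0 < n := by exact_mod_cast hn0
  have hst : h / n < δ := by
    rw [div_lt_iff₀ hδ] at hn; rw [div_lt_iff₀ hn0]; linarith
  refine ⟨n, hnn, fun a ha => ?_⟩
  have hGa : Continuous (G a) := hG.comp (by fun_prop : Continuous fun s : ℝ => (a, s))
  have hsum := intervalIntegral.sum_integral_adjacent_intervals (μ := volume) (f := G a)
    (a := fun i : ℕ => (i:ℝ) * (h / n)) (n := n) (fun k _ => hGa.intervalIntegrable _ _)
  have hend : (n:ℝ) * (h / n) = h := by field_simp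
  simp only [Nat.cast_zero, zero_mul, hend] at hsum
  rw [← hsum, ← Finset.sum_sub_distrib]
  refine (Finset.abs_sum_le_sum_abs _ _).trans ?_
  have : ∀ i ∈ Finset.range n, |(∫ s in ((i:ℝ) * (h / n))..(((i + 1 : ℕ):ℝ) * (h / n)), G a s)
      - (h / n) * G a (i * (h / n))| ≤ ε / n := by
    intro i hi
    have hi' : (i:ℝ) + 1 ≤ n := by exact_mod_cast Finset.mem_range.1 hi
    have hs0 : 0 < h / n := by positivity
    have hle : (i:ℝ) * (h / n) ≤ ((i + 1 : ℕ):ℝ) * (h / n) := by push_cast; nlinarith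
    have e : (h / n) * G a (i * (h / n)) =
        ∫ s in ((i:ℝ) * (h / n))..(((i + 1 : ℕ):ℝ) * (h / n)), G a (i * (h / n)) := by
      rw [intervalIntegral.integral_const]; push_cast; simp only [smul_eq_mul]; ring
    rw [e, ← intervalIntegral.integral_sub (hGa.intervalIntegrable _ _) (by simp)]
    have := intervalIntegral.norm_integral_le_of_norm_le_const (C := ε / h)
      (f := fun s => G a s - G a (i * (h / n))) (a := (i:ℝ) * (h / n))
      (b := ((i + 1 : ℕ):ℝ) * (h / n)) ?_
    · rw [Real.norm_eq_abs] at this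
      refine this.trans (le_of_eq ?_)
      rw [abs_of_nonneg (by linarith)]
      push_cast; field_simp; ring
    · intro s hs
      rw [Set.uIoc_of_le hle] at hs
      have i0 : (0:ℝ) ≤ i * (h / n) := by positivity
      have hend2 : ((i + 1 : ℕ):ℝ) * (h / n) ≤ h := by
        push_cast
        calc ((i:ℝ) + 1) * (h / n) ≤ n * (h / n) := by gcongr
          _ = h := hend
      have hs2 := hs.2
      have := H (a, s) ⟨ha, ⟨by linarith [hs.1], by linarith⟩⟩ (a, i * (h / n))
        ⟨ha, ⟨i0, by linarith⟩⟩ (by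
          rw [Prod.dist_eq, dist_self, Real.dist_eq]
          have : s - i * (h / n) ≤ h / n := by push_cast at hs2; linarith
          rw [abs_of_nonneg (by linarith [hs.1])]
          exact max_lt hδ (by simpa using lt_of_le_of_lt this hst))
      exact this.le
  refine (Finset.sum_le_sum this).trans (le_of_eq ?_)
  simp; field_simp

lemma hh_param (f f' : ℝ → ℝ → ℝ) (hf : Continuous (fun p : ℝ × ℝ => f p.1 p.2))
    (hf' : Continuous (fun p : ℝ × ℝ => f' p.1 p.2)) (a b k x : ℝ) (hk : 0 ≤ k)
    (hx : x ∈ Set.Ioo a b)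
    (h : ∀ y ∈ Set.Ioo a b, ∀ s ∈ Set.Icc 0 k, HasDerivAt (fun y => f y s) (f' y s) y) :
    HasDerivAt (fun y => ∫ s in (0:ℝ)..k, f y s) (∫ s in (0:ℝ)..k, f' x s) x := by
  obtain ⟨C, hC⟩ := ((isCompact_Icc (a := a) (b := b)).prod
    (isCompact_Icc (a := (0:ℝ)) (b := k))).exists_bound_of_continuousOn hf'.continuousOn
  have c1 (y : ℝ) : Continuous (f y) := hf.comp (by fun_prop : Continuous fun s : ℝ => (y, s))
  have c2 (y : ℝ) : Continuous (f' y) := hf'.comp (by fun_prop : Continuous fun s : ℝ => (y, s))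
  refine (intervalIntegral.hasDerivAt_integral_of_dominated_loc_of_deriv_le
    (bound := fun _ => C) (Ioo_mem_nhds hx.1 hx.2) (.of_forall fun y => (c1 y).aestronglyMeasurable)
    ((c1 x).intervalIntegrable _ _) (c2 x).aestronglyMeasurable (.of_forall ?_) (by simp)
    (.of_forall ?_)).2
  · intro s hs y hy
    rw [Set.uIoc_of_le hk] at hs
    exact hC (y, s) ⟨⟨hy.1.le, hy.2.le⟩, ⟨hs.1.le, hs.2⟩⟩
  · intro s hs y hy
    rw [Set.uIoc_of_le hk] at hs
    exact h y hy s ⟨hs.1.le, hs.2⟩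

lemma hh_swap {E : Type*} [NormedAddCommGroup E] [NormedSpace ℝ E] (f : ℝ → ℝ → E)
    (hf : Continuous (fun p : ℝ × ℝ => f p.1 p.2)) (a b c d : ℝ) :
    ∫ x in a..b, ∫ y in c..d, f x y = ∫ y in c..d, ∫ x in a..b, f x y := by
  apply MeasureTheory.intervalIntegral_intervalIntegral_swap
  have : IntegrableOn (Function.uncurry f) (Set.uIcc a b ×ˢ Set.uIcc c d) :=
    hf.continuousOn.integrableOn_compact (isCompact_uIcc.prod isCompact_uIcc)
  exact this.mono_set (Set.prod_mono Set.uIoc_subset_uIcc Set.uIoc_subset_uIcc)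

lemma hh_shift (g : ℝ → ℝ) (hg : Continuous g) (h x : ℝ) :
    HasDerivAt (fun y => ∫ ξ in (0:ℝ)..h, g (y + ξ)) (g (x + h) - g x) x := by
  have e : (fun y => ∫ ξ in (0:ℝ)..h, g (y + ξ)) =
      fun y => (∫ z in (0:ℝ)..(y + h), g z) - ∫ z in (0:ℝ)..y, g z := by
    funext y
    rw [intervalIntegral.integral_comp_add_left (fun z => g z),
      intervalIntegral.integral_interval_sub_left (hg.intervalIntegrable _ _)
        (hg.intervalIntegrable _ _)]
    simp
  rw [e]
  have d (z : ℝ) := hg.integral_hasStrictDerivAt 0 z |>.hasDerivAt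
  exact ((d (x + h)).comp_add_const x h).sub (d x)

lemma hh_core (D K : ℝ) (hD : 0 < D) (hK : 0 < K) (θ θx q : ℝ → ℝ → ℝ) (α β σ : ℝ)
    (hθ : Continuous (fun p : ℝ × ℝ => θ p.1 p.2))
    (hθx : Continuous (fun p : ℝ × ℝ => θx p.1 p.2))
    (hP : ∀ x ∈ Set.Ioo α β, ∀ t ∈ Set.Ioi σ,
      HasDerivAt (fun y => θ y t) (θx x t) x ∧ HasDerivAt (fun y => θx y t) (q x t) x ∧
      HasDerivAt (fun s => θ x s) (D * q x t - K * θx x t) t)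
    (a h s k : ℝ) (hh : 0 < h) (hk : 0 < k) (ha : α < a) (hb : a + h < β) (hs : σ < s) :
    (∫ ξ in (0:ℝ)..h, (θ (a + ξ) (s + k) - θ (a + ξ) s))
      + K * (∫ τ in (0:ℝ)..k, (θ (a + h) (s + τ) - θ a (s + τ)))
      - D * (∫ τ in (0:ℝ)..k, (θx (a + h) (s + τ) - θx a (s + τ))) ≤ 0 := by
  have cθ {X : Type} [TopologicalSpace X] (f g : X → ℝ) (hf : Continuous f) (hg : Continuous g) :
    Continuous fun x => θ (f x) (g x) := hθ.comp (hf.prodMk hg)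
  have cθx {X : Type} [TopologicalSpace X] (f g : X → ℝ) (hf : Continuous f) (hg : Continuous g) :
    Continuous fun x => θx (f x) (g x) := hθx.comp (hf.prodMk hg)
  set ut : ℝ → ℝ → ℝ := fun x t => ∫ ξ in (0:ℝ)..h, (θ (x + ξ) (t + k) - θ (x + ξ) t) with hut
  set ux : ℝ → ℝ → ℝ := fun x t => ∫ τ in (0:ℝ)..k, (θ (x + h) (t + τ) - θ x (t + τ)) with hux
  set uxx : ℝ → ℝ → ℝ := fun x t => ∫ τ in (0:ℝ)..k, (θx (x + h) (t + τ) - θx x (t + τ)) with huxx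
  set u : ℝ → ℝ → ℝ := fun x t => ∫ ξ in (0:ℝ)..h, ∫ τ in (0:ℝ)..k, θ (x + ξ) (t + τ) with hu
  change ut a s + K * ux a s - D * uxx a s ≤ 0
  have cu1 : Continuous fun z : (ℝ × ℝ) × ℝ => ∫ τ in (0:ℝ)..k, θ (z.1.1 + z.2) (z.1.2 + τ) := by
    apply intervalIntegral.continuous_parametric_intervalIntegral_of_continuous'
    apply cθ <;> fun_prop
  have cu : Continuous fun p : ℝ × ℝ => u p.1 p.2 := by
    apply intervalIntegral.continuous_parametric_intervalIntegral_of_continuous'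
    exact cu1
  have cut : Continuous fun p : ℝ × ℝ => ut p.1 p.2 := by
    apply intervalIntegral.continuous_parametric_intervalIntegral_of_continuous'
    apply Continuous.sub <;> apply cθ <;> fun_prop
  have cux : Continuous fun p : ℝ × ℝ => ux p.1 p.2 := by
    apply intervalIntegral.continuous_parametric_intervalIntegral_of_continuous'
    apply Continuous.sub <;> apply cθ <;> fun_prop
  have cuxx : Continuous fun p : ℝ × ℝ => uxx p.1 p.2 := by
    apply intervalIntegral.continuous_parametric_intervalIntegral_of_continuous'
    apply Continuous.sub <;> apply cθx <;> fun_prop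
  have dut (x t : ℝ) : HasDerivAt (fun r => u x r) (ut x t) t := by
    refine hh_param (fun r ξ => ∫ τ in (0:ℝ)..k, θ (x + ξ) (r + τ))
      (fun r ξ => θ (x + ξ) (r + k) - θ (x + ξ) r) ?_ ?_ (t - 1) (t + 1) h t hh.le
      ⟨by linarith, by linarith⟩ ?_
    · exact cu1.comp (by fun_prop : Continuous fun p : ℝ × ℝ => ((x, p.1), p.2))
    · apply Continuous.sub <;> apply cθ <;> fun_prop
    · intro r _ ξ _
      exact hh_shift (fun z => θ (x + ξ) z) (cθ _ _ (by fun_prop) (by fun_prop)) k r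
  have dux (x t : ℝ) : HasDerivAt (fun r => u r t) (ux x t) x := by
    have e : (fun r => u r t) =
        fun r => ∫ τ in (0:ℝ)..k, ∫ ξ in (0:ℝ)..h, θ (r + ξ) (t + τ) := by
      funext r
      exact hh_swap (fun ξ τ => θ (r + ξ) (t + τ)) (by apply cθ <;> fun_prop) _ _ _ _
    rw [e]
    refine hh_param (fun r τ => ∫ ξ in (0:ℝ)..h, θ (r + ξ) (t + τ))
      (fun r τ => θ (r + h) (t + τ) - θ r (t + τ)) ?_ ?_ (x - 1) (x + 1) k x hk.le
      ⟨by linarith, by linarith⟩ ?_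
    · apply intervalIntegral.continuous_parametric_intervalIntegral_of_continuous'
      apply cθ <;> fun_prop
    · apply Continuous.sub <;> apply cθ <;> fun_prop
    · intro r _ τ _
      exact hh_shift (fun z => θ z (t + τ)) (cθ _ _ (by fun_prop) (by fun_prop)) h r
  have duxx (x t : ℝ) (hx : α < x) (hx' : x + h < β) (ht : σ < t) :
      HasDerivAt (fun r => ux r t) (uxx x t) x := by
    refine hh_param (fun r τ => θ (r + h) (t + τ) - θ r (t + τ))
      (fun r τ => θx (r + h) (t + τ) - θx r (t + τ)) ?_ ?_ α (β - h) k x hk.le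
      ⟨by linarith, by linarith⟩ ?_
    · apply Continuous.sub <;> apply cθ <;> fun_prop
    · apply Continuous.sub <;> apply cθx <;> fun_prop
    · intro r hr τ hτ
      have h1 : σ < t + τ := by linarith [hτ.1]
      exact ((hP (r + h) ⟨by linarith [hr.1], by linarith [hr.2]⟩ (t + τ) h1).1.comp_add_const r h).sub
        (hP r ⟨by linarith [hr.1], by linarith [hr.2]⟩ (t + τ) h1).1
  by_contra hpos
  push Not at hpos
  obtain ⟨c, hc0, hc⟩ := exists_between hpos
  have ev : ∀ᶠ p : ℝ × ℝ in nhds (a, s),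
      c < ut p.1 p.2 + K * ux p.1 p.2 - D * uxx p.1 p.2 ∧ α < p.1 ∧ p.1 + h < β ∧ σ < p.2 := by
    have c0 : Continuous fun p : ℝ × ℝ => ut p.1 p.2 + K * ux p.1 p.2 - D * uxx p.1 p.2 := by
      fun_prop
    have c1 : Continuous fun p : ℝ × ℝ => p.1 + h := by fun_prop
    filter_upwards [(c0.tendsto (a, s)).eventually_const_lt hc,
      (continuous_fst.tendsto (a, s)).eventually_const_lt ha,
      (c1.tendsto (a, s)).eventually_lt_const hb,
      (continuous_snd.tendsto (a, s)).eventually_const_lt hs] with p h1 h2 h3 h4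
    exact ⟨h1, h2, h3, h4⟩
  obtain ⟨ρ, hρ, hball⟩ := Metric.eventually_nhds_iff.1 ev
  have hbox : ∀ x ∈ Set.Ioo (a - ρ) (a + ρ), ∀ t ∈ Set.Ioo (s - ρ) (s + ρ),
      c < ut x t + K * ux x t - D * uxx x t ∧ α < x ∧ x + h < β ∧ σ < t := by
    intro x hx t ht
    refine hball (y := (x, t)) ?_
    rw [Prod.dist_eq, Real.dist_eq, Real.dist_eq]
    exact max_lt (abs_lt.2 ⟨by simp; linarith [hx.1], by simp; linarith [hx.2]⟩)
      (abs_lt.2 ⟨by simp; linarith [ht.1], by simp; linarith [ht.2]⟩)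
  set η := c / (2 * (2 * ρ + 2 * K * ρ + 2 * D)) with hη
  have hη0 : 0 < η := by positivity
  have hηc : η * (2 * ρ + 2 * K * ρ + 2 * D) < c := by
    have : η * (2 * ρ + 2 * K * ρ + 2 * D) = c / 2 := by rw [hη]; field_simp
    linarith
  set B := Set.Icc (a - ρ) (a + ρ) ×ˢ Set.Icc (s - ρ) (s + ρ)
  have hB : IsCompact B := isCompact_Icc.prod isCompact_Icc
  set δ := η * ρ ^ 2 / 8 with hδ
  have hδ0 : 0 < δ := by positivity
  obtain ⟨n, hn, Hn⟩ := hh_riem B hB (fun p ξ => ∫ τ in (0:ℝ)..k, θ (p.1 + ξ) (p.2 + τ)) cu1 h δ hh hδ0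
  obtain ⟨m, hm, Hm⟩ := hh_riem B hB
    (fun p τ => ∑ i ∈ Finset.range n, (h / n) * θ (p.1 + i * (h / n)) (p.2 + τ))
    (by
      refine continuous_finsetSum _ fun i _ => continuous_const.mul ?_
      apply cθ <;> fun_prop) k δ hk hδ0
  have hnr : (0:ℝ) < n := by exact_mod_cast hn
  have hmr : (0:ℝ) < m := by exact_mod_cast hm
  have hi (i : ℕ) (hi : i ∈ Finset.range n) : 0 ≤ (i:ℝ) * (h / n) ∧ (i:ℝ) * (h / n) ≤ h := by
    refine ⟨by positivity, ?_⟩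
    have : (i:ℝ) ≤ n := by exact_mod_cast (Finset.mem_range.1 hi).le
    calc (i:ℝ) * (h / n) ≤ n * (h / n) := by gcongr
      _ = h := by field_simp
  have hj (j : ℕ) : 0 ≤ (j:ℝ) * (k / m) := by positivity
  let S : (ℝ → ℝ → ℝ) → ℝ → ℝ → ℝ := fun F x t => ∑ j ∈ Finset.range m, (k / m) *
    ∑ i ∈ Finset.range n, (h / n) * F (x + i * (h / n)) (t + j * (k / m))
  have hSv : ∀ x t, (x, t) ∈ B → |S θ x t - u x t| ≤ 2 * δ := by
    intro x t hxt
    have h1 := Hn _ hxt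
    have h2 := Hm _ hxt
    have e : (∫ τ in (0:ℝ)..k, ∑ i ∈ Finset.range n, (h / n) * θ (x + i * (h / n)) (t + τ)) =
        ∑ i ∈ Finset.range n, (h / n) * ∫ τ in (0:ℝ)..k, θ (x + i * (h / n)) (t + τ) := by
      rw [intervalIntegral.integral_finsetSum]
      · simp only [intervalIntegral.integral_const_mul]
      · intro i _
        apply Continuous.intervalIntegrable
        exact continuous_const.mul (cθ _ _ (by fun_prop) (by fun_prop))
    simp only [e] at h2
    simp only at h1
    rw [abs_le] at *
    constructor <;> simp only [S, hu] <;> linarith [h1.1, h1.2, h2.1, h2.2]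
  refine hh_visc D K c ρ η (2 * δ) a s hD hK hρ hη0 hηc (by rw [hδ]; nlinarith [hδ0])
    (fun x t => S θ x t - u x t) (fun x t => S θx x t - ux x t) (fun x t => S q x t - uxx x t)
    (fun x t => S (fun x t => D * q x t - K * θx x t) x t - ut x t) ?_ ?_ ?_
  · refine Continuous.sub ?_ cu
    refine continuous_finsetSum _ fun j _ => continuous_const.mul ?_
    refine continuous_finsetSum _ fun i _ => continuous_const.mul ?_
    apply cθ <;> fun_prop
  · intro x hx t ht
    obtain ⟨b1, b2, b3, b4⟩ := hbox x hx t ht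
    have hp (i j : ℕ) (h' : i ∈ Finset.range n) := hP (x + i * (h / n))
      ⟨by linarith [(hi i h').1], by linarith [(hi i h').2]⟩ (t + j * (k / m))
      (show σ < _ by linarith [hj j])
    refine ⟨.sub ?_ (dux x t), .sub ?_ (duxx x t b2 b3 b4), .sub ?_ (dut x t), ?_⟩
    · exact HasDerivAt.fun_sum fun j _ => (HasDerivAt.fun_sum fun i h' =>
        ((hp i j h').1.comp_add_const x _).const_mul _).const_mul _
    · exact HasDerivAt.fun_sum fun j _ => (HasDerivAt.fun_sum fun i h' =>
        ((hp i j h').2.1.comp_add_const x _).const_mul _).const_mul _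
    · exact HasDerivAt.fun_sum fun j _ => (HasDerivAt.fun_sum fun i h' =>
        ((hp i j h').2.2.comp_add_const t _).const_mul _).const_mul _
    · have : S (fun x t => D * q x t - K * θx x t) x t = D * S q x t - K * S θx x t := by
        simp only [S, Finset.mul_sum, ← Finset.sum_sub_distrib]
        refine Finset.sum_congr rfl fun j _ => Finset.sum_congr rfl fun i _ => ?_
        ring
      simp only [this]
      linarith
  · intro x hx t ht
    exact hSv x t ⟨hx, ht⟩

lemma hh_core_eq (D K : ℝ) (hD : 0 < D) (hK : 0 < K) (θ θx q : ℝ → ℝ → ℝ) (α β σ : ℝ)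
    (hθ : Continuous (fun p : ℝ × ℝ => θ p.1 p.2))
    (hθx : Continuous (fun p : ℝ × ℝ => θx p.1 p.2))
    (hP : ∀ x ∈ Set.Ioo α β, ∀ t ∈ Set.Ioi σ,
      HasDerivAt (fun y => θ y t) (θx x t) x ∧ HasDerivAt (fun y => θx y t) (q x t) x ∧
      HasDerivAt (fun s => θ x s) (D * q x t - K * θx x t) t)
    (a h s k : ℝ) (hh : 0 < h) (hk : 0 < k) (ha : α < a) (hb : a + h < β) (hs : σ < s) :
    (∫ ξ in (0:ℝ)..h, (θ (a + ξ) (s + k) - θ (a + ξ) s))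
      + K * (∫ τ in (0:ℝ)..k, (θ (a + h) (s + τ) - θ a (s + τ)))
      - D * (∫ τ in (0:ℝ)..k, (θx (a + h) (s + τ) - θx a (s + τ))) = 0 := by
  have h1 := hh_core D K hD hK θ θx q α β σ hθ hθx hP a h s k hh hk ha hb hs
  have h2 := hh_core D K hD hK (fun x t => -θ x t) (fun x t => -θx x t) (fun x t => -q x t) α β σ
    hθ.neg hθx.neg (fun x hx t ht => by
      obtain ⟨p1, p2, p3⟩ := hP x hx t ht
      exact ⟨p1.fun_neg, p2.fun_neg, p3.fun_neg.congr_deriv (by ring)⟩) a h s k hh hk ha hb hs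
  simp only [neg_sub_neg] at h2
  have e (F : ℝ → ℝ) (G : ℝ → ℝ) (b : ℝ) : ∫ x in (0:ℝ)..b, (F x - G x) =
      - ∫ x in (0:ℝ)..b, (G x - F x) := by
    rw [← intervalIntegral.integral_neg]; simp
  rw [e, e (fun τ => θ a (s + τ)), e (fun τ => θx a (s + τ))] at h2
  linarith

lemma hh_increment (D K L : ℝ) (hD : 0 < D) (hK : 0 < K) (hL : 0 < L) (θ θx q : ℝ → ℝ → ℝ) (σ : ℝ)
    (hθ : Continuous (fun p : ℝ × ℝ => θ p.1 p.2))
    (hθx : Continuous (fun p : ℝ × ℝ => θx p.1 p.2))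
    (hP : ∀ x ∈ Set.Ioo 0 L, ∀ t ∈ Set.Ioi σ,
      HasDerivAt (fun y => θ y t) (θx x t) x ∧ HasDerivAt (fun y => θx y t) (q x t) x ∧
      HasDerivAt (fun s => θ x s) (D * q x t - K * θx x t) t)
    (l : ℂ) (s k : ℝ) (hk : 0 < k) (hs : σ < s) :
    hatTheta L θ l (s + k) - hatTheta L θ l s = ∫ τ in (0:ℝ)..k,
      (Complex.exp (-Complex.I * l * (L : ℂ)) * (Complex.I * l * (D : ℂ) - (K : ℂ)) * (θ L (s + τ) : ℂ)
        - (Complex.I * l * (D : ℂ) - (K : ℂ)) * (θ 0 (s + τ) : ℂ)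
        + (D : ℂ) * (Complex.exp (-Complex.I * l * (L : ℂ)) * (θx L (s + τ) : ℂ) - (θx 0 (s + τ) : ℂ))
        - omegaF D K l * hatTheta L θ l (s + τ)) := by
  have cθ {X : Type} [TopologicalSpace X] (f g : X → ℝ) (hf : Continuous f) (hg : Continuous g) :
    Continuous fun x => θ (f x) (g x) := hθ.comp (hf.prodMk hg)
  have cθx {X : Type} [TopologicalSpace X] (f g : X → ℝ) (hf : Continuous f) (hg : Continuous g) :
    Continuous fun x => θx (f x) (g x) := hθx.comp (hf.prodMk hg)
  set W : ℝ → ℝ := fun x => ∫ τ in (0:ℝ)..k, θ x (s + τ) with hW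
  set W1 : ℝ → ℝ := fun x => ∫ τ in (0:ℝ)..k, θx x (s + τ) with hW1
  set φ : ℝ → ℂ := fun x => Complex.exp (-Complex.I * l * (x : ℂ)) with hφ
  have cW : Continuous W := by
    apply intervalIntegral.continuous_parametric_intervalIntegral_of_continuous'
    apply cθ <;> fun_prop
  have cW1 : Continuous W1 := by
    apply intervalIntegral.continuous_parametric_intervalIntegral_of_continuous'
    apply cθx <;> fun_prop
  have cφ : Continuous φ := by fun_prop
  set Δ : ℝ → ℝ := fun x => θ x (s + k) - θ x s with hΔ
  have cΔ : Continuous Δ := by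
    apply Continuous.sub <;> apply cθ <;> fun_prop
  have dφ (x : ℝ) : HasDerivAt φ (-Complex.I * l * φ x) x := by
    have := (((Complex.ofRealCLM.hasDerivAt (x := x)).const_mul (-Complex.I * l))).cexp
    simp only [Complex.ofRealCLM_apply] at this
    convert this using 1
    simp [hφ]; ring
  have dW (x : ℝ) (hx : x ∈ Set.Ioo 0 L) : HasDerivAt W (W1 x) x := by
    refine hh_param (fun x τ => θ x (s + τ)) (fun x τ => θx x (s + τ)) ?_ ?_ 0 L k x hk.le hx ?_
    · apply cθ <;> fun_prop
    · apply cθx <;> fun_prop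
    · intro y hy τ hτ
      exact (hP y hy (s + τ) (show σ < _ by linarith [hτ.1])).1
  set G : ℝ → ℝ := fun x => D * W1 x - K * W x with hG
  have cG : Continuous G := by fun_prop
  have hGinc (a b : ℝ) (ha : 0 < a) (hab : a < b) (hb : b < L) : G b = G a + ∫ y in a..b, Δ y := by
    have := hh_core_eq D K hD hK θ θx q 0 L σ hθ hθx hP a (b - a) s k (by linarith) hk ha
      (by linarith) hs
    have e1 : (∫ ξ in (0:ℝ)..(b - a), (θ (a + ξ) (s + k) - θ (a + ξ) s)) = ∫ y in a..b, Δ y := by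
      rw [intervalIntegral.integral_comp_add_left (fun z => Δ z)]
      simp
    have ab : a + (b - a) = b := by ring
    have j1 (x : ℝ) : IntervalIntegrable (fun τ => θ x (s + τ)) volume 0 k :=
      (cθ _ _ (by fun_prop) (by fun_prop)).intervalIntegrable _ _
    have j2 (x : ℝ) : IntervalIntegrable (fun τ => θx x (s + τ)) volume 0 k :=
      (cθx _ _ (by fun_prop) (by fun_prop)).intervalIntegrable _ _
    rw [e1, ab, intervalIntegral.integral_sub (j1 b) (j1 a),
      intervalIntegral.integral_sub (j2 b) (j2 a)] at this
    simp only [hG, hW, hW1]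
    linarith
  have dG (x : ℝ) (hx : x ∈ Set.Ioo 0 L) : HasDerivAt G (Δ x) x := by
    have d := (cΔ.integral_hasStrictDerivAt (x / 2) x).hasDerivAt.const_add (G (x / 2))
    refine d.congr_of_eventuallyEq ?_
    filter_upwards [Ioo_mem_nhds (show x / 2 < x by linarith [hx.1]) hx.2] with y hy
    exact hGinc (x / 2) y (by linarith [hx.1]) hy.1 hy.2
  have hmm : Set.Ioo (min 0 L) (max 0 L) = Set.Ioo 0 L := by
    rw [min_eq_left hL.le, max_eq_right hL.le]
  have ib1 := intervalIntegral.integral_mul_deriv_eq_deriv_mul_of_hasDerivAt (a := 0) (b := L)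
    (u := φ) (v := fun x => (G x : ℂ)) (u' := fun x => -Complex.I * l * φ x)
    (v' := fun x => (Δ x : ℂ)) cφ.continuousOn (by fun_prop)
    (fun x _ => dφ x) (fun x hx => (dG x (hmm ▸ hx)).ofReal_comp)
    (Continuous.intervalIntegrable (by fun_prop) _ _)
    (Continuous.intervalIntegrable (by fun_prop) _ _)
  have ib2 := intervalIntegral.integral_mul_deriv_eq_deriv_mul_of_hasDerivAt (a := 0) (b := L)
    (u := φ) (v := fun x => (W x : ℂ)) (u' := fun x => -Complex.I * l * φ x)
    (v' := fun x => (W1 x : ℂ)) cφ.continuousOn (by fun_prop)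
    (fun x _ => dφ x) (fun x hx => (dW x (hmm ▸ hx)).ofReal_comp)
    (Continuous.intervalIntegrable (by fun_prop) _ _)
    (Continuous.intervalIntegrable (by fun_prop) _ _)
  simp only [mul_assoc (-Complex.I * l), intervalIntegral.integral_const_mul] at ib1 ib2
  have eG : ∫ x in (0:ℝ)..L, φ x * (G x : ℂ) =
      D * (∫ x in (0:ℝ)..L, φ x * (W1 x : ℂ)) - K * ∫ x in (0:ℝ)..L, φ x * (W x : ℂ) := by
    rw [← intervalIntegral.integral_const_mul, ← intervalIntegral.integral_const_mul,
      ← intervalIntegral.integral_sub]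
    · congr 1; funext x; simp only [hG]; push_cast; ring
    all_goals exact Continuous.intervalIntegrable (by fun_prop) _ _
  have cE : Continuous fun p : ℝ × ℝ => φ p.1 * (θ p.1 p.2 : ℂ) := by fun_prop
  have cH : Continuous fun τ => hatTheta L θ l τ := by
    apply intervalIntegral.continuous_parametric_intervalIntegral_of_continuous'
    exact cE.comp (by fun_prop : Continuous fun p : ℝ × ℝ => (p.2, p.1))
  have eW : ∫ x in (0:ℝ)..L, φ x * (W x : ℂ) = ∫ τ in (0:ℝ)..k, hatTheta L θ l (s + τ) := by
    have := hh_swap (fun x τ => φ x * (θ x (s + τ) : ℂ))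
      (cE.comp (by fun_prop : Continuous fun p : ℝ × ℝ => (p.1, s + p.2))) 0 L 0 k
    simp only [intervalIntegral.integral_const_mul, intervalIntegral.integral_ofReal] at this
    exact this
  have eL : hatTheta L θ l (s + k) - hatTheta L θ l s = ∫ x in (0:ℝ)..L, φ x * (Δ x : ℂ) := by
    unfold hatTheta
    rw [← intervalIntegral.integral_sub]
    · congr 1; funext x; simp only [hΔ]; push_cast; ring
    · exact (cE.comp (by fun_prop : Continuous fun x : ℝ => (x, s + k))).intervalIntegrable _ _
    · exact (cE.comp (by fun_prop : Continuous fun x : ℝ => (x, s))).intervalIntegrable _ _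
  have φ0 : φ 0 = 1 := by simp [hφ]
  have i1 (x : ℝ) : Continuous fun τ : ℝ => (θ x (s + τ) : ℂ) :=
    Complex.continuous_ofReal.comp (cθ _ _ (by fun_prop) (by fun_prop))
  have i2 (x : ℝ) : Continuous fun τ : ℝ => (θx x (s + τ) : ℂ) :=
    Complex.continuous_ofReal.comp (cθx _ _ (by fun_prop) (by fun_prop))
  have i3 : Continuous fun τ : ℝ => hatTheta L θ l (s + τ) := cH.comp (by fun_prop)
  rw [intervalIntegral.integral_sub, intervalIntegral.integral_add, intervalIntegral.integral_sub]
  · simp only [intervalIntegral.integral_const_mul]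
    rw [intervalIntegral.integral_sub]
    · simp only [intervalIntegral.integral_const_mul, intervalIntegral.integral_ofReal]
      rw [eL, ib1, eG, ib2, ← eW, φ0]
      simp only [hG, omegaF]
      push_cast
      simp only [hφ, hW, hW1]
      linear_combination (D * l ^ 2 * (∫ x in (0:ℝ)..L, φ x * (W x : ℂ))) * Complex.I_sq
    all_goals exact Continuous.intervalIntegrable (by fun_prop) _ _
  all_goals exact Continuous.intervalIntegrable (by fun_prop) _ _

lemma hh_main (D K L : ℝ) (hD : 0 < D) (hK : 0 < K) (hL : 0 < L) (θ θx q : ℝ → ℝ → ℝ) (σ : ℝ)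
    (hθ : Continuous (fun p : ℝ × ℝ => θ p.1 p.2))
    (hθx : Continuous (fun p : ℝ × ℝ => θx p.1 p.2))
    (hP : ∀ x ∈ Set.Ioo 0 L, ∀ t ∈ Set.Ioi σ,
      HasDerivAt (fun y => θ y t) (θx x t) x ∧ HasDerivAt (fun y => θx y t) (q x t) x ∧
      HasDerivAt (fun s => θ x s) (D * q x t - K * θx x t) t)
    (l : ℂ) (t : ℝ) (ht : σ < t) :
    HasDerivAt (fun τ => hatTheta L θ l τ)
      (Complex.exp (-Complex.I * l * (L : ℂ)) * (Complex.I * l * (D : ℂ) - (K : ℂ)) * (θ L t : ℂ)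
        - (Complex.I * l * (D : ℂ) - (K : ℂ)) * (θ 0 t : ℂ)
        + (D : ℂ) * (Complex.exp (-Complex.I * l * (L : ℂ)) * (θx L t : ℂ) - (θx 0 t : ℂ))
        - omegaF D K l * hatTheta L θ l t) t := by
  set R : ℝ → ℂ := fun t =>
    (Complex.exp (-Complex.I * l * (L : ℂ)) * (Complex.I * l * (D : ℂ) - (K : ℂ)) * (θ L t : ℂ)
        - (Complex.I * l * (D : ℂ) - (K : ℂ)) * (θ 0 t : ℂ)
        + (D : ℂ) * (Complex.exp (-Complex.I * l * (L : ℂ)) * (θx L t : ℂ) - (θx 0 t : ℂ))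
        - omegaF D K l * hatTheta L θ l t) with hR
  change HasDerivAt _ (R t) t
  have cR : Continuous R := by
    have i1 (x : ℝ) : Continuous fun τ : ℝ => (θ x τ : ℂ) :=
      Complex.continuous_ofReal.comp (hθ.comp (by fun_prop : Continuous fun τ : ℝ => (x, τ)))
    have i2 (x : ℝ) : Continuous fun τ : ℝ => (θx x τ : ℂ) :=
      Complex.continuous_ofReal.comp (hθx.comp (by fun_prop : Continuous fun τ : ℝ => (x, τ)))
    have cH : Continuous fun τ => hatTheta L θ l τ := by
      apply intervalIntegral.continuous_parametric_intervalIntegral_of_continuous'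
      have cE : Continuous fun p : ℝ × ℝ =>
        Complex.exp (-Complex.I * l * (p.1 : ℂ)) * (θ p.1 p.2 : ℂ) := by fun_prop
      exact cE.comp (by fun_prop : Continuous fun p : ℝ × ℝ => (p.2, p.1))
    fun_prop
  obtain ⟨s, hs, hst⟩ := exists_between ht
  have d := (cR.integral_hasStrictDerivAt s t).hasDerivAt.const_add (hatTheta L θ l s)
  refine d.congr_of_eventuallyEq ?_
  filter_upwards [Ioi_mem_nhds hst] with r hr
  have hr' : s < r := hr
  have := hh_increment D K L hD hK hL θ θx q σ hθ hθx hP l s (r - s) (by linarith) hs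
  have e : (∫ τ in (0:ℝ)..(r - s), R (s + τ)) = ∫ y in s..r, R y := by
    rw [intervalIntegral.integral_comp_add_left (fun z => R z)]
    simp
  rw [← e, ← sub_eq_iff_eq_add']
  rw [show s + (r - s) = r by ring] at this
  exact this

theorem statement_2
    (D₀ K₀ L : ℝ) (hD : 0 < D₀) (hK : 0 < K₀) (hL : 0 < L)
    (θ θx : ℝ → ℝ → ℝ) (θ₀ f g : ℝ → ℝ)
    (hsol : IsClassicalSolution D₀ K₀ L θ θx θ₀ f g)
    (l : ℂ) (t : ℝ) (ht : 0 < t) :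
    HasDerivAt (fun τ => hatTheta L θ l τ)
      (Complex.exp (-Complex.I * l * (L : ℂ)) * (Complex.I * l * (D₀ : ℂ) - (K₀ : ℂ)) * (g t : ℂ)
        - (Complex.I * l * (D₀ : ℂ) - (K₀ : ℂ)) * (f t : ℂ)
        + (D₀ : ℂ) * (Complex.exp (-Complex.I * l * (L : ℂ)) * (θx L t : ℂ) - (θx 0 t : ℂ))
        - omegaF D₀ K₀ l * hatTheta L θ l t) t := by
  obtain ⟨h1, -, h3, h4, -, hf, hg⟩ := hsol
  obtain ⟨σ, hσ, hσt⟩ := exists_between ht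
  set cx : ℝ → ℝ := fun x => max 0 (min x L) with hcx
  set ct : ℝ → ℝ := fun t => max σ t with hct
  have ccx : Continuous cx := by fun_prop
  have cct : Continuous ct := by fun_prop
  have mx (x : ℝ) : cx x ∈ Set.Icc 0 L :=
    ⟨le_max_left _ _, max_le hL.le (min_le_right _ _)⟩
  have mt (r : ℝ) : 0 < ct r := lt_of_lt_of_le hσ (le_max_left _ _)
  have ex (x : ℝ) (hx : x ∈ Set.Icc 0 L) : cx x = x := by
    simp only [hcx]; rw [min_eq_left hx.2, max_eq_right hx.1]
  have et (r : ℝ) (hr : σ < r) : ct r = r := max_eq_right hr.le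
  have hc1 : Continuous fun p : ℝ × ℝ => θ (cx p.1) (ct p.2) :=
    h1.comp_continuous (f := fun p : ℝ × ℝ => (cx p.1, ct p.2)) (by fun_prop)
      fun p => ⟨mx _, (mt _).le⟩
  have hc2 : Continuous fun p : ℝ × ℝ => θx (cx p.1) (ct p.2) :=
    h3.comp_continuous (f := fun p : ℝ × ℝ => (cx p.1, ct p.2)) (by fun_prop)
      fun p => ⟨mx _, mt _⟩
  have key := hh_main D₀ K₀ L hD hK hL (fun x t => θ (cx x) (ct t)) (fun x t => θx (cx x) (ct t))
    (fun x t => deriv (fun x' => θx x' t) x) σ hc1 hc2 (by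
      intro x hx r hr
      have hr' : σ < r := hr
      obtain ⟨p1, p2, p3⟩ := h4 x hx r (show 0 < r by linarith)
      have evx : ∀ᶠ y in nhds x, cx y = y := by
        filter_upwards [Ioo_mem_nhds hx.1 hx.2] with y hy
        exact ex y ⟨hy.1.le, hy.2.le⟩
      have evt : ∀ᶠ y in nhds r, ct y = y := by
        filter_upwards [Ioi_mem_nhds hr'] with y hy
        exact et y hy
      have exx := evx.self_of_nhds
      have ett := et r hr'
      simp only [exx, ett]
      refine ⟨p1.congr_of_eventuallyEq ?_, p2.hasDerivAt.congr_of_eventuallyEq ?_,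
        p3.congr_of_eventuallyEq ?_⟩
      · filter_upwards [evx] with y hy
        rw [hy]
      · filter_upwards [evx] with y hy
        rw [hy]
      · filter_upwards [evt] with y hy
        rw [hy]) l t hσt
  have hhat (r : ℝ) (hr : σ < r) :
      hatTheta L (fun x t => θ (cx x) (ct t)) l r = hatTheta L θ l r := by
    unfold hatTheta
    refine intervalIntegral.integral_congr fun x hx => ?_
    rw [Set.uIcc_of_le hL.le] at hx
    simp only [ex x hx, et r hr]
  have e0 : cx 0 = 0 := ex 0 ⟨le_rfl, hL.le⟩
  have eL : cx L = L := ex L ⟨hL.le, le_rfl⟩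
  simp only [hhat t hσt, e0, eL, et t hσt, hf t ht, hg t ht] at key
  refine key.congr_of_eventuallyEq ?_
  filter_upwards [Ioi_mem_nhds hσt] with r hr
  exact (hhat r hr).symm
end

section
/- The zero set of the entire function λ ↦ ω(λ)Δ(λ) is exactly {0, −iK₀/D₀} ∪ { nπ/L − iK₀/(2D₀) : n ∈ ℤ }. In particular, every zero of ω·Δ other than λ = 0 has strictly negative imaginary part, and Δ(λ) ≠ 0 for every λ with Im λ ≥ 0. -/
theorem delta_iff_aux (D₀ K₀ L : ℝ) (hD : 0 < D₀) (hL : 0 < L) (l : ℂ) :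
    deltaF D₀ K₀ L l = 0 ↔ ∃ n : ℤ, ((n : ℂ) * (Real.pi : ℂ) / (L : ℂ)
      - Complex.I * ((K₀ : ℂ) / (2 * (D₀ : ℂ)))) = l := by
  have hD' : (D₀ : ℂ) ≠ 0 := by exact_mod_cast hD.ne'
  have hL' : (L : ℂ) ≠ 0 := by exact_mod_cast hL.ne'
  have h2 : (K₀ : ℂ) / (2 * (D₀ : ℂ)) = (K₀ : ℂ) / D₀ / 2 := by field_simp
  unfold deltaF nuF
  rw [sub_eq_zero, Complex.exp_eq_exp_iff_exists_int, h2]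
  generalize (K₀ : ℂ) / D₀ = c
  constructor
  · rintro ⟨n, hn⟩
    refine ⟨-n, ?_⟩
    have e : Complex.I * (-(2 * l * L) - Complex.I * c * L) = Complex.I * (2 * n * Real.pi) := by
      linear_combination hn
    have e' := mul_left_cancel₀ Complex.I_ne_zero e
    push_cast
    field_simp
    linear_combination e'
  · rintro ⟨n, rfl⟩
    refine ⟨-n, ?_⟩
    push_cast
    field_simp
    ring

theorem im_aux (D₀ K₀ L : ℝ) (n : ℤ) : ((n : ℂ) * (Real.pi : ℂ) / (L : ℂ)
      - Complex.I * ((K₀ : ℂ) / (2 * (D₀ : ℂ)))).im = -(K₀ / (2 * D₀)) := by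
  have : ((n : ℂ) * (Real.pi : ℂ) / (L : ℂ) - Complex.I * ((K₀ : ℂ) / (2 * (D₀ : ℂ))))
    = ((n * Real.pi / L : ℝ) : ℂ) - Complex.I * ((K₀ / (2 * D₀) : ℝ) : ℂ) := by push_cast; rfl
  rw [this, Complex.sub_im, Complex.ofReal_im, Complex.I_mul_im, Complex.ofReal_re]
  ring

theorem omega_iff_aux (D₀ K₀ : ℝ) (hD : 0 < D₀) (l : ℂ) :
    omegaF D₀ K₀ l = 0 ↔ l = 0 ∨ l = -Complex.I * ((K₀ : ℂ) / (D₀ : ℂ)) := by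
  have hD' : (D₀ : ℂ) ≠ 0 := by exact_mod_cast hD.ne'
  have : omegaF D₀ K₀ l = D₀ * (l * (l - -Complex.I * ((K₀ : ℂ) / (D₀ : ℂ)))) := by
    unfold omegaF
    field_simp
    ring
  rw [this, mul_eq_zero, mul_eq_zero, sub_eq_zero]
  simp [hD']

/-- The zero set of λ ↦ ω(λ)Δ(λ) is exactly {0, −iK₀/D₀} ∪ {nπ/L − iK₀/(2D₀) : n ∈ ℤ};
every zero other than 0 has strictly negative imaginary part, and Δ(λ) ≠ 0 whenever Im λ ≥ 0. -/
theorem statement_6 (D₀ K₀ L : ℝ) (hD : 0 < D₀) (hK : 0 < K₀) (hL : 0 < L) :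
    ({l : ℂ | omegaF D₀ K₀ l * deltaF D₀ K₀ L l = 0} =
      ({0, -Complex.I * ((K₀ : ℂ) / (D₀ : ℂ))} ∪
        Set.range (fun n : ℤ =>
          ((n : ℂ) * (Real.pi : ℂ) / (L : ℂ) - Complex.I * ((K₀ : ℂ) / (2 * (D₀ : ℂ))))))) ∧
    (∀ l : ℂ, omegaF D₀ K₀ l * deltaF D₀ K₀ L l = 0 → l ≠ 0 → l.im < 0) ∧
    (∀ l : ℂ, 0 ≤ l.im → deltaF D₀ K₀ L l ≠ 0) := by
  have him : 0 < K₀ / (2 * D₀) := by positivity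
  have him2 : 0 < K₀ / D₀ := by positivity
  refine ⟨?_, ?_, ?_⟩
  · ext l
    simp only [Set.mem_setOf_eq, mul_eq_zero, omega_iff_aux D₀ K₀ hD, delta_iff_aux D₀ K₀ L hD hL,
      Set.mem_union, Set.mem_insert_iff, Set.mem_singleton_iff, Set.mem_range]
  · intro l h h0
    rw [mul_eq_zero, omega_iff_aux D₀ K₀ hD, delta_iff_aux D₀ K₀ L hD hL] at h
    rcases h with (h | h) | ⟨n, rfl⟩
    · exact absurd h h0
    · rw [h, ← Complex.ofReal_div, neg_mul, Complex.neg_im, Complex.I_mul_im, Complex.ofReal_re]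
      linarith
    · rw [im_aux]
      linarith
  · intro l h h0
    rw [delta_iff_aux D₀ K₀ L hD hL] at h0
    obtain ⟨n, rfl⟩ := h0
    rw [im_aux] at h
    linarith
end
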